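/- arXiv:2108.00991 — 3 statements merged into one kernel-verified Lean document; each statement's English description precedes it below -/
import Mathlib

section
/- For every 0 < ε ≤ 10^{−10} and all reals d, λ ≥ 1000ε, there exist a positive integer M_0 (depending only on ε) and n_0 such that for every n ≥ n_0, every two-coloring of the edges of K_n satisfies at least one of the following. Case 1: there exist a positive integer M ≤ M_0, a real c ≥ (1−ε)/M, an integer m ≥ (2/3+λ)M/2, a color (red or blue), and pairwise disjoint vertex subsets U_1,…,U_m,V_1,…,V_m, each of size at least cn, such that every pair (U_i,V_i) is ε-regular in the graph of that color with edge density at least d−ε in that color, and the union of all the sets U_i and V_i is (200M,6)-well-connected in the graph of that color. Case 2: the coloring is an extremal coloring with parameter 1000(d+λ+√ε). -/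
open Finset

/-- A path copy as a sequence: `k` distinct vertices with consecutive vertices adjacent. -/
def IsPathSeq {V : Type*} (G : SimpleGraph V) (k : ℕ) (f : Fin k → V) : Prop :=
  Function.Injective f ∧ ∀ (i : Fin k) (h : i.val + 1 < k), G.Adj (f i) (f ⟨i.val + 1, h⟩)

/-- Number of copies of the path `P_k` in `G` (sequences identified with their reversals). -/
noncomputable def pathCount {V : Type*} (G : SimpleGraph V) (k : ℕ) : ℕ :=
  Nat.card {f : Fin k → V // IsPathSeq G k f} / 2

/-- A cycle copy as a cyclic sequence: `k` distinct vertices, cyclically consecutive adjacent. -/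
def IsCycleSeq {V : Type*} (G : SimpleGraph V) (k : ℕ) (f : Fin k → V) : Prop :=
  Function.Injective f ∧ ∀ i : Fin k, G.Adj (f i) (f ⟨(i.val + 1) % k, Nat.mod_lt _ i.pos⟩)

/-- Number of copies of the cycle `C_k` in `G` (identified up to rotation and reflection). -/
noncomputable def cycleCount {V : Type*} (G : SimpleGraph V) (k : ℕ) : ℕ :=
  Nat.card {f : Fin k → V // IsCycleSeq G k f} / (2 * k)

/-- The red graph of the coloring `χ(a,b)`: complete bipartite between the first `a`
vertices and the remaining `b` vertices. The blue graph is its complement. -/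
def chiRed (a b : ℕ) : SimpleGraph (Fin (a + b)) :=
  SimpleGraph.fromRel (fun x y => (x.val < a) ≠ (y.val < a))

/-- Number of neighbors of `x` inside the set `Y`. -/
noncomputable def nbrCount {V : Type*} (G : SimpleGraph V) (x : V) (Y : Finset V) : ℕ :=
  Nat.card {y : V // y ∈ Y ∧ G.Adj x y}

/-- `e(X,Y)`: number of pairs in `X × Y` that are edges. -/
noncomputable def eCnt {V : Type*} (G : SimpleGraph V) (X Y : Finset V) : ℕ :=
  Nat.card {p : V × V // p.1 ∈ X ∧ p.2 ∈ Y ∧ G.Adj p.1 p.2}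

/-- Edge density `d(X,Y) = e(X,Y)/(|X||Y|)`. -/
noncomputable def dens {V : Type*} (G : SimpleGraph V) (X Y : Finset V) : ℝ :=
  (eCnt G X Y : ℝ) / ((X.card : ℝ) * (Y.card : ℝ))

/-- `(X,Y)` is an `ε`-regular pair in `G`. -/
def IsRegularPair {V : Type*} (G : SimpleGraph V) (X Y : Finset V) (ε : ℝ) : Prop :=
  ∀ U, U ⊆ X → ∀ W, W ⊆ Y → ε * X.card ≤ (U.card : ℝ) → ε * Y.card ≤ (W.card : ℝ) →
    |dens G U W - dens G X Y| ≤ ε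

/-- `W` is `(t,l)`-well-connected in `G`: any two distinct vertices of `W` are joined by
at least `t` internally vertex-disjoint paths of length at most `l`. -/
def WellConnected {V : Type*} (G : SimpleGraph V) (W : Set V) (t l : ℕ) : Prop :=
  ∀ u ∈ W, ∀ v ∈ W, u ≠ v →
    ∃ P : Fin t → G.Walk u v, Function.Injective P ∧
      (∀ i, (P i).IsPath ∧ (P i).length ≤ l) ∧
      (∀ i j, i ≠ j → ∀ x, x ∈ (P i).support → x ∈ (P j).support → x = u ∨ x = v)

/-- Extremal coloring with parameter `α` (the red graph is `R`, blue is `Rᶜ`). -/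
def IsExtremalColoring {V : Type*} [Fintype V] [DecidableEq V] (R : SimpleGraph V) (α : ℝ) : Prop :=
  ∃ A : Finset V,
    (2/3 - α) * (Fintype.card V : ℝ) ≤ (A.card : ℝ) ∧
    (1/3 - α) * (Fintype.card V : ℝ) ≤ ((Aᶜ).card : ℝ) ∧
    ((1 - α ≤ dens R A A ∧ 1 - α ≤ dens Rᶜ A Aᶜ) ∨
     (1 - α ≤ dens Rᶜ A A ∧ 1 - α ≤ dens R A Aᶜ))

/-- A path of length `l` in `G[A,B]`: `l+1` distinct vertices alternating between the
parts `A` and `B`, with consecutive vertices adjacent in `G`. -/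
def IsAltPath {Ω : Type*} (G : SimpleGraph Ω) (A B : Finset Ω) (l : ℕ) (f : Fin (l + 1) → Ω) : Prop :=
  Function.Injective f ∧
  (∀ i : Fin (l + 1), f i ∈ A ∨ f i ∈ B) ∧
  (∀ (i : Fin (l + 1)) (h : i.val + 1 < l + 1),
    G.Adj (f i) (f ⟨i.val + 1, h⟩) ∧
    ((f i ∈ A ∧ f ⟨i.val + 1, h⟩ ∈ B) ∨ (f i ∈ B ∧ f ⟨i.val + 1, h⟩ ∈ A)))

/-- A path with `k` vertices alternating between `V` and `U`, starting in `V`. -/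
def IsBipPathFromV {Ω : Type*} (G : SimpleGraph Ω) (U V : Finset Ω) (k : ℕ) (f : Fin k → Ω) : Prop :=
  Function.Injective f ∧
  (∀ i : Fin k, (i.val % 2 = 0 → f i ∈ V) ∧ (i.val % 2 = 1 → f i ∈ U)) ∧
  (∀ (i : Fin k) (h : i.val + 1 < k), G.Adj (f i) (f ⟨i.val + 1, h⟩))

def StabConn {V : Type*} (G : SimpleGraph V) (W : Finset V) : Prop :=
  ∃ p : V → V, (∀ x ∈ W, G.Adj x (p x)) ∧
    ∀ x ∈ W, ∀ y ∈ W, ∃ w : G.Walk (p x) (p y), 1 ≤ w.length ∧ w.length ≤ 4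

open Classical in
theorem stab_hall {V : Type*} [Fintype V] (G : SimpleGraph V) (θ : ℝ)
    (hθ : θ ≤ Fintype.card V) :
    (∃ (m : ℕ) (f g : Fin m → V), θ ≤ m ∧ f.Injective ∧ g.Injective ∧ ∀ i, G.Adj (f i) (g i)) ∨
    ∃ T R : Finset V, Disjoint T R ∧ (#R : ℝ) + Fintype.card V - θ ≤ #T ∧
      ∀ x ∈ T, ∀ y, G.Adj x y → y ∈ R := by
  set k := Fintype.card V with hk
  set m := ⌈θ⌉₊ with hm
  have hmk : m ≤ k := Nat.ceil_le.2 hθ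
  let N : V → Finset V := fun x => univ.filter (G.Adj x)
  let t : V → Finset (V ⊕ Fin (k - m)) := fun x => (N x).disjSum univ
  by_cases hall : ∀ S : Finset V, #S ≤ #(S.biUnion t)
  · left
    obtain ⟨f, hf, hft⟩ := (Finset.all_card_le_biUnion_card_iff_exists_injective t).1 hall
    let I : Finset V := univ.filter (fun x => (f x).isLeft)
    let J : Finset V := univ.filter (fun x => ¬ (f x).isLeft)
    have hIJ : #I + #J = k := by
      rw [hk, ← Finset.card_univ]; exact Finset.card_filter_add_card_filter_not _
    have hJ : #J ≤ k - m := by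
      have : #J ≤ #((univ : Finset (Fin (k - m))).map ⟨Sum.inr, Sum.inr_injective⟩ : Finset (V ⊕ Fin (k-m))) := by
        apply Finset.card_le_card_of_injOn f
        · intro x hx
          simp only [J, coe_filter, Set.mem_ofPred_eq, mem_univ, true_and] at hx
          rcases hfx : f x with a | b
          · simp [hfx] at hx
          · simp
        · exact hf.injOn
      simpa using this
    have hI : m ≤ #I := by omega
    have hleft : ∀ i : Fin #I, ∃ y, f (I.equivFin.symm i : V) = Sum.inl y := by
      intro i
      have := (I.equivFin.symm i).2
      simp only [I, mem_filter, mem_univ, true_and] at this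
      exact Sum.isLeft_iff.1 this
    choose g hg using hleft
    refine ⟨#I, fun i => (I.equivFin.symm i : V), g, ?_, ?_, ?_, ?_⟩
    · exact (Nat.le_ceil θ).trans (by exact_mod_cast hI)
    · intro a b h
      exact I.equivFin.symm.injective (Subtype.ext h)
    · intro a b h
      have : f (I.equivFin.symm a : V) = f (I.equivFin.symm b : V) := by rw [hg, hg, h]
      exact I.equivFin.symm.injective (Subtype.ext (hf this))
    · intro i
      have := hft (I.equivFin.symm i : V)
      rw [hg] at this
      simpa [t, N] using this
  · right
    push Not at hall
    obtain ⟨S, hS⟩ := hall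
    have hSne : S.Nonempty := by
      rw [Finset.nonempty_iff_ne_empty]; rintro rfl; simp at hS
    let NS := S.biUnion N
    have hbi : S.biUnion t = NS.disjSum univ := by
      ext z
      rcases z with a | b
      · simp [t, NS]
      · simp [t]; exact hSne
    rw [hbi, Finset.card_disjSum] at hS
    simp only [card_univ, Fintype.card_fin] at hS
    refine ⟨S \ NS, NS \ S, ?_, ?_, ?_⟩
    · rw [Finset.disjoint_left]; intro x hx hx'
      simp at hx hx'; exact hx'.2 hx.1
    · have h1 := Finset.card_sdiff_add_card_inter S NS
      have h2 := Finset.card_sdiff_add_card_inter NS S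
      rw [Finset.inter_comm] at h2
      by_cases hθ0 : θ < 0
      · have : m = 0 := Nat.ceil_eq_zero.2 hθ0.le
        have := Finset.card_le_univ S
        omega
      · have hc := Nat.ceil_lt_add_one (not_lt.1 hθ0)
        have h3 : #(NS \ S) + (k - m) + 1 ≤ #(S \ NS) := by omega
        have h4 : ((#(NS \ S) + (k - m) + 1 : ℕ) : ℝ) ≤ #(S \ NS) := by exact_mod_cast h3
        push_cast [hmk] at h4
        linarith
    · intro x hx y hy
      simp only [mem_sdiff, NS, mem_biUnion, N, mem_filter, mem_univ, true_and, not_exists, not_and] at hx ⊢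
      exact ⟨⟨x, hx.1, hy⟩, fun hyS => hx.2 y hyS hy.symm⟩

open Classical in
theorem stab_nb {V : Type*} [Fintype V] (red blue : SimpleGraph V) (K : ℝ) (x : V)
    (hm : (#(univ.filter fun y => y ≠ x ∧ ¬ red.Adj x y ∧ ¬ blue.Adj x y) : ℝ) ≤ K)
    (S : Finset V) :
    (#(S.filter fun y => ¬ blue.Adj x y) : ℝ) ≤ #(S.filter fun y => red.Adj x y) + K + 1 := by
  have h : S.filter (fun y => ¬ blue.Adj x y) ⊆ (S.filter fun y => red.Adj x y) ∪
      (univ.filter fun y => y ≠ x ∧ ¬ red.Adj x y ∧ ¬ blue.Adj x y) ∪ {x} := by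
    intro y hy
    simp only [mem_filter, mem_union, mem_univ, true_and, mem_singleton] at hy ⊢
    tauto
  have h2 := (card_le_card h).trans (card_union_le _ _)
  have h3 := card_union_le (S.filter fun y => red.Adj x y) (univ.filter fun y => y ≠ x ∧ ¬ red.Adj x y ∧ ¬ blue.Adj x y)
  rw [card_singleton] at h2
  have h5 : #(S.filter fun y => ¬ blue.Adj x y) ≤ #(S.filter fun y => red.Adj x y) +
      #(univ.filter fun y => y ≠ x ∧ ¬ red.Adj x y ∧ ¬ blue.Adj x y) + 1 := by omega
  have h4 := (Nat.cast_le (α := ℝ)).2 h5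
  rw [Nat.cast_add, Nat.cast_add, Nat.cast_one] at h4
  linarith

open Classical in
theorem stab_one {V : Type*} [Fintype V] (red blue : SimpleGraph V) (K : ℝ) (x : V)
    (hm : (#(univ.filter fun y => y ≠ x ∧ ¬ red.Adj x y ∧ ¬ blue.Adj x y) : ℝ) ≤ K)
    (S : Finset V) (hS : K + 1 < #S) (hr : ∀ y ∈ S, ¬ red.Adj x y) :
    ∃ y ∈ S, blue.Adj x y := by
  by_contra! hcon
  have h := stab_nb red blue K x hm S
  rw [Finset.filter_true_of_mem hcon, Finset.filter_false_of_mem hr] at h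
  simp at h; linarith

open Classical in
theorem stab_two {V : Type*} [Fintype V] (red blue : SimpleGraph V) (K : ℝ) (x x' : V)
    (hm : (#(univ.filter fun y => y ≠ x ∧ ¬ red.Adj x y ∧ ¬ blue.Adj x y) : ℝ) ≤ K)
    (hm' : (#(univ.filter fun y => y ≠ x' ∧ ¬ red.Adj x' y ∧ ¬ blue.Adj x' y) : ℝ) ≤ K)
    (S : Finset V) (hS : 2 * K + 2 < #S) (hr : ∀ y ∈ S, ¬ red.Adj x y) (hr' : ∀ y ∈ S, ¬ red.Adj x' y) :
    ∃ y ∈ S, blue.Adj x y ∧ blue.Adj x' y := by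
  by_contra! hcon
  have h := stab_nb red blue K x hm S
  have h' := stab_nb red blue K x' hm' S
  rw [Finset.filter_false_of_mem hr] at h
  rw [Finset.filter_false_of_mem hr'] at h'
  have hsub : S ⊆ S.filter (fun y => ¬ blue.Adj x y) ∪ S.filter (fun y => ¬ blue.Adj x' y) := by
    intro y hy
    have := hcon y hy
    simp only [mem_union, mem_filter]; tauto
  have h2 := (card_le_card hsub).trans (card_union_le _ _)
  have h3 : (#S : ℝ) ≤ #(S.filter (fun y => ¬ blue.Adj x y)) + #(S.filter (fun y => ¬ blue.Adj x' y)) := by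
    exact_mod_cast h2
  simp only [card_empty, Nat.cast_zero] at h h'
  linarith

open Classical in
theorem stab_conn {V : Type*} [Fintype V] (red blue : SimpleGraph V) (V0 : Finset V) (K : ℝ)
    (hK : 10 ≤ K) (hk : 100 * K ≤ Fintype.card V) (hV0 : (#V0ᶜ : ℝ) ≤ K)
    (hm : ∀ x ∈ V0, (#(univ.filter fun y => y ≠ x ∧ ¬ red.Adj x y ∧ ¬ blue.Adj x y) : ℝ) ≤ K) :
    (∃ W, W ⊆ V0 ∧ (#Wᶜ : ℝ) ≤ 10 * K ∧ StabConn red W) ∨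
    (∃ W, W ⊆ V0 ∧ (#Wᶜ : ℝ) ≤ 10 * K ∧ StabConn blue W) := by
  by_cases hL : ∃ l ∈ V0, (#(univ.filter fun y => red.Adj l y) : ℝ) ≤ 4 * K
  · right
    obtain ⟨l, hl, hdeg⟩ := hL
    have hnb := stab_nb red blue K l (hm l hl) univ
    refine ⟨V0.filter (fun y => blue.Adj l y), filter_subset _ _, ?_, fun _ => l, ?_, ?_⟩
    · have hsub : (V0.filter (fun y => blue.Adj l y))ᶜ ⊆ V0ᶜ ∪ univ.filter (fun y => ¬ blue.Adj l y) := by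
        intro y; simp; tauto
      have h2 : (#((V0.filter (fun y => blue.Adj l y))ᶜ) : ℝ) ≤ #V0ᶜ + #(univ.filter (fun y => ¬ blue.Adj l y)) := by
        exact_mod_cast (card_le_card hsub).trans (card_union_le _ _)
      linarith
    · intro x hx; exact ((mem_filter.1 hx).2).symm
    · intro _ _ _ _
      have : ∃ z, blue.Adj l z := by
        by_contra! hcon
        rw [Finset.filter_true_of_mem (fun y _ => hcon y), card_univ] at hnb
        linarith
      obtain ⟨z, hz⟩ := this
      exact ⟨.cons hz (.cons hz.symm .nil), by simp, by simp⟩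
  push Not at hL
  have hdeg : ∀ x ∈ V0, 3 * K < #(V0.filter fun y => red.Adj x y) := by
    intro x hx
    have hsub : univ.filter (fun y => red.Adj x y) ⊆ V0ᶜ ∪ V0.filter (fun y => red.Adj x y) := by
      intro y; simp; tauto
    have h2 : (#(univ.filter (fun y => red.Adj x y)) : ℝ) ≤ #V0ᶜ + #(V0.filter (fun y => red.Adj x y)) := by
      exact_mod_cast (card_le_card hsub).trans (card_union_le _ _)
    have := hL x hx
    linarith
  by_cases hw : ∀ x ∈ V0, ∀ y ∈ V0, ∃ w : red.Walk x y, 1 ≤ w.length ∧ w.length ≤ 4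
  · left
    have hp : ∀ x, ∃ z, x ∈ V0 → z ∈ V0 ∧ red.Adj x z := by
      intro x
      by_cases hx : x ∈ V0
      · have : 0 < #(V0.filter fun y => red.Adj x y) := by
          have := hdeg x hx
          exact_mod_cast (by linarith : (0:ℝ) < #(V0.filter fun y => red.Adj x y))
        obtain ⟨z, hz⟩ := card_pos.1 this
        exact ⟨z, fun _ => mem_filter.1 hz⟩
      · exact ⟨x, fun h => (hx h).elim⟩
    choose p hp using hp
    exact ⟨V0, subset_rfl, by linarith, p, fun x hx => (hp x hx).2,
      fun x hx y hy => hw _ (hp x hx).1 _ (hp y hy).1⟩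
  · right
    push Not at hw
    obtain ⟨x, hx, y, hy, hxy⟩ := hw
    set P := V0.filter fun z => red.Adj x z with hP
    set Q := V0.filter fun z => red.Adj y z with hQ
    have hPc : 3 * K < #P := hdeg x hx
    have hQc : 3 * K < #Q := hdeg y hy
    have hPQ : ∀ p ∈ P, ∀ q ∈ Q, ¬ red.Adj p q := by
      intro p hp q hq h
      have := hxy (.cons (mem_filter.1 hp).2 (.cons h (.cons (mem_filter.1 hq).2.symm .nil))) (by simp)
      simp at this
    have hz : ∀ z p q, p ∈ P → q ∈ Q → red.Adj z p → ¬ red.Adj z q := by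
      intro z p q hp hq h h'
      have := hxy (.cons (mem_filter.1 hp).2 (.cons h.symm (.cons h' (.cons (mem_filter.1 hq).2.symm .nil)))) (by simp)
      simp at this
    have hpp : ∀ p ∈ P, ∀ p' ∈ P, ∃ q ∈ Q, blue.Adj p q ∧ blue.Adj p' q := by
      intro p hp p' hp'
      exact stab_two red blue K p p' (hm _ (mem_filter.1 hp).1) (hm _ (mem_filter.1 hp').1) Q (by linarith)
        (hPQ p hp) (hPQ p' hp')
    have hqq : ∀ p ∈ Q, ∀ p' ∈ Q, ∃ q ∈ P, blue.Adj p q ∧ blue.Adj p' q := by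
      intro p hp p' hp'
      exact stab_two red blue K p p' (hm _ (mem_filter.1 hp).1) (hm _ (mem_filter.1 hp').1) P (by linarith)
        (fun z hz h => hPQ z hz p hp h.symm) (fun z hz h => hPQ z hz p' hp' h.symm)
    have hp : ∀ z, ∃ p, z ∈ V0 → (p ∈ P ∨ p ∈ Q) ∧ blue.Adj z p := by
      intro z
      by_cases hz0 : z ∈ V0
      · by_cases h : ∃ p ∈ P, red.Adj z p
        · obtain ⟨p, hp, hzp⟩ := h
          obtain ⟨q, hq, hzq⟩ := stab_one red blue K z (hm z hz0) Q (by linarith) (fun q hq => hz z p q hp hq hzp)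
          exact ⟨q, fun _ => ⟨Or.inr hq, hzq⟩⟩
        · push Not at h
          obtain ⟨q, hq, hzq⟩ := stab_one red blue K z (hm z hz0) P (by linarith) h
          exact ⟨q, fun _ => ⟨Or.inl hq, hzq⟩⟩
      · exact ⟨z, fun h => (hz0 h).elim⟩
    choose p hp using hp
    have hpq : ∀ p ∈ P, ∀ q ∈ Q, ∃ w : blue.Walk p q, w.length = 3 := by
      intro p hp q hq
      obtain ⟨q', hq', h1, -⟩ := hpp p hp p hp
      obtain ⟨p', hp', h2, h3⟩ := hqq q' hq' q hq
      exact ⟨.cons h1 (.cons h2 (.cons h3.symm .nil)), by simp⟩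
    refine ⟨V0, subset_rfl, by linarith, p, fun x hx => (hp x hx).2, fun a ha b hb => ?_⟩
    rcases (hp a ha).1 with h1 | h1 <;> rcases (hp b hb).1 with h2 | h2
    · obtain ⟨q, -, h3, h4⟩ := hpp _ h1 _ h2
      exact ⟨.cons h3 (.cons h4.symm .nil), by simp, by simp⟩
    · obtain ⟨w, hw⟩ := hpq _ h1 _ h2
      exact ⟨w, by omega, by omega⟩
    · obtain ⟨w, hw⟩ := hpq _ h2 _ h1
      exact ⟨w.reverse, by simp [hw], by simp [hw]⟩
    · obtain ⟨q, -, h3, h4⟩ := hqq _ h1 _ h2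
      exact ⟨.cons h3 (.cons h4.symm .nil), by simp, by simp⟩

open Classical in
theorem stab_comb {V : Type*} [Fintype V] (red blue : SimpleGraph V) (V0 W : Finset V) (K lam : ℝ)
    (hK : 10 ≤ K) (hk : 1000 * K ≤ Fintype.card V) (hV0 : (#V0ᶜ : ℝ) ≤ K)
    (hm : ∀ x ∈ V0, (#(univ.filter fun y => y ≠ x ∧ ¬ red.Adj x y ∧ ¬ blue.Adj x y) : ℝ) ≤ K)
    (hl0 : 0 ≤ lam) (hl1 : lam ≤ 1 / 100)
    (hWV : W ⊆ V0) (hW : (#Wᶜ : ℝ) ≤ 10 * K) (hconn : StabConn red W) (μ : ℝ)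
    (hμ : μ = lam * Fintype.card V + 20 * K) :
    (∃ G, (G = red ∨ G = blue) ∧ ∃ (W : Finset V) (m : ℕ) (f g : Fin m → V),
      (2 / 3 + lam) * Fintype.card V ≤ m ∧ f.Injective ∧ g.Injective ∧ (∀ i, G.Adj (f i) (g i)) ∧
      (∀ i, f i ∈ W ∧ g i ∈ W) ∧ StabConn G W) ∨
    ∃ A : Finset V, 2 / 3 * Fintype.card V - 3 * μ ≤ #A ∧ 1 / 3 * Fintype.card V - 3 * μ ≤ #Aᶜ ∧
      (((#((A ×ˢ A).filter fun p => red.Adj p.1 p.2) : ℝ) ≤ 10 * μ * Fintype.card V ∧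
        (#((A ×ˢ Aᶜ).filter fun p => blue.Adj p.1 p.2) : ℝ) ≤ 10 * μ * Fintype.card V) ∨
       ((#((A ×ˢ A).filter fun p => blue.Adj p.1 p.2) : ℝ) ≤ 10 * μ * Fintype.card V ∧
        (#((A ×ˢ Aᶜ).filter fun p => red.Adj p.1 p.2) : ℝ) ≤ 10 * μ * Fintype.card V)) := by
  set k : ℝ := (Fintype.card V : ℝ) with hkdef
  have hkpos : 0 < k := by linarith
  have hlk : 0 ≤ lam * k := by positivity
  have hlk1 : lam * k ≤ k / 100 := by nlinarith
  -- the colour graphs restricted to a set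
  let res : SimpleGraph V → Finset V → SimpleGraph V := fun G W =>
    { Adj := fun x y => G.Adj x y ∧ x ∈ W ∧ y ∈ W
      symm := ⟨fun x y h => ⟨h.1.symm, h.2.2, h.2.1⟩⟩
      loopless := ⟨fun x h => G.loopless.irrefl x h.1⟩ }
  have hθ : (2 / 3 + lam) * k ≤ k := by nlinarith
  have hall : ∀ G, (G = red ∨ G = blue) → ∀ W, StabConn G W → 
    (∃ G, (G = red ∨ G = blue) ∧ ∃ (W : Finset V) (m : ℕ) (f g : Fin m → V),
      (2 / 3 + lam) * k ≤ m ∧ f.Injective ∧ g.Injective ∧ (∀ i, G.Adj (f i) (g i)) ∧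
      (∀ i, f i ∈ W ∧ g i ∈ W) ∧ StabConn G W) ∨ 
    ∃ T R : Finset V, Disjoint T R ∧ (#R : ℝ) + 1 / 3 * k - lam * k ≤ #T ∧
      ∀ x ∈ T, ∀ y, G.Adj x y → x ∈ W → y ∈ W → y ∈ R := by
    intro G hG W hc
    rcases stab_hall (res G W) ((2 / 3 + lam) * k) hθ with ⟨m, f, g, h1, h2, h3, h4⟩ | ⟨T, R, h1, h2, h3⟩
    · left
      exact ⟨G, hG, W, m, f, g, h1, h2, h3, fun i => (h4 i).1, fun i => (h4 i).2, hc⟩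
    · right
      exact ⟨T, R, h1, by linarith, fun x hx y h4 h5 h6 => h3 x hx y ⟨h4, h5, h6⟩⟩
  rcases hall red (Or.inl rfl) W hconn with h | ⟨T0, R0, hd0, hc0, hn0⟩
  · exact Or.inl h
  -- clean version of the red dual
  obtain ⟨T, R, hdTR, hcTR, hTW, hWR, hnTR⟩ : ∃ T R : Finset V, Disjoint T R ∧
      (#R : ℝ) + 1 / 3 * k - μ ≤ #T ∧ T ⊆ V0 ∧ (∀ y, y ∉ R → y ∈ V0) ∧
      ∀ x ∈ T, ∀ y, y ∉ R → ¬ red.Adj x y := by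
    refine ⟨T0 ∩ W, R0 ∪ Wᶜ, ?_, ?_, ?_, ?_, ?_⟩
    · rw [Finset.disjoint_left] at hd0 ⊢
      intro x hx; simp at hx ⊢; exact ⟨hd0 hx.1, hx.2⟩
    · have h1 : (#(R0 ∪ Wᶜ) : ℝ) ≤ #R0 + #Wᶜ := by exact_mod_cast card_union_le _ _
      have h2 : T0 ⊆ (T0 ∩ W) ∪ Wᶜ := by intro x hx; simp; tauto
      have h3 : (#T0 : ℝ) ≤ #(T0 ∩ W) + #Wᶜ := by exact_mod_cast (card_le_card h2).trans (card_union_le _ _)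
      linarith
    · exact inter_subset_right.trans hWV
    · intro y hy; simp at hy; exact hWV hy.2
    · intro x hx y hy h
      simp at hx hy
      exact hy.1 (hn0 x hx.1 y h hx.2 hy.2)
  have hTbig : 1 / 3 * k - μ ≤ #T := by
    have : (0:ℝ) ≤ #R := by positivity
    linarith
  have hTbig' : 100 * K ≤ #T := by linarith
  -- blue part
  let Wb : Finset V := univ.filter fun y => ∃ x ∈ T, blue.Adj y x
  have hWb : ∀ y, y ∈ V0 → y ∉ R → y ∈ Wb := by
    intro y hy hyR
    obtain ⟨z, hz, h⟩ := stab_one red blue K y (hm y hy) T (by linarith) (fun x hx h => hnTR x hx y hyR h.symm)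
    simp only [Wb, mem_filter, mem_univ, true_and]
    exact ⟨z, hz, h⟩
  have hTR : ∀ x ∈ T, x ∉ R := fun x hx => Finset.disjoint_left.1 hdTR hx
  have hbc : StabConn blue Wb := by
    have : ∀ y, ∃ x, y ∈ Wb → x ∈ T ∧ blue.Adj y x := by
      intro y
      by_cases hy : y ∈ Wb
      · obtain ⟨x, hx⟩ := (mem_filter.1 hy).2
        exact ⟨x, fun _ => hx⟩
      · exact ⟨y, fun h => (hy h).elim⟩
    choose p hp using this
    refine ⟨p, fun x hx => (hp x hx).2, fun x hx y hy => ?_⟩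
    have h1 := (hp x hx).1
    have h2 := (hp y hy).1
    obtain ⟨z, -, hz1, hz2⟩ := stab_two red blue K (p x) (p y) (hm _ (hTW h1)) (hm _ (hTW h2)) T (by linarith)
      (fun z hz => hnTR _ h1 z (hTR z hz)) (fun z hz => hnTR _ h2 z (hTR z hz))
    exact ⟨.cons hz1 (.cons hz2.symm .nil), by simp, by simp⟩
  rcases hall blue (Or.inr rfl) Wb hbc with h | ⟨T', R', hd', hc', hn'⟩
  · exact Or.inl h
  right
  have hsum : ∀ X Y : Finset V, Disjoint X Y → (#X : ℝ) + #Y ≤ k := by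
    intro X Y h
    rw [hkdef]
    have := Finset.card_union_of_disjoint h
    have h2 := Finset.card_le_univ (X ∪ Y)
    exact_mod_cast this ▸ h2
  have hcompl : ∀ X : Finset V, (#Xᶜ : ℝ) = k - #X := by
    intro X
    have := Finset.card_add_card_compl X
    have h2 : ((#X + #Xᶜ : ℕ) : ℝ) = k := by rw [this]
    push_cast at h2; linarith
  have hs1 := hsum T R hdTR
  have hs2 := hsum T' R' hd'
  have hR0 : (0:ℝ) ≤ #R := by positivity
  have hR0' : (0:ℝ) ≤ #R' := by positivity
  have hprod : ∀ (X Y B C : Finset V) (p : V × V → Prop) (b c : ℝ), 0 ≤ b → 0 ≤ c → (#B : ℝ) ≤ b → (#C : ℝ) ≤ c →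
      (∀ x ∈ X, ∀ y ∈ Y, p (x, y) → x ∈ B ∨ y ∈ C) →
      (#((X ×ˢ Y).filter p) : ℝ) ≤ (b + c) * k := by
    intro X Y B C p b c hb0 hc0 hb hc h
    have hsub : (X ×ˢ Y).filter p ⊆ B ×ˢ univ ∪ univ ×ˢ C := by
      rintro ⟨x, y⟩ hxy
      simp only [mem_filter, mem_product] at hxy
      have := h x hxy.1.1 y hxy.1.2 hxy.2
      simpa using this
    have h2 : (#((X ×ˢ Y).filter p) : ℝ) ≤ #(B ×ˢ (univ : Finset V)) + #((univ : Finset V) ×ˢ C) := by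
      exact_mod_cast (card_le_card hsub).trans (card_union_le _ _)
    rw [card_product, card_product, card_univ] at h2
    push_cast at h2
    rw [← hkdef] at h2
    nlinarith
  by_cases hTR' : T ⊆ R'
  · -- second case
    have hTle : (#T : ℝ) ≤ #R' := by exact_mod_cast card_le_card hTR'
    refine ⟨T', ?_, ?_, Or.inr ⟨?_, ?_⟩⟩
    · linarith
    · rw [hcompl]; linarith
    · refine (hprod T' T' R R _ (2 * μ) (2 * μ) (by linarith) (by linarith) (by linarith) (by linarith) ?_).trans (by nlinarith)
      intro x hx y hy h
      by_contra! hcon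
      exact Finset.disjoint_left.1 hd' hy (hn' x hx y h (hWb x (hWR x hcon.1) hcon.1) (hWb y (hWR y hcon.2) hcon.2))
    · have hC : (#(T'ᶜ \ T) : ℝ) ≤ 6 * μ := by
        have hsub : T ⊆ T'ᶜ := fun x hx => mem_compl.2 fun h => Finset.disjoint_left.1 hd' h (hTR' hx)
        have h1 := Finset.card_sdiff_add_card_eq_card hsub
        have h2 : (#(T'ᶜ \ T) : ℝ) + #T = #T'ᶜ := by exact_mod_cast h1
        rw [hcompl] at h2
        linarith
      refine (hprod T' T'ᶜ R (T'ᶜ \ T) _ (2 * μ) (6 * μ) (by linarith) (by linarith) (by linarith) hC ?_).trans (by nlinarith)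
      intro x hx y hy h
      by_contra! hcon
      have hyT : y ∈ T := by
        by_contra hyT
        exact hcon.2 (mem_sdiff.2 ⟨hy, hyT⟩)
      exact hnTR y hyT x hcon.1 h.symm
  · -- first case
    rw [Finset.not_subset] at hTR'
    obtain ⟨x0, hx0, hx0R⟩ := hTR'
    have hTb : ∀ x ∈ T, x ∈ Wb := fun x hx => hWb x (hTW hx) (hTR x hx)
    have hsmall : (#(T' \ R) : ℝ) ≤ K + 1 := by
      by_contra! hcon
      obtain ⟨y, hy, h⟩ := stab_one red blue K x0 (hm x0 (hTW hx0)) (T' \ R) hcon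
        (fun y hy => hnTR x0 hx0 y (mem_sdiff.1 hy).2)
      rw [mem_sdiff] at hy
      exact hx0R (hn' y hy.1 x0 h.symm (hWb y (hWR y hy.2) hy.2) (hTb x0 hx0))
    have hTR1 : (#(T' \ R) : ℝ) + #(T' ∩ R) = #T' := by
      exact_mod_cast Finset.card_sdiff_add_card_inter T' R
    have hTR2 : (#(T' ∩ R) : ℝ) ≤ #R := by exact_mod_cast card_le_card inter_subset_right
    refine ⟨T, ?_, ?_, Or.inl ⟨?_, ?_⟩⟩
    · linarith
    · rw [hcompl]; linarith
    · rw [Finset.filter_false_of_mem]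
      · simp; nlinarith
      · rintro ⟨x, y⟩ hxy
        rw [mem_product] at hxy
        exact hnTR x hxy.1 y (hTR y hxy.2)
    · have hC : (#(Tᶜ \ (T' ∩ R)) : ℝ) ≤ 6 * μ := by
        have hsub : T' ∩ R ⊆ Tᶜ := fun x hx => mem_compl.2 fun h => hTR x h (mem_inter.1 hx).2
        have h1 := Finset.card_sdiff_add_card_eq_card hsub
        have h2 : (#(Tᶜ \ (T' ∩ R)) : ℝ) + #(T' ∩ R) = #Tᶜ := by exact_mod_cast h1
        rw [hcompl] at h2
        linarith
      refine (hprod T Tᶜ R' (Tᶜ \ (T' ∩ R)) _ (4 * μ) (6 * μ) (by linarith) (by linarith) (by linarith) hC ?_).trans (by nlinarith)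
      intro x hx y hy h
      by_contra! hcon
      have hyT : y ∈ T' ∩ R := by
        by_contra hyT
        exact hcon.2 (mem_sdiff.2 ⟨hy, hyT⟩)
      have hyb : y ∈ Wb := by
        simp only [Wb, mem_filter, mem_univ, true_and]
        exact ⟨x, hx, h.symm⟩
      exact hcon.1 (hn' y (mem_inter.1 hyT).1 x h.symm hyb (hTb x hx))

open Classical in
theorem stab_walk {V α : Type*} [Fintype α] (G : SimpleGraph α) (Γ : SimpleGraph V) (part : V → Finset α)
    (e : ℝ)
    (hE : ∀ X Y, Γ.Adj X Y → ∀ A, A ⊆ part X → ∀ B, B ⊆ part Y → e * #(part X) ≤ #A →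
      e * #(part Y) ≤ #B → ∃ a ∈ A, ∃ b ∈ B, G.Adj a b)
    (F : Finset α) (hF : ∀ X, (#F : ℝ) + 2 * e * #(part X) ≤ #(part X))
    {X Y : V} (w : Γ.Walk X Y) : 1 ≤ w.length → ∀ A, A ⊆ part X → ∀ B, B ⊆ part Y →
      e * #(part X) ≤ #A → e * #(part Y) ≤ #B → (∀ a ∈ A, a ∉ F) → (∀ b ∈ B, b ∉ F) →
      ∃ a ∈ A, ∃ b ∈ B, ∃ q : G.Walk a b, q.length = w.length ∧ ∀ z ∈ q.support, z ∉ F := by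
  induction w with
  | nil => intro h; simp at h
  | @cons X Z Y h w ih =>
    intro _ A hA B hB hAc hBc hAF hBF
    rcases Nat.eq_zero_or_pos w.length with h0 | h0
    · have hZY := SimpleGraph.Walk.eq_of_length_eq_zero h0
      subst hZY
      obtain ⟨a, ha, b, hb, hab⟩ := hE _ _ h A hA B hB hAc hBc
      refine ⟨a, ha, b, hb, .cons hab .nil, by simp [h0], ?_⟩
      intro z hz
      simp at hz
      rcases hz with rfl | rfl
      · exact hAF _ ha
      · exact hBF _ hb
    · let A1 := (part Z \ F).filter fun y => ∃ a ∈ A, G.Adj a y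
      have hA1 : e * #(part Z) ≤ #A1 := by
        by_contra! hcon
        let B1 := (part Z \ F).filter fun y => ¬ ∃ a ∈ A, G.Adj a y
        have h1 : #A1 + #B1 = #(part Z \ F) := Finset.card_filter_add_card_filter_not _
        have h2 : #(part Z) ≤ #(part Z \ F) + #F := by
          have := Finset.le_card_sdiff F (part Z); omega
        have h3 : (#(part Z) : ℝ) ≤ #A1 + #B1 + #F := by
          rw [← h1] at h2; exact_mod_cast h2
        have h4 := hF Z
        obtain ⟨a, ha, b, hb, hab⟩ := hE _ _ h A hA B1 ((filter_subset _ _).trans sdiff_subset) hAc (by linarith)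
        exact (mem_filter.1 hb).2 ⟨a, ha, hab⟩
      obtain ⟨a1, ha1, b, hb, q, hq, hqF⟩ := ih h0 A1 ((filter_subset _ _).trans sdiff_subset) B hB hA1 hBc
        (fun a ha => (mem_sdiff.1 (mem_filter.1 ha).1).2) hBF
      obtain ⟨a, ha, haa⟩ := (mem_filter.1 ha1).2
      refine ⟨a, ha, b, hb, .cons haa q, by simp [hq], ?_⟩
      intro z hz
      rw [SimpleGraph.Walk.support_cons, List.mem_cons] at hz
      rcases hz with rfl | hz
      · exact hAF _ ha
      · exact hqF z hz

open Classical in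
theorem stab_disj {α : Type*} (G : SimpleGraph α) (u v : α) (huv : u ≠ v) (t : ℕ)
    (h : ∀ F : Finset α, #F ≤ 7 * t → ∃ P : G.Walk u v, P.IsPath ∧ P.length ≤ 6 ∧ s(u, v) ∉ P.edges ∧
      ∀ z ∈ P.support, z ∈ F → z = u ∨ z = v) :
    ∃ P : Fin t → G.Walk u v, Function.Injective P ∧
      (∀ i, (P i).IsPath ∧ (P i).length ≤ 6) ∧
      (∀ i j, i ≠ j → ∀ x, x ∈ (P i).support → x ∈ (P j).support → x = u ∨ x = v) := by
  have key : ∀ s, s ≤ t → ∃ P : Fin s → G.Walk u v, 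
      (∀ i, (P i).IsPath ∧ (P i).length ≤ 6 ∧ s(u, v) ∉ (P i).edges) ∧
      (∀ i j, i ≠ j → ∀ x, x ∈ (P i).support → x ∈ (P j).support → x = u ∨ x = v) := by
    intro s
    induction s with
    | zero => intro _; exact ⟨fun i => i.elim0, fun i => i.elim0, fun i => i.elim0⟩
    | succ s ih =>
      intro hs
      obtain ⟨P, hP1, hP2⟩ := ih (by omega)
      let F : Finset α := univ.biUnion fun i => (P i).support.toFinset
      have hF : #F ≤ 7 * t := by
        have : #F ≤ #(univ : Finset (Fin s)) * 7 := by
          apply Finset.card_biUnion_le_card_mul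
          intro i _
          refine (List.toFinset_card_le _).trans ?_
          rw [SimpleGraph.Walk.length_support]
          have := (hP1 i).2.1
          omega
        simp at this; omega
      obtain ⟨Q, hQ1, hQ2, hQ3, hQ4⟩ := h F hF
      have hQF : ∀ i, ∀ x, x ∈ (P i).support → x ∈ Q.support → x = u ∨ x = v := by
        intro i x hx hx'
        apply hQ4 x hx'
        simp only [F, mem_biUnion, mem_univ, true_and, List.mem_toFinset]
        exact ⟨i, hx⟩
      refine ⟨Fin.snoc (α := fun _ => G.Walk u v) P Q, ?_, ?_⟩
      · intro i
        refine Fin.lastCases ?_ (fun i => ?_) i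
        · rw [Fin.snoc_last]; exact ⟨hQ1, hQ2, hQ3⟩
        · rw [Fin.snoc_castSucc]; exact hP1 i
      · intro i j
        refine Fin.lastCases ?_ (fun i => ?_) i <;> refine Fin.lastCases ?_ (fun j => ?_) j
        · intro h; exact (h rfl).elim
        · rw [Fin.snoc_castSucc, Fin.snoc_last]
          intro _ x h1 h2; exact hQF j x h2 h1
        · rw [Fin.snoc_castSucc, Fin.snoc_last]
          intro _ x h1 h2; exact hQF i x h1 h2
        · rw [Fin.snoc_castSucc, Fin.snoc_castSucc]
          intro h; exact hP2 i j (fun h' => h (by rw [h']))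
  obtain ⟨P, hP1, hP2⟩ := key t le_rfl
  refine ⟨P, ?_, fun i => ⟨(hP1 i).1, (hP1 i).2.1⟩, hP2⟩
  have hed : ∀ p : G.Walk u v, (∀ x ∈ p.support, x = u ∨ x = v) → s(u, v) ∈ p.edges := by
    intro p hp
    cases p with
    | nil => exact (huv rfl).elim
    | @cons _ w _ hw q =>
      have : w = u ∨ w = v := hp w (by simp)
      rcases this with rfl | rfl
      · exact (G.loopless.irrefl _ hw).elim
      · simp
  intro i j hij
  by_contra hne
  apply (hP1 i).2.2
  apply hed
  intro x hx
  exact hP2 i j hne x hx (hij ▸ hx)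

open Classical in
theorem stab_well {V α : Type*} [Fintype α] (G : SimpleGraph α) (Γ : SimpleGraph V) (part : V → Finset α)
    (e ε : ℝ) (t : ℕ)
    (hE : ∀ X Y, Γ.Adj X Y → ∀ A, A ⊆ part X → ∀ B, B ⊆ part Y → e * #(part X) ≤ #A →
      e * #(part Y) ≤ #B → ∃ a ∈ A, ∃ b ∈ B, G.Adj a b)
    (hF1 : ∀ X, (7 * t + 2 : ℝ) + 2 * e * #(part X) ≤ #(part X))
    (hF2 : ∀ X, (7 * t + 2 : ℝ) + e * #(part X) ≤ ε * #(part X))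
    (S : Set α) (W : Finset V) (p : V → V)
    (hp : ∀ x ∈ W, ∀ y ∈ W, ∃ w : Γ.Walk (p x) (p y), 1 ≤ w.length ∧ w.length ≤ 4)
    (hS : ∀ u ∈ S, ∃ X ∈ W, ε * #(part (p X)) ≤ #((part (p X)).filter (G.Adj u))) :
    WellConnected G S t 6 := by
  intro u hu v hv huv
  apply stab_disj G u v huv t
  intro F hF
  obtain ⟨X, hX, huX⟩ := hS u hu
  obtain ⟨Y, hY, hvY⟩ := hS v hv
  obtain ⟨w, hw1, hw4⟩ := hp X hX Y hY
  let F' := F ∪ {u, v}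
  have hF' : (#F' : ℝ) ≤ 7 * t + 2 := by
    have h1 : #F' ≤ #F + #({u, v} : Finset α) := card_union_le _ _
    have h2 : #({u, v} : Finset α) ≤ 2 := Finset.card_le_two
    exact_mod_cast (by omega : #F' ≤ 7 * t + 2)
  have hN : ∀ x Z, ε * #(part Z) ≤ #((part Z).filter (G.Adj x)) → e * #(part Z) ≤ #((part Z).filter (G.Adj x) \ F') := by
    intro x Z h
    have h1 := Finset.le_card_sdiff F' ((part Z).filter (G.Adj x))
    have h2 : (#((part Z).filter (G.Adj x)) : ℝ) ≤ #((part Z).filter (G.Adj x) \ F') + #F' := by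
      exact_mod_cast (by omega)
    have := hF2 Z
    linarith
  obtain ⟨a, ha, b, hb, q, hq, hqF⟩ := stab_walk G Γ part e hE F' (fun X => by have := hF1 X; linarith) w hw1
    ((part (p X)).filter (G.Adj u) \ F') (sdiff_subset.trans (filter_subset _ _))
    ((part (p Y)).filter (G.Adj v) \ F') (sdiff_subset.trans (filter_subset _ _))
    (hN _ _ huX) (hN _ _ hvY) (fun a ha => (mem_sdiff.1 ha).2) (fun a ha => (mem_sdiff.1 ha).2)
  rw [mem_sdiff, mem_filter] at ha hb
  have huF : ∀ z, z ∉ F' → z ≠ u ∧ z ≠ v ∧ z ∉ F := by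
    intro z hz; simp [F'] at hz; tauto
  let r : G.Walk u v := .cons ha.1.2 (q.concat hb.1.2.symm)
  have hrs : ∀ z ∈ r.support, z ∈ F → z = u ∨ z = v := by
    intro z hz hzF
    simp only [r, SimpleGraph.Walk.support_cons, SimpleGraph.Walk.support_concat, List.mem_cons,
      List.concat_eq_append, List.mem_append, List.not_mem_nil, or_false] at hz
    rcases hz with h | h | h
    · exact Or.inl h
    · exact ((huF z (hqF z h)).2.2 hzF).elim
    · exact Or.inr h
  have hre : s(u, v) ∉ r.edges := by
    intro h
    simp only [r, SimpleGraph.Walk.edges_cons, SimpleGraph.Walk.edges_concat, List.mem_cons,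
      List.concat_eq_append, List.mem_append, List.not_mem_nil, or_false] at h
    rcases h with h | h | h
    · have := (huF a ha.2)
      simp at h; rcases h with h | h
      · exact this.2.1 h.symm
      · exact this.1 h.1.symm
    · exact (huF u (hqF u (q.fst_mem_support_of_mem_edges h))).1 rfl
    · have := (huF b hb.2)
      simp at h; rcases h with h | h
      · exact this.1 h.symm
      · exact huv h.1
  refine ⟨r.bypass, r.bypass_isPath, r.length_bypass_le_length.trans ?_, fun h => hre (r.edges_bypass_subset_edges h),
    fun z hz => hrs z (r.support_bypass_subset_support hz)⟩
  simp [r]; omega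

open Classical in
theorem stab_eCnt {α : Type*} (G : SimpleGraph α) (X Y : Finset α) :
    eCnt G X Y = #((X ×ˢ Y).filter fun p => G.Adj p.1 p.2) := by
  rw [eCnt]
  apply Nat.subtype_card
  intro p
  simp [mem_product, and_assoc]

open Classical in
theorem stab_eCnt_sum {α : Type*} (G : SimpleGraph α) (X Y : Finset α) :
    eCnt G X Y = ∑ u ∈ X, #(Y.filter (G.Adj u)) := by
  rw [stab_eCnt, Finset.card_filter, Finset.sum_product]
  simp_rw [Finset.card_filter]

open Classical in
theorem stab_dens {α : Type*} (G : SimpleGraph α) (X Y : Finset α) :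
    dens G X Y = (G.edgeDensity X Y : ℝ) := by
  rw [_root_.dens, stab_eCnt, SimpleGraph.edgeDensity_def, SimpleGraph.interedges, Rel.interedges]
  push_cast
  rfl

theorem stab_eCnt_comm {α : Type*} (G : SimpleGraph α) (X Y : Finset α) :
    eCnt G X Y = eCnt G Y X := by
  classical
  rw [stab_eCnt, stab_eCnt]
  apply Finset.card_bij (fun p _ => (p.2, p.1))
  · rintro ⟨a, b⟩ h; simp at h ⊢; exact ⟨⟨h.1.2, h.1.1⟩, h.2.symm⟩
  · rintro ⟨a, b⟩ _ ⟨c, d⟩ _ h; simp at h ⊢; tauto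
  · rintro ⟨a, b⟩ h; refine ⟨(b, a), ?_, rfl⟩; simp at h ⊢; exact ⟨⟨h.1.2, h.1.1⟩, h.2.symm⟩

theorem stab_dens_comm {α : Type*} (G : SimpleGraph α) (X Y : Finset α) :
    dens G X Y = dens G Y X := by
  rw [_root_.dens, _root_.dens, stab_eCnt_comm, mul_comm]

theorem stab_reg_symm {α : Type*} (G : SimpleGraph α) (X Y : Finset α) (e : ℝ)
    (h : IsRegularPair G X Y e) : IsRegularPair G Y X e := by
  intro U hU W hW h1 h2
  rw [stab_dens_comm G U, stab_dens_comm G Y]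
  exact h W hW U hU h2 h1

theorem stab_eCnt_compl {α : Type*} [DecidableEq α] (G : SimpleGraph α) (X Y : Finset α) :
    #X * #Y ≤ eCnt G X Y + eCnt Gᶜ X Y + #(X ∩ Y) := by
  classical
  have e1 : eCnt G X Y = #((X ×ˢ Y).filter fun p => G.Adj p.1 p.2) := by rw [stab_eCnt]
  have e2 : eCnt Gᶜ X Y = #((X ×ˢ Y).filter fun p => Gᶜ.Adj p.1 p.2) := by rw [stab_eCnt]; congr!
  rw [e1, e2, ← card_product]
  have h : X ×ˢ Y ⊆ ((X ×ˢ Y).filter fun p => G.Adj p.1 p.2) ∪ ((X ×ˢ Y).filter fun p => Gᶜ.Adj p.1 p.2) ∪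
      (X ∩ Y).image (fun x => (x, x)) := by
    rintro ⟨a, b⟩ hab
    rw [mem_product] at hab
    simp only [mem_union, mem_filter, mem_product, SimpleGraph.compl_adj, mem_image, mem_inter, Prod.mk.injEq]
    by_cases h1 : a = b
    · subst h1; exact Or.inr ⟨a, hab, rfl, rfl⟩
    · tauto
  have h2 := (card_le_card h).trans (card_union_le _ _)
  have h3 := card_union_le ((X ×ˢ Y).filter fun p => G.Adj p.1 p.2) ((X ×ˢ Y).filter fun p => Gᶜ.Adj p.1 p.2)
  have h4 := card_image_le (s := X ∩ Y) (f := fun x => (x, x))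
  omega

theorem stab_dens_compl {α : Type*} (G : SimpleGraph α) (X Y : Finset α) (hX : 0 < #X) (hY : 0 < #Y)
    (hd : Disjoint X Y) : dens Gᶜ X Y = 1 - dens G X Y := by
  classical
  have := SimpleGraph.edgeDensity_add_edgeDensity_compl G (card_pos.1 hX) (card_pos.1 hY) hd
  have h2 : ((G.edgeDensity X Y : ℚ) : ℝ) + (Gᶜ.edgeDensity X Y : ℚ) = 1 := by exact_mod_cast this
  rw [stab_dens, stab_dens]
  have h3 : ((Gᶜ.edgeDensity X Y : ℚ) : ℝ) = 1 - (G.edgeDensity X Y : ℚ) := by linarith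
  convert h3

theorem stab_reg_compl {α : Type*} (G : SimpleGraph α) (X Y : Finset α) (e : ℝ) (he : 0 < e)
    (hX : 0 < #X) (hY : 0 < #Y)
    (hd : Disjoint X Y) (h : IsRegularPair G X Y e) : IsRegularPair Gᶜ X Y e := by
  intro U hU W hW h1 h2
  have hX' : (0:ℝ) < #X := by exact_mod_cast hX
  have hY' : (0:ℝ) < #Y := by exact_mod_cast hY
  have hU0 : 0 < #U := by
    have : (0:ℝ) < #U := lt_of_lt_of_le (by positivity) h1
    exact_mod_cast this
  have hW0 : 0 < #W := by
    have : (0:ℝ) < #W := lt_of_lt_of_le (by positivity) h2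
    exact_mod_cast this
  rw [stab_dens_compl G X Y hX hY hd, stab_dens_compl G U W hU0 hW0 (hd.mono hU hW)]
  have := h U hU W hW h1 h2
  rw [abs_le] at this ⊢
  constructor <;> linarith

open Classical in
theorem stab_case1 {V : Type*} {n : ℕ} (G : SimpleGraph (Fin n)) (Γ : SimpleGraph V)
    (part : V → Finset (Fin n)) (hdisj : ∀ X Y, X ≠ Y → Disjoint (part X) (part Y))
    (ε d : ℝ) (hε0 : 0 < ε) (hε1 : ε ≤ 1 / 10 ^ 10) (hd : 1000 * ε ≤ d)
    (hΓ : ∀ X Y, Γ.Adj X Y → IsRegularPair G (part X) (part Y) (ε ^ 2) ∧ d ≤ dens G (part X) (part Y))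
    (t : ℕ) (hsize : ∀ X, 2 * (7 * t + 10 : ℝ) ≤ ε * #(part X)) (q : ℝ)
    (hq : ∀ X, 2 * q + 1 ≤ (1 - ε ^ 2) * #(part X)) (W : Finset V) (m : ℕ) (f g : Fin m → V)
    (hf : f.Injective) (hg : g.Injective) (hfg : ∀ i, Γ.Adj (f i) (g i)) (hW : ∀ i, f i ∈ W ∧ g i ∈ W)
    (hc : StabConn Γ W) :
    ∃ Us Vs : Fin m → Finset (Fin n),
      (∀ i j, i ≠ j → Disjoint (Us i) (Us j)) ∧
      (∀ i j, i ≠ j → Disjoint (Vs i) (Vs j)) ∧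
      (∀ i j, Disjoint (Us i) (Vs j)) ∧
      (∀ i, q ≤ ((Us i).card : ℝ) ∧ q ≤ ((Vs i).card : ℝ)) ∧
      (∀ i, IsRegularPair G (Us i) (Vs i) ε ∧ d - ε ≤ dens G (Us i) (Vs i)) ∧
      WellConnected G ((⋃ i, ((Us i : Set (Fin n)))) ∪ ⋃ i, ((Vs i : Set (Fin n)))) t 6 := by
  obtain ⟨p, hp1, hp2⟩ := hc
  have hee : ε ^ 2 ≤ ε / 100 := by nlinarith
  have he0 : 0 < ε ^ 2 := by positivity
  have hsz : ∀ X, (20 : ℝ) / ε ≤ #(part X) := by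
    intro X
    rw [div_le_iff₀ hε0]
    have := hsize X
    have : (0:ℝ) ≤ t := by positivity
    linarith
  have hsz' : ∀ X, (20 : ℝ) ≤ #(part X) := by
    intro X
    refine le_trans ?_ (hsz X)
    rw [le_div_iff₀ hε0]; nlinarith
  let typ : V → Finset (Fin n) := fun X =>
    (part X).filter fun u => ε * #(part (p X)) ≤ #((part (p X)).filter (G.Adj u))
  have htyp : ∀ X ∈ W, (1 - ε ^ 2) * #(part X) ≤ #(typ X) := by
    intro X hX
    by_contra! hcon
    let bad := (part X).filter fun u => ¬ ε * #(part (p X)) ≤ #((part (p X)).filter (G.Adj u))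
    have h1 : #(typ X) + #bad = #(part X) := Finset.card_filter_add_card_filter_not _
    have h1' : (#(typ X) : ℝ) + #bad = #(part X) := by exact_mod_cast h1
    obtain ⟨h2, h3⟩ := hΓ X (p X) (hp1 X hX)
    have hY := hsz' (p X)
    have hX0 := hsz' X
    have hb : ε ^ 2 * #(part X) ≤ #bad := by linarith
    have h4 := h2 bad (filter_subset _ _) (part (p X)) subset_rfl hb (by nlinarith)
    have hbad0 : (0:ℝ) < #bad := lt_of_lt_of_le (by positivity) hb
    have h5 : dens G bad (part (p X)) ≤ ε := by
      rw [_root_.dens, div_le_iff₀ (by positivity), stab_eCnt_sum]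
      push_cast
      calc ∑ u ∈ bad, (#((part (p X)).filter (G.Adj u)) : ℝ) ≤ ∑ u ∈ bad, ε * #(part (p X)) := by
            apply Finset.sum_le_sum
            intro u hu
            exact (not_le.1 (mem_filter.1 hu).2).le
        _ = ε * (#bad * #(part (p X))) := by rw [sum_const, nsmul_eq_mul]; ring
    rw [abs_le] at h4
    linarith
  have hlo : ∀ X, ∃ s ⊆ typ X, #s = #(typ X) / 2 := fun X =>
    Finset.exists_subset_card_eq (Nat.div_le_self _ _)
  choose lo hlo1 hlo2 using hlo
  let hi : V → Finset (Fin n) := fun X => typ X \ lo X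
  have hhi1 : ∀ X, hi X ⊆ typ X := fun X => sdiff_subset
  have htp : ∀ X, typ X ⊆ part X := fun X => filter_subset _ _
  have hcl : ∀ X, (#(typ X) : ℝ) - 1 ≤ 2 * #(lo X) := by
    intro X
    have : #(typ X) ≤ 2 * #(lo X) + 1 := by rw [hlo2]; omega
    have : (#(typ X) : ℝ) ≤ 2 * #(lo X) + 1 := by exact_mod_cast this
    linarith
  have hch : ∀ X, (#(typ X) : ℝ) - 1 ≤ 2 * #(hi X) := by
    intro X
    have h1 : #(hi X) = #(typ X) - #(lo X) := card_sdiff_of_subset (hlo1 X)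
    have : #(typ X) ≤ 2 * #(hi X) + 1 := by rw [h1, hlo2]; omega
    have : (#(typ X) : ℝ) ≤ 2 * #(hi X) + 1 := by exact_mod_cast this
    linarith
  have hbig : ∀ X ∈ W, ∀ c : ℝ, (#(typ X) : ℝ) - 1 ≤ 2 * c → (1 / 3 : ℝ) * #(part X) ≤ c ∧ q ≤ c := by
    intro X hX c hc
    have h1 := htyp X hX
    have h2 := hq X
    have h3 := hsz' X
    refine ⟨?_, by linarith⟩
    nlinarith
  have hd' : ∀ X Y, X ≠ Y → ∀ A B, A ⊆ typ X → B ⊆ typ Y → Disjoint A B := fun X Y h A B hA hB =>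
    (hdisj X Y h).mono (hA.trans (htp X)) (hB.trans (htp Y))
  refine ⟨fun i => lo (f i), fun i => hi (g i), ?_, ?_, ?_, ?_, ?_, ?_⟩
  · intro i j h
    exact hd' _ _ (hf.ne h) _ _ (hlo1 _) (hlo1 _)
  · intro i j h
    exact hd' _ _ (hg.ne h) _ _ (hhi1 _) (hhi1 _)
  · intro i j
    by_cases h : f i = g j
    · show Disjoint (lo (f i)) (hi (g j))
      rw [h]; exact Finset.disjoint_sdiff
    · exact hd' _ _ h _ _ (hlo1 _) (hhi1 _)
  · intro i
    exact ⟨(hbig _ (hW i).1 _ (hcl _)).2, (hbig _ (hW i).2 _ (hch _)).2⟩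
  · intro i
    obtain ⟨h1, h2⟩ := hΓ _ _ (hfg i)
    have hl := (hbig _ (hW i).1 _ (hcl _)).1
    have hh := (hbig _ (hW i).2 _ (hch _)).1
    have hs1 := hsz' (f i)
    have hs2 := hsz' (g i)
    have h3 := h1 (lo (f i)) ((hlo1 _).trans (htp _)) (hi (g i)) ((hhi1 _).trans (htp _)) (by nlinarith) (by nlinarith)
    rw [abs_le] at h3
    refine ⟨?_, by linarith⟩
    intro U hU S hS hU' hS'
    have h4 := h1 U (hU.trans ((hlo1 _).trans (htp _))) S (hS.trans ((hhi1 _).trans (htp _)))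
      (by nlinarith) (by nlinarith)
    rw [abs_le] at h4 ⊢
    constructor <;> linarith
  · apply stab_well G Γ part (ε ^ 2) ε t ?_ ?_ ?_ _ W p hp2 ?_
    · intro X Y hXY A hA B hB hA' hB'
      obtain ⟨h1, h2⟩ := hΓ _ _ hXY
      have h3 := h1 A hA B hB hA' hB'
      rw [abs_le] at h3
      by_contra! hcon
      have h0 : eCnt G A B = 0 := by
        rw [stab_eCnt, card_eq_zero]
        apply Finset.filter_false_of_mem
        rintro ⟨a, b⟩ hab
        rw [mem_product] at hab
        exact hcon a hab.1 b hab.2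
      have : dens G A B = 0 := by rw [_root_.dens, h0]; simp
      linarith
    · intro X
      have := hsize X
      have h3 := hsz' X
      nlinarith
    · intro X
      have := hsize X
      have h3 := hsz' X
      nlinarith
    · intro u hu
      rcases hu with hu | hu
      · obtain ⟨i, hi'⟩ := Set.mem_iUnion.1 hu
        exact ⟨f i, (hW i).1, (mem_filter.1 (hlo1 _ hi')).2⟩
      · obtain ⟨i, hi'⟩ := Set.mem_iUnion.1 hu
        exact ⟨g i, (hW i).2, (mem_filter.1 (hhi1 _ hi')).2⟩

open Classical in
theorem stab_count {V α : Type*} [Fintype V] (G : SimpleGraph α) (Γ : SimpleGraph V)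
    (part : V → Finset α) (good : V → V → Prop) (A B : Finset V) (d s b c : ℝ) (hd : 0 ≤ d)
    (hs : ∀ X, (#(part X) : ℝ) ≤ s)
    (hg : ∀ X Y, X ≠ Y → good X Y → ¬ Γ.Adj X Y → (eCnt G (part X) (part Y) : ℝ) ≤ d * s ^ 2)
    (hb : (#((A ×ˢ B).filter fun p => Γ.Adj p.1 p.2) : ℝ) ≤ b)
    (hc : (#((univ : Finset (V × V)).filter fun p => p.1 ≠ p.2 ∧ ¬ good p.1 p.2) : ℝ) ≤ c) :
    (eCnt G (A.biUnion part) (B.biUnion part) : ℝ) ≤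
      (d * Fintype.card V ^ 2 + b + c + Fintype.card V) * s ^ 2 := by
  have h1 : eCnt G (A.biUnion part) (B.biUnion part) ≤ ∑ p ∈ A ×ˢ B, eCnt G (part p.1) (part p.2) := by
    rw [stab_eCnt]
    simp_rw [stab_eCnt]
    refine le_trans (card_le_card ?_) card_biUnion_le
    rintro ⟨x, y⟩ h
    simp only [mem_filter, mem_product, mem_biUnion] at h ⊢
    obtain ⟨⟨⟨X, hX, hx⟩, ⟨Y, hY, hy⟩⟩, ha⟩ := h
    exact ⟨(X, Y), ⟨hX, hY⟩, ⟨hx, hy⟩, ha⟩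
  have h1' : (eCnt G (A.biUnion part) (B.biUnion part) : ℝ) ≤ ∑ p ∈ A ×ˢ B, (eCnt G (part p.1) (part p.2) : ℝ) := by
    exact_mod_cast h1
  have hall : ∀ X Y, (eCnt G (part X) (part Y) : ℝ) ≤ s ^ 2 := by
    intro X Y
    have : eCnt G (part X) (part Y) ≤ #(part X) * #(part Y) := by
      rw [stab_eCnt, ← card_product]; exact card_filter_le _ _
    have h2 : (eCnt G (part X) (part Y) : ℝ) ≤ #(part X) * #(part Y) := by exact_mod_cast this
    refine h2.trans ?_
    rw [sq]
    exact mul_le_mul (hs X) (hs Y) (by positivity) (le_trans (by positivity) (hs X))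
  have hs2 : 0 ≤ s ^ 2 := sq_nonneg s
  have h2 : ∑ p ∈ A ×ˢ B, (eCnt G (part p.1) (part p.2) : ℝ) ≤
      ∑ p ∈ A ×ˢ B, (d + (if Γ.Adj p.1 p.2 then 1 else 0) + (if p.1 ≠ p.2 ∧ ¬ good p.1 p.2 then 1 else 0)
        + (if p.1 = p.2 then 1 else 0)) * s ^ 2 := by
    apply Finset.sum_le_sum
    rintro ⟨X, Y⟩ -
    have hXY := hall X Y
    have hds : 0 ≤ d * s ^ 2 := by positivity
    by_cases e1 : X = Y
    · simp only [e1, if_true]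
      subst e1
      split_ifs <;> nlinarith
    by_cases e2 : Γ.Adj X Y
    · simp only [e2, if_true]
      split_ifs <;> nlinarith
    by_cases e3 : good X Y
    · have := hg X Y e1 e3 e2
      simp only [e1, e2, e3]
      simpa using this
    · show (eCnt G (part X) (part Y) : ℝ) ≤ (d + (if Γ.Adj X Y then 1 else 0) +
        (if X ≠ Y ∧ ¬ good X Y then 1 else 0) + (if X = Y then 1 else 0)) * s ^ 2
      rw [if_neg e2, if_pos ⟨e1, e3⟩, if_neg e1]
      nlinarith
  refine h1'.trans (h2.trans ?_)
  rw [← Finset.sum_mul]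
  apply mul_le_mul_of_nonneg_right _ hs2
  rw [sum_add_distrib, sum_add_distrib, sum_add_distrib]
  have hA : (#A : ℝ) ≤ Fintype.card V := by exact_mod_cast card_le_univ A
  have hB : (#B : ℝ) ≤ Fintype.card V := by exact_mod_cast card_le_univ B
  have t1 : ∑ p ∈ A ×ˢ B, d ≤ d * Fintype.card V ^ 2 := by
    rw [sum_const, card_product, nsmul_eq_mul]; push_cast
    rw [mul_comm, sq]
    gcongr
  have t2 : ∑ p ∈ A ×ˢ B, (if Γ.Adj p.1 p.2 then (1:ℝ) else 0) ≤ b := by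
    rw [Finset.sum_boole]; exact hb
  have t3 : ∑ p ∈ A ×ˢ B, (if p.1 ≠ p.2 ∧ ¬ good p.1 p.2 then (1:ℝ) else 0) ≤ c := by
    rw [Finset.sum_boole]
    refine le_trans ?_ hc
    exact_mod_cast card_le_card (filter_subset_filter _ (subset_univ _))
  have t4 : ∑ p ∈ A ×ˢ B, (if p.1 = p.2 then (1:ℝ) else 0) ≤ Fintype.card V := by
    rw [Finset.sum_boole]
    have : #((A ×ˢ B).filter fun p => p.1 = p.2) ≤ #(univ : Finset V) := by
      apply card_le_card_of_injOn Prod.fst (fun _ _ => by simp)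
      rintro ⟨a, b⟩ h ⟨c, d⟩ h' h''
      simp at h h' h''
      ext <;> simp <;> grind
    rw [card_univ] at this
    exact_mod_cast this
  linarith

open Classical in
theorem stab_reg_of_unif {α : Type*} (G : SimpleGraph α) (X Y : Finset α) (e : ℝ)
    (h : G.IsUniform e X Y) : IsRegularPair G X Y e := by
  intro U hU W hW h1 h2
  have := h hU hW (by rw [mul_comm]; exact h1) (by rw [mul_comm]; exact h2)
  rw [stab_dens, stab_dens]
  exact this.le

open Classical in
theorem stab_szem (e : ℝ) (he : 0 < e) (l n : ℕ) (hl : l ≤ n) (R : SimpleGraph (Fin n)) :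
    ∃ k : ℕ, l ≤ k ∧ k ≤ SzemerediRegularity.bound e l ∧ ∃ part : Fin k → Finset (Fin n),
      (∀ i j, i ≠ j → Disjoint (part i) (part j)) ∧ (∀ x, ∃ i, x ∈ part i) ∧
      (∀ i, (n : ℝ) ≤ k * (#(part i) + 1)) ∧ (∀ i, (k : ℝ) * #(part i) ≤ n + k) ∧
      (#((univ : Finset (Fin k × Fin k)).filter
        fun p => p.1 ≠ p.2 ∧ ¬ IsRegularPair R (part p.1) (part p.2) e) : ℝ) ≤ e * k ^ 2 := by
  obtain ⟨P, hP1, hP2, hP3, hP4⟩ := szemeredi_regularity R he (l := l) (by simpa using hl)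
  let φ := P.parts.equivFin
  refine ⟨#P.parts, hP2, hP3, fun i => (φ.symm i).1, ?_, ?_, ?_, ?_, ?_⟩
  · intro i j hij
    apply P.disjoint (φ.symm i).2 (φ.symm j).2
    intro h
    exact hij (φ.symm.injective (Subtype.ext h))
  · intro x
    obtain ⟨X, hX, hx⟩ := P.exists_mem (mem_univ x)
    exact ⟨φ ⟨X, hX⟩, by simpa using hx⟩
  · intro i
    have h := hP1.average_le_card_part (φ.symm i).2
    rw [card_univ, Fintype.card_fin] at h
    have h2 : n < #P.parts * (n / #P.parts + 1) := Nat.lt_mul_div_succ n (by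
      exact card_pos.2 ⟨_, (φ.symm i).2⟩)
    have h3 : n ≤ #P.parts * (#((φ.symm i).1) + 1) := h2.le.trans (Nat.mul_le_mul_left _ (by omega))
    exact_mod_cast h3
  · intro i
    have h := hP1.card_part_le_average_add_one (φ.symm i).2
    rw [card_univ, Fintype.card_fin] at h
    have h3 : #P.parts * #((φ.symm i).1) ≤ n + #P.parts := by
      refine (Nat.mul_le_mul_left _ h).trans ?_
      rw [mul_add, mul_one]
      exact Nat.add_le_add_right (Nat.mul_div_le n _) _
    exact_mod_cast h3
  · rw [Finpartition.IsUniform] at hP4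
    have h1 : #((univ : Finset (Fin #P.parts × Fin #P.parts)).filter
        fun p => p.1 ≠ p.2 ∧ ¬ IsRegularPair R (φ.symm p.1).1 (φ.symm p.2).1 e) ≤ #(P.nonUniforms R e) := by
      apply card_le_card_of_injOn (fun p => ((φ.symm p.1).1, (φ.symm p.2).1))
      · rintro ⟨i, j⟩ h
        simp only [coe_filter, mem_univ, true_and, Set.mem_ofPred_eq] at h
        simp only [mem_coe, Finpartition.mk_mem_nonUniforms]
        refine ⟨(φ.symm i).2, (φ.symm j).2, ?_, ?_⟩
        · intro h'
          exact h.1 (φ.symm.injective (Subtype.ext h'))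
        · intro h'
          exact h.2 (stab_reg_of_unif R _ _ _ h')
      · rintro ⟨i, j⟩ _ ⟨i', j'⟩ _ h
        simp only [Prod.mk.injEq] at h
        ext1
        · exact φ.symm.injective (Subtype.ext h.1)
        · exact φ.symm.injective (Subtype.ext h.2)
    have h2 : (#P.parts * (#P.parts - 1) : ℕ) ≤ (#P.parts ^ 2 : ℕ) := by
      rw [sq]; exact Nat.mul_le_mul_left _ (Nat.sub_le _ _)
    have h2' : ((#P.parts * (#P.parts - 1) : ℕ) : ℝ) ≤ (#P.parts : ℝ) ^ 2 := by exact_mod_cast h2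
    calc _ ≤ (#(P.nonUniforms R e) : ℝ) := by exact_mod_cast h1
      _ ≤ _ := hP4
      _ ≤ (#P.parts : ℝ) ^ 2 * e := by gcongr
      _ = _ := mul_comm _ _

open Classical in
/-- The reduced graph. -/
def StabRed {V α : Type*} (G : SimpleGraph α) (part : V → Finset α) (e d : ℝ) :
    SimpleGraph V where
  Adj i j := i ≠ j ∧ IsRegularPair G (part i) (part j) e ∧ d ≤ dens G (part i) (part j)
  symm := ⟨fun i j h => ⟨h.1.symm, stab_reg_symm G _ _ _ h.2.1, by rw [stab_dens_comm]; exact h.2.2⟩⟩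
  loopless := ⟨fun _ h => h.1 rfl⟩

theorem stab_lower {n : ℕ} (G : SimpleGraph (Fin n)) (X Y : Finset (Fin n)) (τ ε α : ℝ)
    (hX : 0.6 * (n : ℝ) ≤ #X) (hY : 0.3 * (n : ℝ) ≤ #Y) (hn : 0 < n) (he : (eCnt G X Y : ℝ) ≤ τ * n ^ 2)
    (hε : 1 ≤ ε * n) (hε0 : 0 < ε) (hα : 6 * τ + 6 * ε ≤ α) : 1 - α ≤ dens Gᶜ X Y := by
  have hn' : (0:ℝ) < n := by exact_mod_cast hn
  have h1 : (#X : ℝ) * #Y ≤ eCnt G X Y + eCnt Gᶜ X Y + #(X ∩ Y) := by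
    exact_mod_cast stab_eCnt_compl G X Y
  have h2 : (#(X ∩ Y) : ℝ) ≤ n := by
    have := card_le_univ (X ∩ Y)
    rw [Fintype.card_fin] at this
    exact_mod_cast this
  have h3 : 0.18 * (n : ℝ) ^ 2 ≤ #X * #Y := by
    calc 0.18 * (n : ℝ) ^ 2 = (0.6 * n) * (0.3 * n) := by ring
      _ ≤ _ := by gcongr
  have hn2 : (0:ℝ) < n ^ 2 := by positivity
  have hpos : (0:ℝ) < #X * #Y := by nlinarith
  have h4 : (n : ℝ) ≤ ε * n ^ 2 := by nlinarith
  have hτ : 0 ≤ τ := by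
    have : (0:ℝ) ≤ eCnt G X Y := by positivity
    by_contra! h
    nlinarith
  rw [_root_.dens, le_div_iff₀ hpos]
  have h5 : (τ + ε) * n ^ 2 ≤ α * (#X * #Y) := by
    calc (τ + ε) * (n:ℝ) ^ 2 ≤ (6 * τ + 6 * ε) * (0.18 * n ^ 2) := by nlinarith
      _ ≤ α * (#X * #Y) := by gcongr; linarith
  nlinarith

open Classical in
theorem stab_sparse {V : Type*} [Fintype V] {n : ℕ} (G : SimpleGraph (Fin n)) (part : V → Finset (Fin n))
    (ε d b α k : ℝ) (A B : Finset V) (X Y : Finset (Fin n)) (hk : k = Fintype.card V)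
    (hX : ∀ x, x ∈ X ↔ ∃ i ∈ A, x ∈ part i) (hY : ∀ x, x ∈ Y ↔ ∃ i ∈ B, x ∈ part i)
    (hε0 : 0 < ε) (hε1 : ε ≤ 1 / 10 ^ 10) (hd : 0 ≤ d) (hb : 0 ≤ b)
    (hk0 : 10 ≤ ε * k) (hn : 10000 * k ^ 2 ≤ ε * n)
    (hup : ∀ i, k * #(part i) ≤ n + k)
    (hnr : (#((univ : Finset (V × V)).filter
        fun p => p.1 ≠ p.2 ∧ ¬ IsRegularPair G (part p.1) (part p.2) (ε ^ 2)) : ℝ) ≤ ε ^ 2 * k ^ 2)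
    (hs : (#((A ×ˢ B).filter fun p => (StabRed G part (ε ^ 2) d).Adj p.1 p.2) : ℝ) ≤ b * k ^ 2)
    (hX' : 0.6 * (n : ℝ) ≤ #X) (hY' : 0.3 * (n : ℝ) ≤ #Y)
    (hα : 7 * (d + b + ε) + 7 * ε ≤ α) : 1 - α ≤ dens Gᶜ X Y := by
  have hkp : 0 < k := by
    by_contra! h
    nlinarith
  have hk1 : 1 ≤ k := by nlinarith
  have hnp : (0:ℝ) < n := by
    by_contra! h
    nlinarith [sq_nonneg k]
  have hkn : k ≤ ε * n := by nlinarith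
  have hup' : ∀ i, (#(part i) : ℝ) ≤ (1 + ε) * n / k := by
    intro i
    rw [le_div_iff₀ hkp]
    have := hup i
    nlinarith
  have hcnt := stab_count G (StabRed G part (ε ^ 2) d) part
    (fun i j => IsRegularPair G (part i) (part j) (ε ^ 2)) A B d ((1 + ε) * n / k) (b * k ^ 2) (ε ^ 2 * k ^ 2)
    hd hup' ?_ hs hnr
  swap
  · intro i j hij hg hadj
    have h1 : dens G (part i) (part j) < d := by
      by_contra! h
      exact hadj ⟨hij, hg, h⟩
    rw [_root_.dens] at h1
    by_cases h0 : (0:ℝ) < #(part i) * #(part j)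
    · rw [div_lt_iff₀ h0] at h1
      refine h1.le.trans ?_
      rw [sq]
      have := hup' i
      have := hup' j
      gcongr
    · have h2 : eCnt G (part i) (part j) ≤ #(part i) * #(part j) := by
        rw [stab_eCnt, ← card_product]; exact card_filter_le _ _
      have h3 : (eCnt G (part i) (part j) : ℝ) ≤ #(part i) * #(part j) := by exact_mod_cast h2
      have : 0 ≤ d * ((1 + ε) * n / k) ^ 2 := by positivity
      linarith
  rw [← hk] at hcnt
  have eX : ∀ inst : DecidableEq (Fin n), @Finset.biUnion _ _ inst A part = X := by
    intro inst; ext x; simp [hX]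
  have eY : ∀ inst : DecidableEq (Fin n), @Finset.biUnion _ _ inst B part = Y := by
    intro inst; ext x; simp [hY]
  rw [eX, eY] at hcnt
  have hkε : k ≤ ε / 10 * k ^ 2 := by nlinarith
  have hee : ε ^ 2 ≤ ε / 10 := by nlinarith
  apply stab_lower G X Y ((7 / 6) * (d + b + ε)) ε α hX' hY' (by exact_mod_cast hnp) _ (by linarith) hε0 (by linarith)
  refine hcnt.trans ?_
  have h1 : d * k ^ 2 + b * k ^ 2 + ε ^ 2 * k ^ 2 + k ≤ (d + b + ε) * k ^ 2 := by
    have : ε ^ 2 * k ^ 2 ≤ ε / 10 * k ^ 2 := by gcongr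
    have : 0 < ε * k ^ 2 := by positivity
    linarith
  calc _ ≤ ((d + b + ε) * k ^ 2) * ((1 + ε) * n / k) ^ 2 := by gcongr
    _ = ((1 + ε) ^ 2 * (d + b + ε)) * n ^ 2 := by field_simp
    _ ≤ _ := by
      gcongr
      nlinarith

set_option maxHeartbeats 2000000 in
open Classical in
theorem stab_main {V : Type*} [Fintype V] {n : ℕ} (R : SimpleGraph (Fin n)) (part : V → Finset (Fin n))
    (ε d lam k : ℝ) (hk : k = Fintype.card V)
    (hdisj : ∀ i j, i ≠ j → Disjoint (part i) (part j)) (hcov : ∀ x, ∃ i, x ∈ part i)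
    (hε0 : 0 < ε) (hε1 : ε ≤ 1 / 10 ^ 10) (hd : 1000 * ε ≤ d) (hl : 1000 * ε ≤ lam)
    (hd1 : d ≤ 1 / 1000) (hl1 : lam ≤ 1 / 1000)
    (hk0 : 10 ≤ ε * k) (hn : 10000 * k ^ 2 ≤ ε * n)
    (hlow : ∀ i, n ≤ k * (#(part i) + 1))
    (hup : ∀ i, k * #(part i) ≤ n + k)
    (hnr : (#((univ : Finset (V × V)).filter
        fun p => p.1 ≠ p.2 ∧ ¬ IsRegularPair R (part p.1) (part p.2) (ε ^ 2)) : ℝ) ≤ ε ^ 2 * k ^ 2) :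
    (∃ G : SimpleGraph (Fin n), (G = R ∨ G = Rᶜ) ∧ ∃ m : ℕ, (2 / 3 + lam) * k ≤ (m : ℝ) ∧
          ∃ Us Vs : Fin m → Finset (Fin n),
            (∀ i j, i ≠ j → Disjoint (Us i) (Us j)) ∧
            (∀ i j, i ≠ j → Disjoint (Vs i) (Vs j)) ∧
            (∀ i j, Disjoint (Us i) (Vs j)) ∧
            (∀ i, (1 - ε) / (2 * k) * n ≤ ((Us i).card : ℝ) ∧ (1 - ε) / (2 * k) * n ≤ ((Vs i).card : ℝ)) ∧
              (∀ i, IsRegularPair G (Us i) (Vs i) ε ∧ d - ε ≤ dens G (Us i) (Vs i)) ∧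
              WellConnected G
                ((⋃ i, ((Us i : Set (Fin n)))) ∪ ⋃ i, ((Vs i : Set (Fin n))))
                (200 * (2 * Fintype.card V)) 6) ∨
        IsExtremalColoring R (1000 * (d + lam + Real.sqrt ε)) := by
  have hkp : 0 < k := by
    by_contra! h
    nlinarith
  have hk1 : 1000 ≤ k := by nlinarith
  have hnp : (0:ℝ) < n := by
    by_contra! h
    nlinarith [sq_nonneg k]
  have hkn : 10000 * k * k ≤ ε * n := by nlinarith
  have hpk : ∀ i, (n : ℝ) / k - 1 ≤ #(part i) := by
    intro i
    rw [sub_le_iff_le_add, div_le_iff₀ hkp]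
    linarith [hlow i]
  have hnk : 10000 * k ≤ ε * (n / k) := by
    rw [← mul_div_assoc, le_div_iff₀ hkp]; exact hkn
  have hpos : ∀ i, 0 < #(part i) := by
    intro i
    have h1 := hpk i
    have h2 : ε * (n / k) ≤ n / k := by
      have : 0 ≤ (n : ℝ) / k := by positivity
      nlinarith
    have : (0:ℝ) < #(part i) := by linarith
    exact_mod_cast this
  have hregc : ∀ i j, i ≠ j → IsRegularPair R (part i) (part j) (ε ^ 2) →
      IsRegularPair Rᶜ (part i) (part j) (ε ^ 2) := fun i j hij h =>
    stab_reg_compl R _ _ _ (by positivity) (hpos i) (hpos j) (hdisj i j hij) h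
  have hnr' : (#((univ : Finset (V × V)).filter
        fun p => p.1 ≠ p.2 ∧ ¬ IsRegularPair Rᶜ (part p.1) (part p.2) (ε ^ 2)) : ℝ) ≤ ε ^ 2 * k ^ 2 := by
    refine le_trans ?_ hnr
    have : ((univ : Finset (V × V)).filter
        fun p => p.1 ≠ p.2 ∧ ¬ IsRegularPair Rᶜ (part p.1) (part p.2) (ε ^ 2)) ⊆ ((univ : Finset (V × V)).filter
        fun p => p.1 ≠ p.2 ∧ ¬ IsRegularPair R (part p.1) (part p.2) (ε ^ 2)) := by
      intro p hp
      simp only [mem_filter, mem_univ, true_and] at hp ⊢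
      exact ⟨hp.1, fun h => hp.2 (hregc _ _ hp.1 h)⟩
    exact_mod_cast card_le_card this
  set red := StabRed R part (ε ^ 2) d with hred
  set blue := StabRed Rᶜ part (ε ^ 2) d with hblue
  let bad : V → Finset V := fun x => univ.filter fun y => x ≠ y ∧ ¬ IsRegularPair R (part x) (part y) (ε ^ 2)
  let V0 : Finset V := univ.filter fun x => (#(bad x) : ℝ) ≤ ε * k
  have hV0 : (#V0ᶜ : ℝ) ≤ ε * k := by
    have h1 : ∑ x ∈ V0ᶜ, (ε * k) ≤ ∑ x ∈ V0ᶜ, (#(bad x) : ℝ) := by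
      apply Finset.sum_le_sum
      intro x hx
      simp only [V0, mem_compl, mem_filter, mem_univ, true_and, not_le] at hx
      exact hx.le
    have h2 : ∑ x ∈ V0ᶜ, (#(bad x) : ℝ) ≤ ∑ x, (#(bad x) : ℝ) :=
      Finset.sum_le_sum_of_subset_of_nonneg (subset_univ _) (fun _ _ _ => by positivity)
    have h3 : ∑ x, #(bad x) = #((univ : Finset (V × V)).filter
        fun p => p.1 ≠ p.2 ∧ ¬ IsRegularPair R (part p.1) (part p.2) (ε ^ 2)) := by
      rw [Finset.card_filter, ← Finset.univ_product_univ, Finset.sum_product]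
      simp_rw [bad, Finset.card_filter]
    have h3' : ∑ x, (#(bad x) : ℝ) ≤ ε ^ 2 * k ^ 2 := by
      refine le_trans (le_of_eq ?_) hnr
      exact_mod_cast h3
    rw [sum_const, nsmul_eq_mul] at h1
    have h4 : (#V0ᶜ : ℝ) * (ε * k) ≤ (ε * k) * (ε * k) := by linarith [h1, h2, h3']
    exact le_of_mul_le_mul_right h4 (by positivity)
  have hmiss : ∀ x ∈ V0, ∀ (P : V → Prop) (inst : DecidablePred P), (∀ y, P y → y ≠ x ∧ ¬ red.Adj x y ∧ ¬ blue.Adj x y) →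
      (#(univ.filter P) : ℝ) ≤ ε * k := by
    intro x hx P inst hP
    simp only [V0, mem_filter, mem_univ, true_and] at hx
    refine le_trans ?_ hx
    have : univ.filter P ⊆ bad x := by
      intro y hy
      simp only [bad, mem_filter, mem_univ, true_and] at hy ⊢
      obtain ⟨h1, h2, h3⟩ := hP y hy
      refine ⟨h1.symm, fun h => ?_⟩
      have e1 : ¬ d ≤ dens R (part x) (part y) := fun h' => h2 ⟨h1.symm, h, h'⟩
      have e2 : ¬ d ≤ dens Rᶜ (part x) (part y) := fun h' => h3 ⟨h1.symm, hregc _ _ h1.symm h, h'⟩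
      rw [stab_dens_compl R _ _ (hpos x) (hpos y) (hdisj x y h1.symm)] at e2
      linarith
    exact_mod_cast card_le_card this
  have hm1 : ∀ x ∈ V0, (#(univ.filter fun y => y ≠ x ∧ ¬ red.Adj x y ∧ ¬ blue.Adj x y) : ℝ) ≤ ε * k :=
    fun x hx => hmiss x hx _ _ fun y h => h
  have hm2 : ∀ x ∈ V0, (#(univ.filter fun y => y ≠ x ∧ ¬ blue.Adj x y ∧ ¬ red.Adj x y) : ℝ) ≤ ε * k :=
    fun x hx => hmiss x hx _ _ fun y h => ⟨h.1, h.2.2, h.2.1⟩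
  have hl0 : 0 ≤ lam := by linarith
  have hεk : 1000 * (ε * k) ≤ Fintype.card V := by rw [← hk]; nlinarith
  have key : (∃ G, (G = red ∨ G = blue) ∧ ∃ (W : Finset V) (m : ℕ) (f g : Fin m → V),
      (2 / 3 + lam) * Fintype.card V ≤ m ∧ f.Injective ∧ g.Injective ∧ (∀ i, G.Adj (f i) (g i)) ∧
      (∀ i, f i ∈ W ∧ g i ∈ W) ∧ StabConn G W) ∨
    ∃ A : Finset V, 2 / 3 * Fintype.card V - 3 * (lam * Fintype.card V + 20 * (ε * k)) ≤ #A ∧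
      1 / 3 * Fintype.card V - 3 * (lam * Fintype.card V + 20 * (ε * k)) ≤ #Aᶜ ∧
      (((#((A ×ˢ A).filter fun p => red.Adj p.1 p.2) : ℝ) ≤ 10 * (lam * Fintype.card V + 20 * (ε * k)) * Fintype.card V ∧
        (#((A ×ˢ Aᶜ).filter fun p => blue.Adj p.1 p.2) : ℝ) ≤ 10 * (lam * Fintype.card V + 20 * (ε * k)) * Fintype.card V) ∨
       ((#((A ×ˢ A).filter fun p => blue.Adj p.1 p.2) : ℝ) ≤ 10 * (lam * Fintype.card V + 20 * (ε * k)) * Fintype.card V ∧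
        (#((A ×ˢ Aᶜ).filter fun p => red.Adj p.1 p.2) : ℝ) ≤ 10 * (lam * Fintype.card V + 20 * (ε * k)) * Fintype.card V)) := by
    rcases stab_conn red blue V0 (ε * k) hk0 (by linarith) hV0 hm1 with ⟨W, hW1, hW2, hW3⟩ | ⟨W, hW1, hW2, hW3⟩
    · exact stab_comb red blue V0 W (ε * k) lam hk0 hεk hV0 hm1 hl0 (by linarith) hW1 hW2 hW3 _ rfl
    · rcases stab_comb blue red V0 W (ε * k) lam hk0 hεk hV0 hm2 hl0 (by linarith) hW1 hW2 hW3 _ rfl with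
        ⟨G, hG, h⟩ | ⟨A, h1, h2, h3⟩
      · exact Or.inl ⟨G, hG.symm, h⟩
      · exact Or.inr ⟨A, h1, h2, h3.symm⟩
  rcases key with ⟨Γ, hΓ, W, m, f, g, h1, h2, h3, h4, h5, h6⟩ | ⟨A, hA1, hA2, hA3⟩
  · left
    have hG : ∃ G : SimpleGraph (Fin n), (G = R ∨ G = Rᶜ) ∧ Γ = StabRed G part (ε ^ 2) d := by
      rcases hΓ with h | h
      · exact ⟨R, Or.inl rfl, h⟩
      · exact ⟨Rᶜ, Or.inr rfl, h⟩
    obtain ⟨G, hG1, hG2⟩ := hG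
    refine ⟨G, hG1, m, by rw [hk]; exact h1, ?_⟩
    refine stab_case1 G Γ part hdisj ε d hε0 hε1 hd ?_ _ ?_ _ ?_ W m f g h2 h3 h4 h5 h6
    · intro X Y h
      rw [hG2] at h
      exact h.2
    · intro X
      push_cast
      rw [← hk]
      have := hpk X
      nlinarith
    · intro X
      have h7 := hpk X
      have h8 : 2 * ((1 - ε) / (2 * k) * n) = (1 - ε) * (n / k) := by field_simp
      rw [h8]
      have h9 : 0 ≤ (n : ℝ) / k := by positivity
      have h10 : ε ^ 2 ≤ ε / 100 := by nlinarith
      have h11 : ε ^ 2 * (n / k) ≤ ε / 100 * (n / k) := by gcongr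
      calc (1 - ε) * ((n : ℝ) / k) + 1 ≤ (1 - ε ^ 2) * (n / k - 1) := by nlinarith
        _ ≤ _ := by
          apply mul_le_mul_of_nonneg_left h7
          linarith
  · right
    rw [← hk] at hA1 hA2 hA3
    have hsize : ∀ B : Finset V, ∀ X : Finset (Fin n), (∀ x, x ∈ X ↔ ∃ i ∈ B, x ∈ part i) →
        #B * ((1 - ε) * (n / k)) ≤ (#X : ℝ) := by
      intro B X hX
      have e : X = B.biUnion part := by ext x; simp [hX]
      have h1 : #X = ∑ i ∈ B, #(part i) := by
        rw [e]; exact card_biUnion fun i _ j _ hij => hdisj i j hij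
      rw [h1]
      push_cast
      rw [← nsmul_eq_mul]
      apply card_nsmul_le_sum
      intro i _
      have := hpk i
      nlinarith
    have hS : ∃ S : Finset (Fin n), ∀ x, x ∈ S ↔ ∃ i ∈ A, x ∈ part i :=
      ⟨A.biUnion part, fun x => by simp⟩
    obtain ⟨S, hS⟩ := hS
    have hSc : ∀ x, x ∈ Sᶜ ↔ ∃ i ∈ Aᶜ, x ∈ part i := by
      intro x
      rw [mem_compl, hS]
      obtain ⟨j, hj⟩ := hcov x
      have hu : ∀ i, x ∈ part i → i = j := by
        intro i hi
        by_contra hij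
        exact Finset.disjoint_left.1 (hdisj i j hij) hi hj
      constructor
      · intro h
        exact ⟨j, by rw [mem_compl]; exact fun hjA => h ⟨j, hjA, hj⟩, hj⟩
      · rintro ⟨i, hi, hix⟩ ⟨i', hi', hix'⟩
        rw [hu i hix] at hi
        rw [hu i' hix'] at hi'
        exact (mem_compl.1 hi) hi'
    have hsA := hsize A S hS
    have hsB := hsize Aᶜ Sᶜ hSc
    have hnk0 : 0 ≤ (1 - ε) * ((n:ℝ) / k) := mul_nonneg (by linarith) (by positivity)
    have hμ : lam * k + 20 * (ε * k) ≤ 1.02 * lam * k := by nlinarith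
    have hcalc : ∀ a : ℝ, a ≤ 1 → 0 ≤ a → (a * k - 3 * (lam * k + 20 * (ε * k))) * ((1 - ε) * (n / k)) ≥
        (a - 4 * lam) * n := by
      intro a ha ha0
      calc (a - 4 * lam) * (n : ℝ) ≤ ((a - 3.06 * lam) * (1 - ε)) * n := by
            gcongr
            nlinarith
        _ = ((a - 3.06 * lam) * k) * ((1 - ε) * (n / k)) := by field_simp
        _ ≤ _ := by
          gcongr
          linarith
    have hs1 : (2 / 3 - 4 * lam) * n ≤ #S :=
      (hcalc (2 / 3) (by norm_num) (by norm_num)).le.trans ((mul_le_mul_of_nonneg_right hA1 hnk0).trans hsA)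
    have hs2 : (1 / 3 - 4 * lam) * n ≤ #Sᶜ :=
      (hcalc (1 / 3) (by norm_num) (by norm_num)).le.trans ((mul_le_mul_of_nonneg_right hA2 hnk0).trans hsB)
    have hs1' : 0.6 * (n:ℝ) ≤ #S := by nlinarith
    have hs2' : 0.3 * (n:ℝ) ≤ #Sᶜ := by nlinarith
    have hsq : 0 ≤ Real.sqrt ε := Real.sqrt_nonneg ε
    have hb : 10 * (lam * k + 20 * (ε * k)) * k = (10 * lam + 200 * ε) * k ^ 2 := by ring
    rw [hb] at hA3
    have hα : 7 * (d + (10 * lam + 200 * ε) + ε) + 7 * ε ≤ 1000 * (d + lam + Real.sqrt ε) := by linarith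
    have sp : ∀ G : SimpleGraph (Fin n), (G = R ∨ G = Rᶜ) → ∀ (B : Finset V) (Y : Finset (Fin n)),
        (∀ x, x ∈ Y ↔ ∃ i ∈ B, x ∈ part i) → 0.3 * (n:ℝ) ≤ #Y → 
        (#((A ×ˢ B).filter fun p => (StabRed G part (ε ^ 2) d).Adj p.1 p.2) : ℝ) ≤ (10 * lam + 200 * ε) * k ^ 2 →
        1 - 1000 * (d + lam + Real.sqrt ε) ≤ dens Gᶜ S Y := by
      intro G hG B Y hY hY' hc
      refine stab_sparse G part ε d (10 * lam + 200 * ε) _ k A B S Y hk hS hY hε0 hε1 (by linarith) (by linarith)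
        hk0 hn hup ?_ hc hs1' hY' hα
      rcases hG with h | h
      · rw [h]; exact hnr
      · rw [h]; exact hnr'
    have hs3 : 0.3 * (n:ℝ) ≤ #S := by linarith
    refine ⟨S, ?_, ?_, ?_⟩
    · rw [Fintype.card_fin]
      refine le_trans (mul_le_mul_of_nonneg_right ?_ hnp.le) hs1
      linarith
    · rw [Fintype.card_fin]
      refine le_trans (mul_le_mul_of_nonneg_right ?_ hnp.le) hs2
      linarith
    · rcases hA3 with ⟨h1, h2⟩ | ⟨h1, h2⟩
      · right
        refine ⟨sp R (Or.inl rfl) A S hS hs3 h1, ?_⟩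
        have := sp Rᶜ (Or.inr rfl) Aᶜ Sᶜ hSc hs2' h2
        rwa [compl_compl] at this
      · left
        refine ⟨?_, sp R (Or.inl rfl) Aᶜ Sᶜ hSc hs2' h2⟩
        have := sp Rᶜ (Or.inr rfl) A S hS hs3 h1
        rwa [compl_compl] at this

/-- the key stability lemma (Lemma 2.5 of the paper). -/
theorem stability_lemma (ε : ℝ) (hε0 : 0 < ε) (hε1 : ε ≤ 1 / 10 ^ 10) :
    ∃ M₀ : ℕ, 0 < M₀ ∧ ∀ d lam : ℝ, 1000 * ε ≤ d → 1000 * ε ≤ lam →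
      ∃ n₀ : ℕ, ∀ n : ℕ, n₀ ≤ n → ∀ R : SimpleGraph (Fin n),
        (∃ M : ℕ, 0 < M ∧ M ≤ M₀ ∧ ∃ c : ℝ, (1 - ε) / M ≤ c ∧
          ∃ m : ℕ, (2 / 3 + lam) * M / 2 ≤ (m : ℝ) ∧
          ∃ Us Vs : Fin m → Finset (Fin n),
            (∀ i j, i ≠ j → Disjoint (Us i) (Us j)) ∧
            (∀ i j, i ≠ j → Disjoint (Vs i) (Vs j)) ∧
            (∀ i j, Disjoint (Us i) (Vs j)) ∧
            (∀ i, c * n ≤ ((Us i).card : ℝ) ∧ c * n ≤ ((Vs i).card : ℝ)) ∧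
            ∃ G : SimpleGraph (Fin n), (G = R ∨ G = Rᶜ) ∧
              (∀ i, IsRegularPair G (Us i) (Vs i) ε ∧ d - ε ≤ dens G (Us i) (Vs i)) ∧
              WellConnected G
                ((⋃ i, ((Us i : Set (Fin n)))) ∪ ⋃ i, ((Vs i : Set (Fin n))))
                (200 * M) 6) ∨
        IsExtremalColoring R (1000 * (d + lam + Real.sqrt ε)) := by
  classical
  set l : ℕ := ⌈10 / ε⌉₊ with hl
  set B : ℕ := SzemerediRegularity.bound (ε ^ 2) l with hB
  have hBpos : 0 < B := SzemerediRegularity.bound_pos _ _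
  have hl10 : 10 ≤ ε * (l : ℝ) := by
    have : 10 / ε ≤ (l : ℝ) := Nat.le_ceil _
    rw [div_le_iff₀ hε0] at this
    linarith
  refine ⟨2 * B, by omega, ?_⟩
  intro d lam hd hlam
  refine ⟨max l ⌈10000 * (B : ℝ) ^ 2 / ε⌉₊, ?_⟩
  intro n hn R
  have hsq : 0 ≤ Real.sqrt ε := Real.sqrt_nonneg ε
  by_cases hbig : 1 ≤ 1000 * (d + lam + Real.sqrt ε)
  · right
    have hnn : ∀ (G : SimpleGraph (Fin n)) X Y, 0 ≤ dens G X Y := fun G X Y => by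
      rw [_root_.dens]; positivity
    have hn0 : (0:ℝ) ≤ n := by positivity
    refine ⟨∅, ?_, ?_, Or.inl ⟨?_, ?_⟩⟩
    · rw [Fintype.card_fin, Finset.card_empty, Nat.cast_zero]
      exact mul_nonpos_of_nonpos_of_nonneg (by linarith) hn0
    · refine le_trans (mul_nonpos_of_nonpos_of_nonneg (by linarith) (by positivity)) (by positivity)
    · exact le_trans (by linarith) (hnn _ _ _)
    · exact le_trans (by linarith) (hnn _ _ _)
  rw [not_le] at hbig
  obtain ⟨k, hk1, hk2, part, hdisj, hcov, hlow, hup, hnr⟩ :=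
    stab_szem (ε ^ 2) (by positivity) l n ((le_max_left _ _).trans hn) R
  have hkl : (l : ℝ) ≤ k := by exact_mod_cast hk1
  have hkB : (k : ℝ) ≤ B := by exact_mod_cast hk2
  have hk0 : 10 ≤ ε * (k : ℝ) := hl10.trans (by gcongr)
  have hn2 : 10000 * (B : ℝ) ^ 2 ≤ ε * n := by
    have h1 : 10000 * (B : ℝ) ^ 2 / ε ≤ n :=
      (Nat.le_ceil _).trans (by exact_mod_cast (le_max_right _ _).trans hn)
    rw [div_le_iff₀ hε0] at h1
    linarith
  have hn3 : 10000 * (k : ℝ) ^ 2 ≤ ε * n := le_trans (by gcongr) hn2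
  have hkpos : 0 < k := by
    rcases Nat.eq_zero_or_pos k with h | h
    · rw [h] at hk0; norm_num at hk0
    · exact h
  have hmain := stab_main R part ε d lam k (by simp) hdisj hcov hε0 hε1 hd hlam (by linarith) (by linarith)
    hk0 hn3 hlow hup (by convert hnr)
  rcases hmain with ⟨G, hG, m, hm, Us, Vs, h1, h2, h3, h4, h5, h6⟩ | h
  · left
    refine ⟨2 * k, by omega, by omega, (1 - ε) / (2 * k : ℝ), by push_cast; exact le_rfl, m, ?_,
      Us, Vs, h1, h2, h3, h4, G, hG, h5, ?_⟩
    · push_cast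
      linarith
    · rw [Fintype.card_fin] at h6
      exact h6
  · exact Or.inr h
end

section
/- There exists k_0 such that the following holds for every integer k ≥ k_0. Let 0 < β < 10^{−4} and let G be a bipartite graph with parts U and V such that |V| ≥ 3k/4, |U| ≥ ⌊k/2⌋, the edge density between U and V is at least 1−β, and every vertex in U has degree at least δ, where δ ≥ 4√β·max(|V|, 2|U|). Then the number of paths with k vertices in G starting from a vertex in V is at least (δ/(4|V|))^{2√β|U|} · (1 − 4√β|U|/δ)^{k/2} · (1 − 6√β)^{k/2} · (|U|)_{⌊k/2⌋} · (|V|)_{⌈k/2⌉}. -/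
open Finset

noncomputable def FF {ι α : Type*} [Fintype ι] [DecidableEq ι] [DecidableEq α]
    (A : ι → Finset α) (v0 : α) (S : Finset ι) : Finset (ι → α) :=
  by
    classical
    exact (Fintype.piFinset fun j => if j ∈ S then A j else {v0}).filter
      (fun f => Set.InjOn f (S : Set ι))

lemma mem_FF {ι α : Type*} [Fintype ι] [DecidableEq ι] [DecidableEq α]
    (A : ι → Finset α) (v0 : α) (S : Finset ι) (f : ι → α) :
    f ∈ FF A v0 S ↔ (∀ j ∈ S, f j ∈ A j) ∧ (∀ j, j ∉ S → f j = v0) ∧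
      Set.InjOn f (S : Set ι) := by
  classical
  unfold FF
  rw [Finset.mem_filter, Fintype.mem_piFinset, ← and_assoc]
  refine and_congr_left fun _ => ⟨fun h => ⟨fun j hj => ?_, fun j hj => ?_⟩, fun h j => ?_⟩
  · simpa [hj] using h j
  · simpa [hj] using h j
  · by_cases hj : j ∈ S
    · simpa [hj] using h.1 j hj
    · simpa [hj] using h.2 j hj

lemma FF_step {ι α : Type*} [Fintype ι] [DecidableEq ι] [DecidableEq α]
    (A : ι → Finset α) (v0 : α) (S : Finset ι) (j : ι) (hj : j ∉ S) :
    (FF A v0 S).card * ((A j).card - S.card) ≤ (FF A v0 (insert j S)).card := by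
  classical
  have h1 : (FF A v0 S).card * ((A j).card - S.card) ≤
      ((FF A v0 S).sigma (fun f => A j \ S.image f)).card := by
    rw [Finset.card_sigma, ← smul_eq_mul]
    apply Finset.card_nsmul_le_sum
    intro f _
    have := Finset.le_card_sdiff (S.image f) (A j)
    have h2 : (S.image f).card ≤ S.card := Finset.card_image_le
    omega
  refine h1.trans ?_
  apply Finset.card_le_card_of_injOn (fun p => Function.update p.1 j p.2)
  · rintro ⟨f, v⟩ hp
    simp only [Finset.coe_sigma, Set.mem_sigma_iff, Finset.mem_coe, mem_FF, Finset.mem_sdiff,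
      Finset.mem_image, not_exists, not_and] at hp ⊢
    obtain ⟨⟨ha, hb, hc⟩, hv, hv2⟩ := hp
    refine ⟨fun i hi => ?_, fun i hi => ?_, ?_⟩
    · by_cases hij : i = j
      · subst hij; simpa using hv
      · rw [Function.update_of_ne hij]
        exact ha i (Finset.mem_of_mem_insert_of_ne hi hij)
    · rw [Finset.mem_insert, not_or] at hi
      rw [Function.update_of_ne hi.1]
      exact hb i hi.2
    · intro x hx y hy hxy
      simp only [Finset.coe_insert, Set.mem_insert_iff, Finset.mem_coe] at hx hy
      by_cases hxj : x = j
      · by_cases hyj : y = j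
        · rw [hxj, hyj]
        · subst hxj
          simp only [Function.update_self, Function.update_of_ne hyj] at hxy
          exact absurd hxy.symm (hv2 y (hy.resolve_left hyj))
      · by_cases hyj : y = j
        · subst hyj
          simp only [Function.update_self, Function.update_of_ne hxj] at hxy
          exact absurd hxy (hv2 x (hx.resolve_left hxj))
        · simp only [Function.update_of_ne hyj, Function.update_of_ne hxj] at hxy
          exact hc (hx.resolve_left hxj) (hy.resolve_left hyj) hxy
  · rintro ⟨f, v⟩ hp ⟨f', v'⟩ hp' h
    simp only [Finset.coe_sigma, Set.mem_sigma_iff, Finset.mem_coe, mem_FF] at hp hp' h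
    have hv : v = v' := by simpa using congrFun h j
    have hf : f = f' := by
      funext i
      by_cases hij : i = j
      · subst hij; rw [hp.1.2.1 i hj, hp'.1.2.1 i hj]
      · simpa [Function.update_of_ne hij] using congrFun h i
    subst hv; subst hf; rfl

lemma FF_bound {ι α : Type*} [Fintype ι] [DecidableEq ι] [DecidableEq α]
    (A : ι → Finset α) (v0 : α) (n : ℕ) (S : Finset ι) (R r : ℝ) (hR : 0 ≤ R) (hr : 0 ≤ r)
    (h0 : R * (n.descFactorial S.card : ℝ) ≤ (FF A v0 S).card) (T : Finset ι)
    (hd : Disjoint S T) (hn : S.card + T.card ≤ n)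
    (hA : ∀ j ∈ T, ∀ t : ℕ, t < S.card + T.card → r * ((n : ℝ) - t) ≤ (A j).card - (t : ℝ)) :
    R * r ^ T.card * (n.descFactorial (S.card + T.card) : ℝ) ≤ (FF A v0 (S ∪ T)).card := by
  classical
  induction T using Finset.induction_on with
  | empty => simpa using h0
  | insert j T hj ih =>
    rw [Finset.card_insert_of_notMem hj] at hn hA ⊢
    rw [Finset.disjoint_insert_right] at hd
    have ih' := ih hd.2 (by omega) (fun i hi t ht => hA i (Finset.mem_insert_of_mem hi) t (by omega))
    have hj' : j ∉ S ∪ T := by simp [hd.1, hj]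
    have hs := FF_step A v0 (S ∪ T) j hj'
    rw [Finset.card_union_of_disjoint hd.2] at hs
    rw [Finset.union_insert]
    have hk := hA j (Finset.mem_insert_self _ _) (S.card + T.card) (by omega)
    rw [← add_assoc, Nat.descFactorial_succ]
    have hs' : ((FF A v0 (S ∪ T)).card : ℝ) * (((A j).card : ℝ) - ((S.card + T.card : ℕ) : ℝ)) ≤
        ((FF A v0 (insert j (S ∪ T))).card : ℝ) := by
      refine le_trans ?_ (Nat.cast_le.mpr hs)
      rw [Nat.cast_mul]
      apply mul_le_mul_of_nonneg_left _ (Nat.cast_nonneg _)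
      rw [sub_le_iff_le_add]
      exact_mod_cast (by omega : (A j).card ≤ (A j).card - (S.card + T.card) + (S.card + T.card))
    refine le_trans ?_ hs'
    have hnn : (0 : ℝ) ≤ (n : ℝ) - ((S.card + T.card : ℕ) : ℝ) := by
      rw [sub_nonneg]; exact_mod_cast (by omega : S.card + T.card ≤ n)
    rw [Nat.cast_mul, Nat.cast_sub (by omega)]
    calc R * r ^ (T.card + 1) * (((n : ℝ) - ((S.card + T.card : ℕ) : ℝ)) *
          (n.descFactorial (S.card + T.card) : ℝ))
        = (R * r ^ T.card * (n.descFactorial (S.card + T.card) : ℝ)) *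
          (r * ((n : ℝ) - ((S.card + T.card : ℕ) : ℝ))) := by ring
      _ ≤ _ := mul_le_mul ih' hk (mul_nonneg hr hnn) (Nat.cast_nonneg _)

/-! switching -/

def NoAdj {α : Type*} {a : ℕ} (B : Finset α) (f : Fin a ↪ α) : Prop :=
  ∀ i j : Fin a, i.val + 1 = j.val → ¬ (f i ∈ B ∧ f j ∈ B)

noncomputable def XX {α : Type*} [Fintype α] [DecidableEq α] (a : ℕ) (B : Finset α) :
    Finset (Fin a ↪ α) := by
  classical
  exact Finset.univ.filter (fun f => NoAdj B f)

def nbi {a : ℕ} (i j : Fin a) : Prop := i.val + 1 = j.val ∨ j.val + 1 = i.val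

noncomputable def near {α : Type*} [Fintype α] {a : ℕ} (B : Finset α)
    (f : Fin a ↪ α) : Finset α := by
  classical
  exact Finset.univ.filter (fun y => ∃ i j : Fin a, nbi i j ∧ f i = y ∧ f j ∈ B)

lemma mem_near {α : Type*} [Fintype α] {a : ℕ} (B : Finset α)
    (f : Fin a ↪ α) (y : α) :
    y ∈ near B f ↔ ∃ i j : Fin a, nbi i j ∧ f i = y ∧ f j ∈ B := by
  classical
  unfold near
  rw [Finset.mem_filter]
  simp only [Finset.mem_univ, true_and]

lemma near_card {α : Type*} [Fintype α] {a : ℕ} (B : Finset α)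
    (f : Fin a ↪ α) : (near B f).card ≤ 2 * B.card := by
  classical
  have : near B f ⊆
    (Finset.univ.filter (fun y => ∃ i j : Fin a, i.val + 1 = j.val ∧ f i = y ∧ f j ∈ B)) ∪
    (Finset.univ.filter (fun y => ∃ i j : Fin a, j.val + 1 = i.val ∧ f i = y ∧ f j ∈ B)) := by
    intro y
    rw [mem_near, Finset.mem_union, Finset.mem_filter, Finset.mem_filter]
    simp only [nbi, Finset.mem_univ, true_and]
    rintro ⟨i, j, h | h, h'⟩
    · exact Or.inl ⟨i, j, h, h'⟩
    · exact Or.inr ⟨i, j, h, h'⟩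
  have h1 : ∀ P : Fin a → Fin a → Prop, (∀ i i' j, P i j → P i' j → i = i') →
     ∀ S : Finset α, (∀ y ∈ S, ∃ i j : Fin a, P i j ∧ f i = y ∧ f j ∈ B) → S.card ≤ B.card := by
    intro P hP S hS
    apply Finset.card_le_card_of_forall_subsingleton
      (fun y b => ∃ i j : Fin a, P i j ∧ f i = y ∧ f j = b)
    · intro y hy
      obtain ⟨i, j, h, h', h''⟩ := hS y hy
      exact ⟨f j, h'', i, j, h, h', rfl⟩
    · rintro b hb y ⟨_, i, j, h, h', h''⟩ y' ⟨_, i', j', g, g', g''⟩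
      have : j = j' := f.injective (h''.trans g''.symm)
      subst this
      rw [← h', ← g', hP i i' j h g]
  have h2 := h1 (fun i j => i.val + 1 = j.val) (fun i i' j h h' => Fin.ext (by omega))
    (Finset.univ.filter (fun y => ∃ i j : Fin a, i.val + 1 = j.val ∧ f i = y ∧ f j ∈ B)) (fun y hy => (Finset.mem_filter.mp hy).2)
  have h3 := h1 (fun i j => j.val + 1 = i.val) (fun i i' j h h' => Fin.ext (by omega))
    (Finset.univ.filter (fun y => ∃ i j : Fin a, j.val + 1 = i.val ∧ f i = y ∧ f j ∈ B)) (fun y hy => (Finset.mem_filter.mp hy).2)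
  have := Finset.card_le_card this
  have := Finset.card_union_le
    (Finset.univ.filter (fun y => ∃ i j : Fin a, i.val + 1 = j.val ∧ f i = y ∧ f j ∈ B))
    (Finset.univ.filter (fun y => ∃ i j : Fin a, j.val + 1 = i.val ∧ f i = y ∧ f j ∈ B))
  omega

lemma XX_step {α : Type*} [Fintype α] [DecidableEq α] (a : ℕ) (B : Finset α) (x : α) (hx : x ∉ B)
    (hB : 5 * B.card + 1 ≤ Fintype.card α) (hm : 0 < B.card) :
    (XX a B).card ≤ 2 * (XX a (insert x B)).card := by
  classical
  have hsub : XX a (insert x B) ⊆ XX a B := by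
    intro f
    simp only [XX, Finset.mem_filter, Finset.mem_univ, true_and]
    intro h i j hij hh
    exact h i j hij ⟨Finset.mem_insert_of_mem hh.1, Finset.mem_insert_of_mem hh.2⟩
  have key : (XX a B \ XX a (insert x B)).card * (2 * B.card) ≤
      (XX a (insert x B)).card * (2 * B.card) := by
    apply Finset.card_mul_le_card_mul
      (fun f g => ∃ y, y ∉ B ∧ y ≠ x ∧ g = f.trans (Equiv.swap x y).toEmbedding)
    · intro f hf
      simp only [XX, Finset.mem_sdiff, Finset.mem_filter, Finset.mem_univ, true_and] at hf
      obtain ⟨hf, hf2⟩ := hf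
      have hi : ∃ i, f i = x := by
        by_contra hcon
        push Not at hcon
        apply hf2
        intro i j hij hh
        exact hf i j hij ⟨Finset.mem_of_mem_insert_of_ne hh.1 (hcon i),
          Finset.mem_of_mem_insert_of_ne hh.2 (hcon j)⟩
      obtain ⟨i, hi⟩ := hi
      let Y : Finset α := Finset.univ \ (insert x (B ∪ near B f))
      have hY : 2 * B.card ≤ Y.card := by
        have h1 := near_card B f
        have h2 := Finset.card_union_le B (near B f)
        have h3 := Finset.card_insert_le x (B ∪ near B f)
        have h4 := Finset.le_card_sdiff (insert x (B ∪ near B f)) (Finset.univ)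
        rw [Finset.card_univ] at h4
        show _ ≤ (Finset.univ \ (insert x (B ∪ near B f))).card
        omega
      refine hY.trans ?_
      apply Finset.card_le_card_of_injOn (fun y => f.trans (Equiv.swap x y).toEmbedding)
      · intro y hy
        simp only [Y, Finset.coe_sdiff, Finset.mem_coe, Finset.mem_sdiff, Finset.mem_univ,
          true_and, Finset.mem_insert, Finset.mem_union, not_or, Set.mem_sdiff] at hy
        obtain ⟨hyx, hyB, hyn⟩ := hy
        simp only [Finset.coe_filter, Finset.mem_coe, Finset.bipartiteAbove, Set.mem_ofPred_eq, XX,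
          Finset.mem_filter, Finset.mem_univ, true_and]
        refine ⟨?_, y, hyB, hyx, rfl⟩
        have hyn' : ∀ i j : Fin a, nbi i j → f i = y → f j ∉ B := by
          intro i j h1 h2 h3
          apply hyn
          rw [mem_near]
          exact ⟨i, j, h1, h2, h3⟩
        have hmem : ∀ z, Equiv.swap x y z ∈ insert x B → z = y ∨ (z ∈ B ∧ z ≠ x) := by
          intro z hz
          by_cases h1 : z = y
          · exact Or.inl h1
          · right
            by_cases h2 : z = x
            · subst h2
              rw [Equiv.swap_apply_left, Finset.mem_insert] at hz
              tauto
            · rw [Equiv.swap_apply_of_ne_of_ne h2 h1, Finset.mem_insert] at hz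
              tauto
        intro p q hpq hh
        simp only [Function.Embedding.trans_apply, Equiv.coe_toEmbedding] at hh
        rcases hmem _ hh.1 with h1 | h1 <;> rcases hmem _ hh.2 with h2 | h2
        · have := f.injective (h1.trans h2.symm)
          rw [this] at hpq; omega
        · exact hyn' p q (Or.inl hpq) h1 h2.1
        · exact hyn' q p (Or.inr hpq) h2 h1.1
        · exact hf p q hpq ⟨h1.1, h2.1⟩
      · intro y _ y' _ h
        have := DFunLike.congr_fun h i
        simpa [hi] using this
    · intro g hg
      refine le_trans ?_ (near_card B g)
      simp only [XX, Finset.mem_filter, Finset.mem_univ, true_and] at hg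
      apply Finset.card_le_card_of_forall_subsingleton
        (fun f y => g = f.trans (Equiv.swap x y).toEmbedding)
      · intro f hf
        simp only [Finset.bipartiteBelow, XX, Finset.mem_sdiff, Finset.mem_filter, Finset.mem_univ,
          true_and] at hf
        obtain ⟨⟨hf, hf2⟩, y, hyB, hyx, rfl⟩ := hf
        refine ⟨y, ?_, rfl⟩
        simp only [NoAdj, not_forall, not_not] at hf2
        obtain ⟨p, q, hpq, h1, h2⟩ := hf2
        have hB' : ∀ z ∈ B, Equiv.swap x y z ∈ B := by
          intro z hz
          rw [Equiv.swap_apply_of_ne_of_ne]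
          · exact hz
          · rintro rfl; exact hx hz
          · rintro rfl; exact hyB hz
        simp only [mem_near,
          Function.Embedding.trans_apply, Equiv.coe_toEmbedding]
        rw [Finset.mem_insert] at h1 h2
        rcases h1 with h1 | h1 <;> rcases h2 with h2 | h2
        · have := f.injective (h1.trans h2.symm)
          rw [this] at hpq; omega
        · exact ⟨p, q, Or.inl hpq, by rw [h1, Equiv.swap_apply_left], hB' _ h2⟩
        · exact ⟨q, p, Or.inr hpq, by rw [h2, Equiv.swap_apply_left], hB' _ h1⟩
        · exact absurd ⟨h1, h2⟩ (hf p q hpq)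
      · rintro y _ f ⟨_, h⟩ f' ⟨_, h'⟩
        ext i
        have := DFunLike.congr_fun (h.symm.trans h') i
        simpa using this
  have h1 := Nat.le_of_mul_le_mul_right key (by omega)
  have h2 := Finset.card_sdiff_add_card_eq_card hsub
  omega

lemma XX_bound {α : Type*} [Fintype α] [DecidableEq α] (a : ℕ) (B : Finset α)
    (hB : 5 * B.card ≤ Fintype.card α) :
    (Fintype.card α).descFactorial a ≤ 2 ^ B.card * (XX a B).card := by
  classical
  induction B using Finset.induction_on with
  | empty =>
    have : XX a (∅ : Finset α) = Finset.univ := by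
      ext f; simp [XX, NoAdj]
    rw [this, Finset.card_univ, Fintype.card_embedding_eq]; simp
  | insert x B hx ih =>
    rw [Finset.card_insert_of_notMem hx] at hB ⊢
    have ih' := ih (by omega)
    have h2 : (XX a B).card ≤ 2 * (XX a (insert x B)).card := by
      rcases Nat.eq_zero_or_pos B.card with h0 | h0
      · rw [Finset.card_eq_zero] at h0
        subst h0
        have : XX a (insert x (∅ : Finset α)) = Finset.univ := by
          ext f
          simp only [XX, NoAdj, Finset.mem_filter, Finset.mem_univ, true_and, iff_true,
            Finset.mem_insert, Finset.notMem_empty, or_false]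
          rintro i j hij ⟨h1, h2⟩
          have := f.injective (h1.trans h2.symm)
          rw [this] at hij; omega
        rw [this]
        have := Finset.card_le_univ (XX a (∅ : Finset α))
        rw [Finset.card_univ]
        omega
      · exact XX_step a B x hx (by omega) h0
    calc _ ≤ _ := ih'
      _ ≤ 2 ^ B.card * (2 * (XX a (insert x B)).card) := Nat.mul_le_mul_left _ h2
      _ = _ := by ring

lemma vside {α : Type*} [DecidableEq α] (k b n : ℕ) (A : Fin b → Finset α) (D : Finset (Fin b))
    (v0 : α) (s δ : ℝ) (hs0 : 0 < s) (hs : s < 1 / 100) (hδ : 0 < δ)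
    (hk2 : 2 ≤ k) (hb : 2 * b ≤ k + 1) (hb0 : 0 < b) (hkn : 3 * (k : ℝ) / 4 ≤ n)
    (hAD : ∀ j ∈ D, δ / 2 + D.card ≤ ((A j).card : ℝ))
    (hAG : ∀ j, j ∉ D → (n : ℝ) - 2 * s * n ≤ ((A j).card : ℝ)) :
    (δ / (2 * n)) ^ D.card * (1 - 6 * s) ^ ((k : ℝ) / 2) * (n.descFactorial b : ℝ) ≤
      ((FF A v0 Finset.univ).card : ℝ) := by
  classical
  have hk2' : (2 : ℝ) ≤ k := by exact_mod_cast hk2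
  have hb' : 2 * (b : ℝ) ≤ k + 1 := by exact_mod_cast hb
  have hn0 : (0 : ℝ) < n := by linarith
  have hbn : b ≤ n := by
    have : (b : ℝ) ≤ n := by linarith
    exact_mod_cast this
  have hF0 : (1 : ℝ) * (n.descFactorial (∅ : Finset (Fin b)).card : ℝ) ≤ (FF A v0 ∅).card := by
    simp only [Finset.card_empty, Nat.descFactorial_zero, Nat.cast_one, mul_one]
    have : 0 < (FF A v0 ∅).card := Finset.card_pos.mpr ⟨fun _ => v0, by simp [mem_FF]⟩
    exact_mod_cast this
  have hr0 : 0 < 1 - 6 * s := by linarith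
  have hr1 : 1 - 6 * s ≤ 1 := by linarith
  have hgen : ∀ j, j ∉ D → ∀ t : ℕ, t < b →
      (1 - 6 * s) * ((n : ℝ) - t) ≤ (A j).card - (t : ℝ) := by
    intro j hj t ht
    have ht' : (t : ℝ) + 1 ≤ b := by exact_mod_cast ht
    have := hAG j hj
    have h3 : (n : ℝ) ≤ 3 * (n - t) := by linarith
    nlinarith [mul_le_mul_of_nonneg_left h3 hs0.le]
  rcases D.eq_empty_or_nonempty with hD | hD
  · subst hD
    have h1 := FF_bound A v0 n ∅ 1 (1 - 2 * s) zero_le_one (by linarith) hF0 {⟨0, hb0⟩}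
      (by simp) (by simp; omega) (by
        intro j hj t ht
        simp at ht
        subst ht
        have := hAG j (by simp)
        simp; linarith)
    rw [Finset.empty_union, Finset.card_empty, zero_add] at h1
    have h2 := FF_bound A v0 n {⟨0, hb0⟩} _ (1 - 6 * s) (by simp; linarith) hr0.le h1
      (Finset.univ \ {⟨0, hb0⟩}) Finset.disjoint_sdiff
      (by rw [add_comm, Finset.card_sdiff_add_card_eq_card (Finset.subset_univ _)]; simpa using hbn)
      (by
        rw [add_comm, Finset.card_sdiff_add_card_eq_card (Finset.subset_univ _), Finset.card_univ,
          Fintype.card_fin]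
        intro j _ t ht
        exact hgen j (by simp) t ht)
    rw [Finset.union_sdiff_of_subset (Finset.subset_univ _), add_comm,
      Finset.card_sdiff_add_card_eq_card (Finset.subset_univ _), Finset.card_univ,
      Fintype.card_fin] at h2
    refine le_trans ?_ h2
    apply mul_le_mul_of_nonneg_right _ (Nat.cast_nonneg _)
    have hc : (Finset.univ \ {(⟨0, hb0⟩ : Fin b)}).card = b - 1 := by
      rw [Finset.card_sdiff_of_subset (Finset.subset_univ _)]; simp
    rw [hc]
    simp only [Finset.card_empty, pow_zero, one_mul, Finset.card_singleton, pow_one]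
    calc (1 - 6 * s) ^ ((k : ℝ) / 2) ≤ (1 - 6 * s) ^ (1 / 2 + ((b - 1 : ℕ) : ℝ)) := by
          apply Real.rpow_le_rpow_of_exponent_ge hr0 hr1
          rw [Nat.cast_sub hb0]
          push_cast; linarith
      _ = (1 - 6 * s) ^ (1 / 2 : ℝ) * (1 - 6 * s) ^ (b - 1) := by
          rw [Real.rpow_add hr0, Real.rpow_natCast]
      _ ≤ _ := by
          apply mul_le_mul_of_nonneg_right _ (by positivity)
          rw [← Real.sqrt_eq_rpow]
          apply Real.sqrt_le_iff.mpr
          constructor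
          · linarith
          · nlinarith
  · have hdb : D.card ≤ b := by simpa using Finset.card_le_univ D
    have hq : 0 < δ / (2 * n) := by positivity
    have h1 := FF_bound A v0 n ∅ 1 (δ / (2 * n)) zero_le_one hq.le hF0 D
      (by simp) (by simp; omega) (by
        intro j hj t ht
        simp at ht
        have := hAD j hj
        have ht' : (t : ℝ) ≤ D.card := by exact_mod_cast ht.le
        have h3 : δ / (2 * n) * ((n : ℝ) - t) ≤ δ / (2 * n) * n :=
          mul_le_mul_of_nonneg_left (by linarith [Nat.cast_nonneg (α := ℝ) t]) hq.le
        have h4 : δ / (2 * n) * n = δ / 2 := by field_simp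
        linarith)
    rw [Finset.empty_union, Finset.card_empty, zero_add] at h1
    have h2 := FF_bound A v0 n D _ (1 - 6 * s) (by positivity) hr0.le h1
      (Finset.univ \ D) Finset.disjoint_sdiff
      (by rw [add_comm, Finset.card_sdiff_add_card_eq_card (Finset.subset_univ _)]; simpa using hbn)
      (by
        rw [add_comm, Finset.card_sdiff_add_card_eq_card (Finset.subset_univ _), Finset.card_univ,
          Fintype.card_fin]
        intro j hj t ht
        exact hgen j (by simpa using hj) t ht)
    rw [Finset.union_sdiff_of_subset (Finset.subset_univ _), add_comm,
      Finset.card_sdiff_add_card_eq_card (Finset.subset_univ _), Finset.card_univ,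
      Fintype.card_fin] at h2
    refine le_trans ?_ h2
    apply mul_le_mul_of_nonneg_right _ (Nat.cast_nonneg _)
    have hc : (Finset.univ \ D).card = b - D.card := by
      rw [Finset.card_sdiff_of_subset (Finset.subset_univ _)]; simp
    rw [hc, one_mul]
    apply mul_le_mul_of_nonneg_left _ (by positivity)
    rw [← Real.rpow_natCast (1 - 6 * s)]
    apply Real.rpow_le_rpow_of_exponent_ge hr0 hr1
    rw [Nat.cast_sub hdb]
    have : (1 : ℝ) ≤ D.card := by exact_mod_cast hD.card_pos
    linarith

noncomputable def glue {Om : Type*} (k : ℕ) (u : Fin (k / 2) → Om) (v : Fin ((k + 1) / 2) → Om) :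
    Fin k → Om := fun i =>
  if h : i.val % 2 = 0 then v ⟨i.val / 2, by have := i.2; omega⟩
    else u ⟨i.val / 2, by have := i.2; omega⟩

lemma glue_even {Om : Type*} (k : ℕ) (u : Fin (k / 2) → Om) (v : Fin ((k + 1) / 2) → Om)
    (j : Fin ((k + 1) / 2)) : glue k u v ⟨2 * j.val, by have := j.2; omega⟩ = v j := by
  unfold glue
  rw [dif_pos (by simp)]
  congr 1
  ext; simp

lemma glue_odd {Om : Type*} (k : ℕ) (u : Fin (k / 2) → Om) (v : Fin ((k + 1) / 2) → Om)
    (j : Fin (k / 2)) : glue k u v ⟨2 * j.val + 1, by have := j.2; omega⟩ = u j := by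
  unfold glue
  rw [dif_neg (by simp)]
  congr 1
  ext; simp; try omega

lemma glue_path {Om : Type*} (G : SimpleGraph Om) (U V : Finset Om) (hd : Disjoint U V) (k : ℕ)
    (u : Fin (k / 2) → Om) (v : Fin ((k + 1) / 2) → Om)
    (hu : Function.Injective u) (hv : Function.Injective v)
    (huU : ∀ i, u i ∈ U) (hvV : ∀ j, v j ∈ V)
    (hadj : ∀ (j : Fin ((k + 1) / 2)) (i : Fin (k / 2)), (i.val = j.val ∨ i.val + 1 = j.val) →
      G.Adj (u i) (v j)) :
    IsBipPathFromV G U V k (glue k u v) := by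
  refine ⟨?_, ?_, ?_⟩
  · intro i j hij
    unfold glue at hij
    split_ifs at hij with h1 h2 h2
    · have := congrArg Fin.val (hv hij)
      simp only at this
      ext; omega
    · exact absurd (hij ▸ hvV _) (Finset.disjoint_left.mp hd (huU _))
    · exact absurd (hij ▸ huU _) (fun h => Finset.disjoint_left.mp hd h (hvV _))
    · have := congrArg Fin.val (hu hij)
      simp only at this
      ext; omega
  · intro i
    unfold glue
    refine ⟨fun h => ?_, fun h => ?_⟩
    · rw [dif_pos h]; exact hvV _
    · rw [dif_neg (by omega)]; exact huU _
  · intro i h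
    unfold glue
    by_cases h1 : i.val % 2 = 0
    · rw [dif_pos h1, dif_neg (by simp only; omega)]
      exact (hadj _ _ (by left; simp only; omega)).symm
    · rw [dif_neg h1, dif_pos (by simp only; omega)]
      exact hadj _ _ (by right; simp only; omega)

lemma finite_paths {Om : Type*} (G : SimpleGraph Om) (U V : Finset Om) (k : ℕ) :
    Finite {f : Fin k → Om // IsBipPathFromV G U V k f} := by
  classical
  let φ : {f : Fin k → Om // IsBipPathFromV G U V k f} → (Fin k → ↥(U ∪ V)) := fun f i =>
    ⟨f.1 i, by
      rcases Nat.mod_two_eq_zero_or_one i.val with h | h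
      · exact Finset.mem_union_right _ ((f.2.2.1 i).1 h)
      · exact Finset.mem_union_left _ ((f.2.2.1 i).2 h)⟩
  apply Finite.of_injective φ
  intro f g h
  apply Subtype.ext
  funext i
  exact congrArg Subtype.val (congrFun h i)

lemma count_paths {Om : Type*} [DecidableEq Om] (G : SimpleGraph Om) (U V : Finset Om)
    (hd : Disjoint U V) (k : ℕ)
    (X : Finset (Fin (k / 2) ↪ ↥U)) (A : (Fin (k / 2) ↪ ↥U) → Fin ((k + 1) / 2) → Finset Om) (v0 : Om)
    (hA : ∀ u j y, y ∈ A u j → y ∈ V ∧ ∀ i : Fin (k / 2), (i.val = j.val ∨ i.val + 1 = j.val) →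
      G.Adj (u i) y) (c : ℝ)
    (hc : ∀ u ∈ X, c ≤ ((FF (A u) v0 Finset.univ).card : ℝ)) :
    (X.card : ℝ) * c ≤ (Nat.card {f : Fin k → Om // IsBipPathFromV G U V k f} : ℝ) := by
  classical
  have := finite_paths G U V k
  have h1 : (X.card : ℝ) * c ≤ ((X.sigma (fun u => FF (A u) v0 Finset.univ)).card : ℝ) := by
    rw [Finset.card_sigma, ← nsmul_eq_mul]
    push_cast
    exact Finset.card_nsmul_le_sum _ _ _ hc
  refine h1.trans ?_
  rw [← Nat.card_eq_finsetCard]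
  apply Nat.cast_le.mpr
  have hmem : ∀ p : ↥(X.sigma (fun u => FF (A u) v0 Finset.univ)),
      IsBipPathFromV G U V k (glue k (fun i => (p.1.1 i : Om)) p.1.2) := by
    rintro ⟨⟨u, v⟩, hp⟩
    simp only [Finset.mem_sigma, mem_FF, Finset.mem_univ, true_implies, Finset.coe_univ] at hp
    obtain ⟨_, hv, _, hi⟩ := hp
    apply glue_path G U V hd k
    · exact Subtype.val_injective.comp u.injective
    · exact Set.injOn_univ.mp hi
    · intro i; exact (u i).2
    · intro j; exact (hA u j _ (hv j)).1
    · intro j i hij; exact (hA u j _ (hv j)).2 i hij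
  apply Nat.card_le_card_of_injective (fun p => ⟨_, hmem p⟩)
  rintro ⟨⟨u, v⟩, hp⟩ ⟨⟨u', v'⟩, hp'⟩ h
  have h := congrArg Subtype.val h
  simp only at h
  have hu : u = u' := by
    ext i
    have := congrFun h ⟨2 * i.val + 1, by have := i.2; omega⟩
    rwa [glue_odd, glue_odd] at this
  have hv : v = v' := by
    funext j
    have := congrFun h ⟨2 * j.val, by have := j.2; omega⟩
    rwa [glue_even, glue_even] at this
  subst hu; subst hv; rfl

noncomputable def NN {Om : Type*} (G : SimpleGraph Om) (V : Finset Om) (u : Om) : Finset Om := by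
  classical
  exact V.filter (fun y => G.Adj u y)

lemma mem_NN {Om : Type*} (G : SimpleGraph Om) (V : Finset Om) (u y : Om) :
    y ∈ NN G V u ↔ y ∈ V ∧ G.Adj u y := by
  classical
  unfold NN; rw [Finset.mem_filter]

lemma nbrCount_eq {Om : Type*} (G : SimpleGraph Om) (V : Finset Om) (u : Om) :
    nbrCount G u V = (NN G V u).card :=
  Nat.subtype_card _ (fun y => mem_NN G V u y)

lemma eCnt_eq {Om : Type*} (G : SimpleGraph Om) (U V : Finset Om) :
    eCnt G U V = ∑ u : ↥U, (NN G V u).card := by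
  classical
  have h1 : eCnt G U V = ((U ×ˢ V).filter (fun p => G.Adj p.1 p.2)).card :=
    Nat.subtype_card _ (fun p => by simp [and_assoc])
  rw [h1, Finset.card_filter, Finset.sum_product, Finset.sum_coe_sort U (fun u => (NN G V u).card)]
  apply Finset.sum_congr rfl
  intro u _
  rw [← Finset.card_filter]
  congr 1

lemma bad_card {Om : Type*} (G : SimpleGraph Om) (U V : Finset Om) (s : ℝ) (hs : 0 < s)
    (hU : 0 < U.card) (hV : 0 < V.card) (hd : 1 - s ^ 2 ≤ _root_.dens G U V) (B : Finset ↥U)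
    (hB : ∀ u ∈ B, ((NN G V u).card : ℝ) ≤ (1 - s) * V.card) : (B.card : ℝ) ≤ s * U.card := by
  classical
  have hU' : (0 : ℝ) < U.card := by exact_mod_cast hU
  have hV' : (0 : ℝ) < V.card := by exact_mod_cast hV
  unfold _root_.dens at hd
  rw [le_div_iff₀ (by positivity), eCnt_eq] at hd
  push_cast at hd
  have h1 : (B.card : ℝ) * (s * V.card) ≤ ∑ u : ↥U, ((V.card : ℝ) - (NN G V u).card) := by
    rw [← nsmul_eq_mul]
    calc _ ≤ ∑ u ∈ B, ((V.card : ℝ) - (NN G V u).card) := by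
          apply Finset.card_nsmul_le_sum
          intro u hu
          linarith [hB u hu]
      _ ≤ _ := by
          apply Finset.sum_le_sum_of_subset_of_nonneg (Finset.subset_univ _)
          intro u _ _
          rw [sub_nonneg]
          exact_mod_cast Finset.card_le_card (fun y hy => ((mem_NN _ _ _ _).mp hy).1)
  rw [Finset.sum_sub_distrib] at h1
  simp only [Finset.sum_const, Finset.card_univ, Fintype.card_coe, nsmul_eq_mul] at h1
  have h2 : (B.card : ℝ) * (s * V.card) ≤ (s * U.card) * (s * V.card) := by nlinarith
  exact le_of_mul_le_mul_right h2 (by positivity)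

noncomputable def AA {Om : Type*} (G : SimpleGraph Om) (U V : Finset Om) {a b : ℕ}
    (u : Fin a ↪ ↥U) (j : Fin b) : Finset Om := by
  classical
  exact V.filter (fun y => ∀ i : Fin a, (i.val = j.val ∨ i.val + 1 = j.val) → G.Adj (u i) y)

noncomputable def DD {Om : Type*} (U : Finset Om) {a : ℕ} (b : ℕ) (B : Finset ↥U)
    (u : Fin a ↪ ↥U) : Finset (Fin b) := by
  classical
  exact Finset.univ.filter (fun j => ∃ i : Fin a, (i.val = j.val ∨ i.val + 1 = j.val) ∧ u i ∈ B)

lemma mem_AA {Om : Type*} (G : SimpleGraph Om) (U V : Finset Om) {a b : ℕ}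
    (u : Fin a ↪ ↥U) (j : Fin b) (y : Om) : y ∈ AA G U V u j ↔
    y ∈ V ∧ ∀ i : Fin a, (i.val = j.val ∨ i.val + 1 = j.val) → G.Adj (u i) y := by
  classical
  unfold AA; rw [Finset.mem_filter]

lemma mem_DD {Om : Type*} (U : Finset Om) {a : ℕ} (b : ℕ) (B : Finset ↥U)
    (u : Fin a ↪ ↥U) (j : Fin b) : j ∈ DD U b B u ↔
    ∃ i : Fin a, (i.val = j.val ∨ i.val + 1 = j.val) ∧ u i ∈ B := by
  classical
  unfold DD; rw [Finset.mem_filter]; simp only [Finset.mem_univ, true_and]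

lemma DD_card {Om : Type*} (U : Finset Om) {a : ℕ} (b : ℕ) (B : Finset ↥U)
    (u : Fin a ↪ ↥U) : (DD U b B u).card ≤ 2 * B.card := by
  classical
  have h1 : ∀ P : Fin a → Fin b → Prop, (∀ i j j', P i j → P i j' → j = j') →
     ∀ S : Finset (Fin b), (∀ j ∈ S, ∃ i : Fin a, P i j ∧ u i ∈ B) → S.card ≤ B.card := by
    intro P hP S hS
    apply Finset.card_le_card_of_forall_subsingleton
      (fun j x => ∃ i : Fin a, P i j ∧ u i = x)
    · intro j hj
      obtain ⟨i, h, h'⟩ := hS j hj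
      exact ⟨u i, h', i, h, rfl⟩
    · rintro x hx j ⟨_, i, h, h'⟩ j' ⟨_, i', g, g'⟩
      have : i = i' := u.injective (h'.trans g'.symm)
      subst this
      exact hP i j j' h g
  have h2 := h1 (fun i j => i.val = j.val) (fun i j j' h h' => Fin.ext (by omega))
    (Finset.univ.filter (fun j : Fin b => ∃ i : Fin a, i.val = j.val ∧ u i ∈ B)) (fun y hy => (Finset.mem_filter.mp hy).2)
  have h3 := h1 (fun i j => i.val + 1 = j.val) (fun i j j' h h' => Fin.ext (by omega))
    (Finset.univ.filter (fun j : Fin b => ∃ i : Fin a, i.val + 1 = j.val ∧ u i ∈ B)) (fun y hy => (Finset.mem_filter.mp hy).2)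
  have h4 := Finset.card_union_le
    (Finset.univ.filter (fun j : Fin b => ∃ i : Fin a, i.val = j.val ∧ u i ∈ B))
    (Finset.univ.filter (fun j : Fin b => ∃ i : Fin a, i.val + 1 = j.val ∧ u i ∈ B))
  have h5 : DD U b B u ⊆
    (Finset.univ.filter (fun j : Fin b => ∃ i : Fin a, i.val = j.val ∧ u i ∈ B)) ∪
    (Finset.univ.filter (fun j : Fin b => ∃ i : Fin a, i.val + 1 = j.val ∧ u i ∈ B)) := by
    intro j
    rw [mem_DD, Finset.mem_union, Finset.mem_filter, Finset.mem_filter]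
    rintro ⟨i, h | h, h'⟩
    · exact Or.inl ⟨Finset.mem_univ _, i, h, h'⟩
    · exact Or.inr ⟨Finset.mem_univ _, i, h, h'⟩
  have := Finset.card_le_card h5
  omega

lemma AA_card {Om : Type*} (G : SimpleGraph Om) (U V : Finset Om) {a b : ℕ}
    (u : Fin a ↪ ↥U) (j : Fin b) (x1 x2 : ℝ) (hx1 : 0 ≤ x1) (hx2 : 0 ≤ x2)
    (h1 : ∀ i : Fin a, i.val = j.val → (V.card : ℝ) - x1 ≤ (NN G V (u i)).card)
    (h2 : ∀ i : Fin a, i.val + 1 = j.val → (V.card : ℝ) - x2 ≤ (NN G V (u i)).card) :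
    (V.card : ℝ) - (x1 + x2) ≤ (AA G U V u j).card := by
  classical
  have key : ∀ (Q : Fin a → Prop), (∀ i i', Q i → Q i' → i = i') → ∀ x : ℝ, 0 ≤ x →
      (∀ i, Q i → (V.card : ℝ) - x ≤ (NN G V (u i)).card) →
      ∀ S : Finset Om, (∀ y ∈ S, y ∈ V ∧ ∃ i, Q i ∧ ¬ G.Adj (u i) y) → (S.card : ℝ) ≤ x := by
    intro Q hQ x hx h S hS
    by_cases hex : ∃ i, Q i
    · obtain ⟨i, hi⟩ := hex
      have hsub : S ⊆ V \ NN G V (u i) := by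
        intro y hy
        obtain ⟨hy, i', hi', hn⟩ := hS y hy
        rw [Finset.mem_sdiff, mem_NN]
        refine ⟨hy, fun hh => hn ?_⟩
        rw [hQ i' i hi' hi]; exact hh.2
      have hc := Finset.card_le_card hsub
      have hc2 := Finset.card_sdiff_add_card_eq_card
        (show NN G V (u i) ⊆ V from fun y hy => ((mem_NN _ _ _ _).mp hy).1)
      have hc' : (S.card : ℝ) ≤
        (V \ NN G V (u i)).card := by exact_mod_cast hc
      have hc2' : ((V \ NN G V (u i)).card : ℝ) + (NN G V (u i)).card = V.card := by
        exact_mod_cast hc2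
      linarith [h i hi]
    · have : S = ∅ := by
        rw [Finset.eq_empty_iff_forall_notMem]
        intro y hy
        obtain ⟨_, i, hi, _⟩ := hS y hy
        exact hex ⟨i, hi⟩
      rw [this]; simpa using hx
  have k1 := key (fun i => i.val = j.val) (fun i i' h h' => Fin.ext (by omega)) x1 hx1 h1
    _ (fun y hy => Finset.mem_filter.mp hy)
  have k2 := key (fun i => i.val + 1 = j.val) (fun i i' h h' => Fin.ext (by omega)) x2 hx2 h2
    _ (fun y hy => Finset.mem_filter.mp hy)
  have hV : V ⊆ AA G U V u j ∪ (V.filter (fun y => ∃ i : Fin a, i.val = j.val ∧ ¬ G.Adj (u i) y) ∪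
      V.filter (fun y => ∃ i : Fin a, i.val + 1 = j.val ∧ ¬ G.Adj (u i) y)) := by
    intro y hy
    rw [Finset.mem_union, Finset.mem_union, mem_AA, Finset.mem_filter, Finset.mem_filter]
    by_contra hcon
    push Not at hcon
    obtain ⟨c1, c2, c3⟩ := hcon
    obtain ⟨i, hi, hn⟩ := c1 hy
    rcases hi with hi | hi
    · exact hn (c2 hy i hi)
    · exact hn (c3 hy i hi)
  have e1 := (Finset.card_le_card hV).trans ((Finset.card_union_le _ _).trans
    (Nat.add_le_add_left (Finset.card_union_le _ _) _))
  have e2 : (V.card : ℝ) ≤ (AA G U V u j).card +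
    (((V.filter (fun y => ∃ i : Fin a, i.val = j.val ∧ ¬ G.Adj (u i) y)).card : ℝ) +
    ((V.filter (fun y => ∃ i : Fin a, i.val + 1 = j.val ∧ ¬ G.Adj (u i) y)).card : ℝ)) := by
    exact_mod_cast e1
  linarith

/-- counting paths with `k` vertices in a dense bipartite graph
(Lemma 2.10 of the paper). -/
theorem many_paths_dense :
    ∃ k₀ : ℕ, ∀ k : ℕ, k₀ ≤ k → ∀ (Om : Type) (G : SimpleGraph Om) (U V : Finset Om),
      Disjoint U V →
      (∀ x y, G.Adj x y → (x ∈ U ∧ y ∈ V) ∨ (x ∈ V ∧ y ∈ U)) →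
      ∀ β : ℝ, 0 < β → β < 1 / 10 ^ 4 →
      (3 * (k : ℝ) / 4 ≤ (V.card : ℝ)) → k / 2 ≤ U.card →
      1 - β ≤ dens G U V →
      ∀ δ : ℝ, 4 * Real.sqrt β * max (V.card : ℝ) (2 * U.card) ≤ δ →
      (∀ u ∈ U, δ ≤ (nbrCount G u V : ℝ)) →
      (δ / (4 * V.card)) ^ (2 * Real.sqrt β * (U.card : ℝ)) *
          (1 - 4 * Real.sqrt β * U.card / δ) ^ ((k : ℝ) / 2) *
          (1 - 6 * Real.sqrt β) ^ ((k : ℝ) / 2) *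
          (U.card.descFactorial (k / 2) : ℝ) * (V.card.descFactorial ((k + 1) / 2) : ℝ)
        ≤ (Nat.card {f : Fin k → Om // IsBipPathFromV G U V k f} : ℝ) := by
  classical
  refine ⟨2, ?_⟩
  intro k hk Om G U V hdisj _ β hβ0 hβ hVk hUk hdens δ hδ hdeg
  set s := Real.sqrt β with hsdef
  have hs0 : 0 < s := Real.sqrt_pos.mpr hβ0
  have hs2 : s ^ 2 = β := Real.sq_sqrt hβ0.le
  have hs : s < 1 / 100 := by
    rw [hsdef, Real.sqrt_lt' (by norm_num)]
    norm_num at hβ ⊢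
    exact hβ
  have hk2 : (2 : ℝ) ≤ k := by exact_mod_cast hk
  have hn0 : (0 : ℝ) < V.card := by linarith
  have hV0 : 0 < V.card := by exact_mod_cast hn0
  have hU0 : 0 < U.card := by omega
  have hm0 : (0 : ℝ) < U.card := by exact_mod_cast hU0
  have hδ1 : 4 * s * V.card ≤ δ :=
    le_trans (mul_le_mul_of_nonneg_left (le_max_left _ _) (by positivity)) hδ
  have hδ2 : 4 * s * (2 * U.card) ≤ δ :=
    le_trans (mul_le_mul_of_nonneg_left (le_max_right _ _) (by positivity)) hδ
  have hδ0 : 0 < δ := lt_of_lt_of_le (by positivity) hδ1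
  have hdeg' : ∀ u : ↥U, δ ≤ ((NN G V u).card : ℝ) := by
    intro u
    rw [← nbrCount_eq]
    exact hdeg u u.2
  have hNV : ∀ u, ((NN G V u).card : ℝ) ≤ V.card := by
    intro u
    exact_mod_cast Finset.card_le_card (fun y hy => ((mem_NN _ _ _ _).mp hy).1)
  have hδn : δ ≤ V.card := by
    obtain ⟨u, hu⟩ := Finset.card_pos.mp hU0
    exact (hdeg' ⟨u, hu⟩).trans (hNV u)
  obtain ⟨v0, -⟩ := Finset.card_pos.mp hV0
  let B : Finset ↥U := Finset.univ.filter (fun u => ((NN G V u).card : ℝ) ≤ (1 - s) * V.card)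
  have hBmem : ∀ u : ↥U, u ∈ B ↔ ((NN G V u).card : ℝ) ≤ (1 - s) * V.card := by
    intro u; simp [B]
  have hBc : (B.card : ℝ) ≤ s * U.card :=
    bad_card G U V s hs0 hU0 hV0 (by rw [hs2]; exact hdens) B (fun u hu => (hBmem u).mp hu)
  have hB5 : 5 * B.card ≤ Fintype.card ↥U := by
    rw [Fintype.card_coe]
    have : 5 * (B.card : ℝ) ≤ U.card := by nlinarith
    exact_mod_cast this
  have hX := XX_bound (k / 2) B hB5
  rw [Fintype.card_coe] at hX
  have hX' : (U.card.descFactorial (k / 2) : ℝ) ≤ 2 ^ B.card * ((XX (k / 2) B).card : ℝ) := by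
    exact_mod_cast hX
  have hgood : ∀ u : ↥U, u ∉ B → (V.card : ℝ) - s * V.card ≤ (NN G V u).card := by
    intro u hu
    rw [hBmem] at hu
    push Not at hu
    linarith
  have hq0 : 0 < δ / (2 * V.card) := by positivity
  have hq1 : δ / (2 * V.card) ≤ 1 := by
    rw [div_le_one (by positivity)]; linarith
  have hr0 : 0 < 1 - 6 * s := by linarith
  have hmain := count_paths G U V hdisj k (XX (k / 2) B) (fun u j => AA G U V u j) v0
    (fun u j y hy => (mem_AA G U V u j y).mp hy)
    ((δ / (2 * V.card)) ^ (2 * s * U.card) * (1 - 6 * s) ^ ((k : ℝ) / 2) *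
      (V.card.descFactorial ((k + 1) / 2) : ℝ)) (by
    intro u hu
    simp only [XX, Finset.mem_filter, Finset.mem_univ, true_and] at hu
    have hDc : ((DD U ((k + 1) / 2) B u).card : ℝ) ≤ 2 * B.card := by
      exact_mod_cast DD_card U ((k + 1) / 2) B u
    refine le_trans ?_ (vside k ((k + 1) / 2) V.card (fun j => AA G U V u j)
      (DD U ((k + 1) / 2) B u) v0 s δ hs0 hs hδ0 hk (by omega) (by omega) hVk ?_ ?_)
    · apply mul_le_mul_of_nonneg_right _ (Nat.cast_nonneg _)
      apply mul_le_mul_of_nonneg_right _ (by positivity)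
      rw [← Real.rpow_natCast]
      apply Real.rpow_le_rpow_of_exponent_ge hq0 hq1
      linarith
    · intro j hj
      have : (V.card : ℝ) - ((V.card - δ) + s * V.card) ≤ (AA G U V u j).card := by
        obtain ⟨i, hi | hi, hiB⟩ := (mem_DD _ _ _ _ _).mp hj
        · apply AA_card G U V u j _ _ (by linarith) (by positivity)
          · intro i' _
            linarith [hdeg' (u i')]
          · intro i' hi'
            apply hgood
            intro h
            exact hu i' i (by omega) ⟨h, hiB⟩
        · rw [add_comm]
          apply AA_card G U V u j _ _ (by positivity) (by linarith)
          · intro i' hi'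
            apply hgood
            intro h
            exact hu i i' (by omega) ⟨hiB, h⟩
          · intro i' _
            linarith [hdeg' (u i')]
      linarith
    · intro j hj
      rw [mem_DD] at hj
      push Not at hj
      have := AA_card G U V u j (s * V.card) (s * V.card) (by positivity) (by positivity)
        (fun i hi => hgood _ (hj i (Or.inl hi))) (fun i hi => hgood _ (hj i (Or.inr hi)))
      linarith)
  refine le_trans ?_ hmain
  have hz0 : 0 ≤ 1 - 4 * s * U.card / δ := by
    rw [sub_nonneg, div_le_one hδ0]
    nlinarith [mul_pos hs0 hm0]
  have hz1 : 1 - 4 * s * U.card / δ ≤ 1 := by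
    rw [sub_le_self_iff]; positivity
  have hz : (1 - 4 * s * U.card / δ) ^ ((k : ℝ) / 2) ≤ 1 :=
    Real.rpow_le_one hz0 hz1 (by positivity)
  have hw : (δ / (4 * V.card)) ^ (2 * s * U.card) * 2 ^ B.card ≤
      (δ / (2 * V.card)) ^ (2 * s * U.card) := by
    have e : δ / (2 * V.card) = δ / (4 * V.card) * 2 := by field_simp; norm_num
    rw [e, Real.mul_rpow (by positivity) (by norm_num)]
    apply mul_le_mul_of_nonneg_left _ (by positivity)
    rw [← Real.rpow_natCast]
    apply Real.rpow_le_rpow_of_exponent_le (by norm_num)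
    nlinarith [mul_pos hs0 hm0]
  calc _ ≤ (δ / (4 * V.card)) ^ (2 * s * U.card) * 1 * (1 - 6 * s) ^ ((k : ℝ) / 2) *
        (2 ^ B.card * ((XX (k / 2) B).card : ℝ)) * (V.card.descFactorial ((k + 1) / 2) : ℝ) := by
        gcongr
    _ = ((δ / (4 * V.card)) ^ (2 * s * U.card) * 2 ^ B.card) * ((1 - 6 * s) ^ ((k : ℝ) / 2) *
        (V.card.descFactorial ((k + 1) / 2) : ℝ) * ((XX (k / 2) B).card : ℝ)) := by ring
    _ ≤ (δ / (2 * V.card)) ^ (2 * s * U.card) * ((1 - 6 * s) ^ ((k : ℝ) / 2) *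
        (V.card.descFactorial ((k + 1) / 2) : ℝ) * ((XX (k / 2) B).card : ℝ)) := by
        gcongr
    _ = _ := by ring
end

section
/- Let 0 < ε ≤ 10^{−20}, d = 20√ε, and λ = 13√ε. For every positive integer M and real c ≥ (1−ε)/M, there exist c' > 0 and n_0 (depending on ε, M, c) such that the following holds for all n ≥ n_0. Let G be a graph on n vertices and suppose there are pairwise disjoint vertex subsets U_1,…,U_m,V_1,…,V_m with m ≥ (2/3+λ)M/2 and |U_i|, |V_i| ≥ cn for all i, such that each pair (U_i,V_i) is ε-regular in G with d(U_i,V_i) ≥ d−ε, and the union of all the sets U_i and V_i is (200M,6)-well-connected in G. Then G contains at least (c'k)^k copies of the path P_k, where k = ⌈2(n+1)/3⌉. -/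
open Finset

open Classical in
noncomputable def pdeg {V : Type*} (G : SimpleGraph V) (x : V) (B : Finset V) : ℕ :=
  (B.filter (fun y => G.Adj x y)).card

lemma eCnt_left {V : Type*} (G : SimpleGraph V) (A B : Finset V) :
    eCnt G A B = ∑ x ∈ A, pdeg G x B := by
  classical
  have : eCnt G A B = ((A ×ˢ B).filter (fun p => G.Adj p.1 p.2)).card := by
    unfold eCnt
    rw [← Nat.card_eq_finsetCard]
    refine Nat.card_congr (Equiv.subtypeEquivRight ?_)
    intro p
    simp [and_assoc]
  rw [this, Finset.card_filter, Finset.sum_product]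
  simp only [pdeg, Finset.card_filter]

def Many {V : Type*} (G : SimpleGraph V) (b a : V) (S : Set V) (L N : ℕ) : Prop :=
  ∃ F : Finset (List V), N ≤ F.card ∧ ∀ l ∈ F, l.length = L ∧ l.Nodup ∧ (∀ x ∈ l, x ∈ S) ∧
    List.IsChain G.Adj (b :: l) ∧ (b :: l).getLast (by simp) = a

lemma Many.mono {V : Type*} {G : SimpleGraph V} {b a : V} {S S' : Set V} {L N : ℕ}
    (h : Many G b a S L N) (hS : S ⊆ S') : Many G b a S' L N := by
  obtain ⟨F, hF, h⟩ := h
  refine ⟨F, hF, fun l hl => ?_⟩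
  obtain ⟨h1, h2, h3, h4, h5⟩ := h l hl
  exact ⟨h1, h2, fun x hx => hS (h3 x hx), h4, h5⟩

lemma Many.append {V : Type*} {G : SimpleGraph V} {b a e : V} {S S' : Set V} {L N L' N' : ℕ}
    (h : Many G b a S L N) (h' : Many G a e S' L' N') (hS : Disjoint S S') :
    Many G b e (S ∪ S') (L + L') (N * N') := by
  classical
  obtain ⟨F, hF, h⟩ := h
  obtain ⟨F', hF', h'⟩ := h'
  refine ⟨(F ×ˢ F').image (fun p => p.1 ++ p.2), ?_, ?_⟩
  · rw [Finset.card_image_of_injOn, Finset.card_product]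
    · exact Nat.mul_le_mul hF hF'
    · rintro ⟨p, q⟩ hp ⟨p', q'⟩ hp' heq
      simp only [Finset.coe_product, Set.mem_prod, Finset.mem_coe] at hp hp'
      have := List.append_inj heq ((h _ hp.1).1.trans (h _ hp'.1).1.symm)
      simp_all
  · intro l hl
    simp only [Finset.mem_image, Finset.mem_product, Prod.exists] at hl
    obtain ⟨p, q, ⟨hp, hq⟩, rfl⟩ := hl
    obtain ⟨h1, h2, h3, h4, h5⟩ := h p hp
    obtain ⟨g1, g2, g3, g4, g5⟩ := h' q hq
    refine ⟨by simp [h1, g1], ?_, ?_, ?_, ?_⟩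
    · rw [List.nodup_append]
      refine ⟨h2, g2, fun x hx y hy hxy => ?_⟩
      subst hxy
      exact Set.disjoint_left.1 hS (h3 _ hx) (g3 _ hy)
    · intro x hx
      rcases List.mem_append.1 hx with hx | hx
      · exact Or.inl (h3 _ hx)
      · exact Or.inr (g3 _ hx)
    · rw [← List.cons_append, List.isChain_append]
      refine ⟨h4, ?_, ?_⟩
      · exact (List.isChain_cons.1 g4).2
      · intro x hx y hy
        rw [List.getLast?_eq_getLast_of_ne_nil (by simp)] at hx
        simp only [h5, Option.mem_def, Option.some.injEq] at hx
        subst hx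
        exact (List.isChain_cons.1 g4).1 y hy
    · rcases eq_or_ne q [] with rfl | hq
      · simp at g5
        simp [h5, g5]
      · rw [List.getLast_cons hq] at g5
        rw [List.getLast_cons (by simp [hq]), List.getLast_append_of_ne_nil _ hq, g5]

lemma Many.cons {V : Type*} {G : SimpleGraph V} {x a : V} {S : Set V} {L N σ : ℕ}
    (Y : Finset V) (hY : σ ≤ Y.card) (hadj : ∀ y ∈ Y, G.Adj x y) (T : V → Set V)
    (hm : ∀ y ∈ Y, Many G y a (T y) L N) (hT : ∀ y ∈ Y, y ∉ T y) (hTS : ∀ y ∈ Y, T y ⊆ S)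
    (hyS : ∀ y ∈ Y, y ∈ S) :
    Many G x a S (L + 1) (σ * N) := by
  classical
  choose! F hF h using hm
  refine ⟨Y.biUnion (fun y => (F y).image (fun l => y :: l)), ?_, ?_⟩
  · rw [Finset.card_biUnion]
    · calc σ * N ≤ Y.card * N := Nat.mul_le_mul_right _ hY
        _ = ∑ y ∈ Y, N := by simp
        _ ≤ _ := Finset.sum_le_sum fun y hy => by
          rw [Finset.card_image_of_injective _ (fun _ _ h => (List.cons.inj h).2)]
          exact hF y hy
    · intro y _ z _ hyz
      refine Finset.disjoint_left.2 ?_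
      intro l hl hl'
      simp only [Finset.mem_image] at hl hl'
      obtain ⟨p, _, rfl⟩ := hl
      obtain ⟨q, _, hq⟩ := hl'
      exact hyz (List.cons.inj hq).1.symm
  · intro l hl
    simp only [Finset.mem_biUnion, Finset.mem_image] at hl
    obtain ⟨y, hy, p, hp, rfl⟩ := hl
    obtain ⟨h1, h2, h3, h4, h5⟩ := h y hy p hp
    refine ⟨by simp [h1], ?_, ?_, ?_, ?_⟩
    · exact List.nodup_cons.2 ⟨fun hyp => hT y hy (h3 y hyp), h2⟩
    · intro z hz
      rcases List.mem_cons.1 hz with rfl | hz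
      · exact hyS _ hy
      · exact hTS y hy (h3 z hz)
    · exact List.isChain_cons_cons.2 ⟨hadj y hy, h4⟩
    · rw [List.getLast_cons (by simp), h5]

lemma Many.nil {V : Type*} {G : SimpleGraph V} (a : V) : Many G a a ∅ 0 1 :=
  ⟨{[]}, by simp, by simp⟩

lemma Many.of_path {V : Type*} {G : SimpleGraph V} {a b : V} (w : G.Walk a b) (hw : w.IsPath) :
    Many G a b {x | x ∈ w.support.tail} w.length 1 := by
  refine ⟨{w.support.tail}, by simp, ?_⟩
  simp only [Finset.mem_singleton, forall_eq]
  refine ⟨by simp, hw.support_nodup.tail, fun x hx => hx, ?_, ?_⟩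
  · rw [w.cons_tail_support]; exact w.isChain_adj_support
  · simp 

/-- bad-vertex condition -/
def FewBad {V : Type*} (G : SimpleGraph V) (U W : Finset V) (ε ρ : ℝ) : Prop :=
  ∀ B ⊆ W, ε * W.card ≤ (B.card : ℝ) → ∀ A ⊆ U, (∀ x ∈ A, (pdeg G x B : ℝ) < ρ * B.card) →
    (A.card : ℝ) < ε * U.card

lemma eCnt_comm {V : Type*} (G : SimpleGraph V) (A B : Finset V) : eCnt G A B = eCnt G B A := by
  unfold eCnt
  refine Nat.card_congr ((Equiv.prodComm V V).subtypeEquiv ?_)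
  rintro ⟨x, y⟩
  simp [G.adj_comm]
  tauto

lemma dens_comm {V : Type*} (G : SimpleGraph V) (A B : Finset V) : dens G A B = dens G B A := by
  unfold _root_.dens; rw [eCnt_comm, mul_comm]

lemma IsRegularPair.symm {V : Type*} {G : SimpleGraph V} {U W : Finset V} {ε : ℝ}
    (h : IsRegularPair G U W ε) : IsRegularPair G W U ε := by
  intro A hA B hB h1 h2
  rw [dens_comm G A, dens_comm G W]
  exact h B hB A hA h2 h1

lemma fewBad_of_regular {V : Type*} {G : SimpleGraph V} {U W : Finset V} {ε ρ : ℝ}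
    (hε : 0 < ε) (hU : 0 < U.card) (hW : 0 < W.card)
    (h : IsRegularPair G U W ε) (hd : ρ + ε ≤ dens G U W) : FewBad G U W ε ρ := by
  intro B hB hB' A hA hdeg
  by_contra! hcon
  have hr := h A hA B hB hcon hB'
  have hU' : (0:ℝ) < U.card := by exact_mod_cast hU
  have hW' : (0:ℝ) < W.card := by exact_mod_cast hW
  have hA0 : (0:ℝ) < A.card := lt_of_lt_of_le (by positivity) hcon
  have hB0 : (0:ℝ) < B.card := lt_of_lt_of_le (by positivity) hB'
  have h1 : ρ ≤ dens G A B := by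
    have := (abs_le.1 hr).1
    linarith
  unfold _root_.dens at h1
  rw [le_div_iff₀ (by positivity), eCnt_left] at h1
  have hne : A.Nonempty := Finset.card_pos.1 (by exact_mod_cast hA0)
  have h2 := Finset.sum_lt_sum_of_nonempty hne hdeg
  push_cast at h1
  simp only [Finset.sum_const, nsmul_eq_mul] at h2
  nlinarith


/-- many good choices among a set of neighbours -/
lemma good_choices {V : Type*} {G : SimpleGraph V} {U W : Finset V} {ε ρ μ : ℝ}
    (hb : FewBad G U W ε ρ) {σ : ℕ} {U' B : Finset V} {x : V} (hU' : U' ⊆ U) (hB : B ⊆ W)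
    (hρ : 0 ≤ ρ) (hBε : ε * W.card ≤ (B.card : ℝ)) (hμ : μ ≤ B.card)
    (hx : σ + ε * U.card ≤ (pdeg G x U' : ℝ)) :
    ∃ Y ⊆ U', σ ≤ Y.card ∧ (∀ y ∈ Y, G.Adj x y) ∧ ∀ y ∈ Y, ρ * μ ≤ (pdeg G y B : ℝ) := by
  classical
  set Nx := U'.filter (fun y => G.Adj x y) with hNx
  have hp : pdeg G x U' = Nx.card := by
    unfold pdeg; congr 1
  refine ⟨Nx.filter (fun y => ρ * B.card ≤ (pdeg G y B : ℝ)), ?_, ?_, ?_, ?_⟩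
  · exact (Finset.filter_subset _ _).trans (Finset.filter_subset _ _)
  · have h1 := hb B hB hBε (Nx.filter (fun y => ¬ ρ * B.card ≤ (pdeg G y B : ℝ)))
      (((Finset.filter_subset _ _).trans (Finset.filter_subset _ _)).trans hU')
      (by intro y hy; simpa using (Finset.mem_filter.1 hy).2)
    have h2 := Finset.card_filter_add_card_filter_not (s := Nx)
      (fun y => ρ * B.card ≤ (pdeg G y B : ℝ))
    rw [hp, ← h2] at hx
    push_cast at hx
    have : (σ : ℝ) ≤ ((Nx.filter (fun y => ρ * B.card ≤ (pdeg G y B : ℝ))).card : ℝ) := by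
      linarith
    exact_mod_cast this
  · intro y hy
    exact (Finset.mem_filter.1 (Finset.mem_filter.1 hy).1).2
  · intro y hy
    exact (mul_le_mul_of_nonneg_left hμ hρ).trans (Finset.mem_filter.1 hy).2

lemma grow {V : Type*} [DecidableEq V] {G : SimpleGraph V} {U W : Finset V} {ε ρ μU μW : ℝ}
    {σ : ℕ} (hUW : Disjoint U W) (H1 : FewBad G U W ε ρ) (H2 : FewBad G W U ε ρ) (hρ : 0 < ρ)
    (hμU : ε * U.card ≤ μU) (hμW : ε * W.card ≤ μW)
    (hσ0 : 1 ≤ σ)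
    (hσU : σ + ε * U.card ≤ ρ * μU) (hσW : σ + ε * W.card ≤ ρ * μW)
    {R : Finset V} (hR : R ⊆ W) (hRε : ε * W.card ≤ (R.card : ℝ)) (hRne : R.Nonempty) {a : V}
    (ha : ∀ r ∈ R, G.Adj r a) (haR : a ∉ R) :
    ∀ (t : ℕ) (U' W' : Finset V) (x : V), U' ⊆ U → W' ⊆ W → Disjoint W' R → a ∉ U' → a ∉ W' →
      t + μU ≤ U'.card → t + μW ≤ W'.card → ρ * μU ≤ (pdeg G x U' : ℝ) →
      Many G x a (↑U' ∪ ↑W' ∪ ↑R ∪ {a}) (2 * t + 3) (σ ^ (2 * t)) := by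
  intro t
  induction t with
  | zero =>
    intro U' W' x hU' hW' hWR haU haW hcU hcW hx
    obtain ⟨Y, hYU, hYc, hYa, hYd⟩ := good_choices H1 hU' hR hρ.le hRε le_rfl (hσU.trans hx)
    have hYne : Y.Nonempty := Finset.card_pos.1 (by omega)
    obtain ⟨y, hy⟩ := hYne
    have h1 := hYd y hy
    have h2 : 0 < pdeg G y R := by
      have : (0:ℝ) < R.card := by exact_mod_cast Finset.card_pos.2 hRne
      have : (0:ℝ) < pdeg G y R := lt_of_lt_of_le (by positivity) h1
      exact_mod_cast this
    unfold pdeg at h2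
    obtain ⟨r, hr⟩ := Finset.card_pos.1 h2
    simp only [Finset.mem_filter] at hr
    have hyU := hYU hy
    have hyr : y ≠ r := hr.2.ne
    have hya : y ≠ a := fun h => haU (h ▸ hyU)
    have hra : r ≠ a := fun h => haR (h ▸ hr.1)
    refine ⟨{[y, r, a]}, by simp, ?_⟩
    simp only [Finset.mem_singleton, forall_eq]
    refine ⟨rfl, by simp [hyr, hya, hra], ?_, ?_, by simp⟩
    · intro z hz
      simp only [List.mem_cons, List.not_mem_nil, or_false] at hz
      rcases hz with rfl | rfl | rfl
      · simp [hyU]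
      · simp [hr.1]
      · simp
    · simp [hYa y hy, hr.2, ha r hr.1]
  | succ t ih =>
    intro U' W' x hU' hW' hWR haU haW hcU hcW hx
    push_cast at hcU hcW
    have ht0 : (0:ℝ) ≤ t := by positivity
    obtain ⟨Y, hYU, hYc, hYa, hYd⟩ := good_choices (μ := μW) H1 hU' hW' hρ.le
      (by linarith) (by linarith) (hσU.trans hx)
    have key : ∀ y ∈ Y, Many G y a (↑(U'.erase y) ∪ ↑W' ∪ ↑R ∪ {a}) (2 * t + 3 + 1)
        (σ * σ ^ (2 * t)) := by
      intro y hy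
      have hyU := hYU hy
      have hce : t + μU ≤ ((U'.erase y).card : ℝ) := by
        have : (((U'.erase y).card + 1 : ℕ) : ℝ) = U'.card := by
          rw [Finset.card_erase_add_one hyU]
        push_cast at this
        linarith
      obtain ⟨Z, hZW, hZc, hZa, hZd⟩ := good_choices (μ := μU) H2 hW'
        ((Finset.erase_subset y U').trans hU') hρ.le
        (by linarith) (by linarith) (hσW.trans (hYd y hy))
      refine Many.cons Z hZc hZa (fun z => ↑(U'.erase y) ∪ ↑(W'.erase z) ∪ ↑R ∪ {a}) ?_ ?_ ?_ ?_
      · intro z hz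
        have hzW := hZW hz
        refine ih _ _ z ((Finset.erase_subset y U').trans hU')
          ((Finset.erase_subset z W').trans hW') ?_ ?_ ?_ hce ?_ (hZd z hz)
        · exact hWR.mono_left (Finset.erase_subset _ _)
        · exact fun h => haU (Finset.mem_of_mem_erase h)
        · exact fun h => haW (Finset.mem_of_mem_erase h)
        · have : (((W'.erase z).card + 1 : ℕ) : ℝ) = W'.card := by
            rw [Finset.card_erase_add_one hzW]
          push_cast at this
          linarith
      · intro z hz
        have hzW := hZW hz
        have h1 : z ∉ U' := fun h => Finset.disjoint_left.1 hUW (hU' h) (hW' hzW)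
        have h2 : z ∉ R := Finset.disjoint_left.1 hWR hzW
        have h3 : z ≠ a := fun h => haW (h ▸ hzW)
        simp [h1, h2, h3]
      · intro z hz
        have : (↑(W'.erase z) : Set V) ⊆ ↑W' := by exact_mod_cast Finset.erase_subset z W'
        intro q hq
        simp only [Set.mem_union] at hq ⊢
        rcases hq with ((h | h) | h) | h
        · tauto
        · have := this h; tauto
        · tauto
        · tauto
      · intro z hz
        have := hZW hz
        simp [this]
    have e1 : 2 * (t + 1) + 3 = 2 * t + 3 + 1 + 1 := by ring
    have e2 : σ ^ (2 * (t + 1)) = σ * (σ * σ ^ (2 * t)) := by ring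
    rw [e1, e2]
    refine Many.cons Y hYc hYa _ key ?_ ?_ ?_
    · intro z hz
      have hzU := hYU hz
      have h1 : z ∉ W' := fun h => Finset.disjoint_left.1 hUW (hU' hzU) (hW' h)
      have h2 : z ∉ R := fun h => Finset.disjoint_left.1 hUW (hU' hzU) (hR h)
      have h3 : z ≠ a := fun h => haU (h ▸ hzU)
      simp [h1, h2, h3]
    · intro z hz
      have : (↑(U'.erase z) : Set V) ⊆ ↑U' := by exact_mod_cast Finset.erase_subset z U'
      intro q hq
      simp only [Set.mem_union] at hq ⊢
      rcases hq with ((h | h) | h) | h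
      · have := this h; tauto
      · tauto
      · tauto
      · tauto
    · intro z hz
      have := hYU hz
      simp [this]

lemma connector {V : Type*} {G : SimpleGraph V} {S : Set V} {T l : ℕ}
    (h : WellConnected G S T l) {u v : V} (hu : u ∈ S) (hv : v ∈ S) (huv : u ≠ v)
    (X : Finset V) (hX : X.card < T) (hXu : u ∉ X) (hXv : v ∉ X) :
    ∃ w : G.Walk u v, w.IsPath ∧ w.length ≤ l ∧ ∀ x ∈ w.support, x ∉ X := by
  obtain ⟨P, -, h1, h2⟩ := h u hu v hv huv
  by_contra! hcon
  choose f hf hfX using fun i => hcon (P i) (h1 i).1 (h1 i).2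
  have hinj : Function.Injective f := by
    intro i j hij
    by_contra hne
    rcases h2 i j hne (f i) (hf i) (hij ▸ hf j) with h | h
    · exact hXu (h ▸ hfX i)
    · exact hXv (h ▸ hfX i)
  have := Finset.card_le_card_of_injOn (s := Finset.univ) (t := X) f (fun i _ => hfX i)
    hinj.injOn
  simp at this
  omega

/-- choose the connectors greedily -/
lemma connectors {V : Type*} [DecidableEq V] {G : SimpleGraph V} {S : Set V} {m Q : ℕ}
    (h : WellConnected G S Q 6) (hQ : 8 * m < Q) (a b : ℕ → V) (T : Finset V)
    (hT : T.card ≤ 2 * m)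
    (haS : ∀ i < m, a i ∈ S) (hbS : ∀ i < m, b i ∈ S)
    (haT : ∀ i < m, a i ∈ T) (hbT : ∀ i < m, b i ∈ T)
    (hab : ∀ i < m, ∀ j < m, a i ≠ b j)
    (hbb : ∀ i < m, ∀ j < m, i ≠ j → b i ≠ b j) :
    ∀ j, j + 1 ≤ m → ∃ R : ℕ → Finset V,
      (∀ i < j, ∃ l ≤ 6, Many G (a i) (b (i+1)) ↑(R i) l 1) ∧
      (∀ i < j, (R i).card ≤ 6) ∧
      (∀ i < j, ∀ x ∈ R i, x ∈ T → x = b (i+1)) ∧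
      (∀ i < j, ∀ i' < j, i ≠ i' → Disjoint (R i) (R i')) := by
  intro j
  induction j with
  | zero => intro _; exact ⟨fun _ => ∅, by simp, by simp, by simp, by simp⟩
  | succ j ih =>
    intro hj
    obtain ⟨R, h1, h2, h3, h4⟩ := ih (by omega)
    set X := ((T ∪ (Finset.range j).biUnion R).erase (a j)).erase (b (j+1)) with hX
    have hXc : X.card < Q := by
      have e1 : X.card ≤ (T ∪ (Finset.range j).biUnion R).card :=
        (Finset.card_erase_le).trans Finset.card_erase_le
      have e2 := Finset.card_union_le T ((Finset.range j).biUnion R)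
      have e3 : ((Finset.range j).biUnion R).card ≤ (Finset.range j).card * 6 :=
        Finset.card_biUnion_le_card_mul _ _ _ (fun i hi => h2 i (Finset.mem_range.1 hi))
      rw [Finset.card_range] at e3
      omega
    obtain ⟨w, hw, hwl, hwX⟩ := connector h (haS j (by omega)) (hbS (j+1) (by omega))
      (hab j (by omega) (j+1) (by omega)) X hXc (by simp [hX]) (by simp [hX])
    set C : Finset V := w.support.tail.toFinset with hC
    have haC : a j ∉ C := by
      have := hw.support_nodup
      rw [← w.cons_tail_support] at this
      simpa [hC] using (List.nodup_cons.1 this).1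
    have hCX : ∀ x ∈ C, x ≠ b (j+1) → x ∉ T ∧ ∀ i < j, x ∉ R i := by
      intro x hx hxb
      have hxa : x ≠ a j := fun h => haC (h ▸ hx)
      have := hwX x (List.mem_of_mem_tail (by simpa [hC] using hx))
      simp only [hX, Finset.mem_erase, Finset.mem_union, Finset.mem_biUnion, Finset.mem_range,
        not_and, not_or, not_exists] at this
      have := this hxb hxa
      exact ⟨this.1, fun i hi => this.2 i hi⟩
    have hCR : ∀ i < j, Disjoint C (R i) := by
      intro i hi
      rw [Finset.disjoint_left]
      intro x hx hxR
      by_cases hxb : x = b (j+1)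
      · have := h3 i hi x hxR (hxb ▸ hbT (j+1) (by omega))
        exact hbb (j+1) (by omega) (i+1) (by omega) (by omega) (hxb.symm.trans this)
      · exact (hCX x hx hxb).2 i hi hxR
    refine ⟨Function.update R j C, ?_, ?_, ?_, ?_⟩
    · intro i hi
      rcases eq_or_ne i j with rfl | hne
      · refine ⟨w.length, hwl, ?_⟩
        rw [Function.update_self]
        exact (Many.of_path w hw).mono (by intro x hx; simpa [hC] using hx)
      · rw [Function.update_of_ne hne]
        exact h1 i (by omega)
    · intro i hi
      rcases eq_or_ne i j with rfl | hne
      · rw [Function.update_self]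
        refine (List.toFinset_card_le _).trans ?_
        simpa using hwl
      · rw [Function.update_of_ne hne]
        exact h2 i (by omega)
    · intro i hi
      rcases eq_or_ne i j with rfl | hne
      · rw [Function.update_self]
        intro x hx hxT
        by_contra hxb
        exact (hCX x hx hxb).1 hxT
      · rw [Function.update_of_ne hne]
        exact h3 i (by omega)
    · intro i hi i' hi' hii
      rcases eq_or_ne i j with rfl | hne
      · rw [Function.update_self, Function.update_of_ne hii.symm]
        exact hCR i' (by omega)
      · rw [Function.update_of_ne hne]
        rcases eq_or_ne i' j with rfl | hne'
        · rw [Function.update_self]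
          exact (hCR i (by omega)).symm
        · rw [Function.update_of_ne hne']
          exact h4 i (by omega) i' (by omega) hii

lemma glue_s16 {V : Type*} {G : SimpleGraph V} {m L N : ℕ} (a b : ℕ → V) (Q R : ℕ → Set V)
    (hQ : ∀ i < m, Many G (b i) (a i) (Q i) L N)
    (hR : ∀ i, i + 1 < m → ∃ l ≤ 6, Many G (a i) (b (i+1)) (R i) l 1)
    (hQQ : ∀ i < m, ∀ j < m, i ≠ j → Disjoint (Q i) (Q j))
    (hRR : ∀ i, i + 1 < m → ∀ j, j + 1 < m → i ≠ j → Disjoint (R i) (R j))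
    (hQR : ∀ i < m, ∀ j, j + 1 < m → Disjoint (Q i) (R j)) :
    ∀ j < m, ∃ K, (j + 1) * L ≤ K ∧ K ≤ (j + 1) * L + 6 * j ∧
      Many G (b 0) (a j) {x | (∃ i ≤ j, x ∈ Q i) ∨ ∃ i < j, x ∈ R i} K (N ^ (j + 1)) := by
  intro j
  induction j with
  | zero =>
    intro h0
    refine ⟨L, by simp, by simp, ?_⟩
    simpa using hQ 0 h0
  | succ j ih =>
    intro hj
    obtain ⟨K, h1, h2, h3⟩ := ih (by omega)
    obtain ⟨l, hl, hm⟩ := hR j hj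
    have := (h3.append hm ?_).append (hQ (j+1) hj) ?_
    · refine ⟨K + l + L, by linarith, by linarith, ?_⟩
      rw [show N ^ (j + 1 + 1) = N ^ (j + 1) * 1 * N by ring]
      refine this.mono ?_
      rintro x ((( ⟨i, hi, hx⟩ | ⟨i, hi, hx⟩) | hx) | hx)
      · exact Or.inl ⟨i, by omega, hx⟩
      · exact Or.inr ⟨i, by omega, hx⟩
      · exact Or.inr ⟨j, by omega, hx⟩
      · exact Or.inl ⟨j + 1, by omega, hx⟩
    · rw [Set.disjoint_left]
      rintro x (⟨i, hi, hx⟩ | ⟨i, hi, hx⟩) hx'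
      · exact Set.disjoint_left.1 (hQR i (by omega) j hj) hx hx'
      · exact Set.disjoint_left.1 (hRR i (by omega) j hj (by omega)) hx hx'
    · rw [Set.disjoint_left]
      rintro x ((⟨i, hi, hx⟩ | ⟨i, hi, hx⟩) | hx) hx'
      · exact Set.disjoint_left.1 (hQQ i (by omega) (j+1) hj (by omega)) hx hx'
      · exact Set.disjoint_left.1 (hQR (j+1) hj i (by omega)) hx' hx
      · exact Set.disjoint_left.1 (hQR (j+1) hj j (by omega)) hx' hx

lemma pdeg_sdiff {V : Type*} [DecidableEq V] (G : SimpleGraph V) (x : V) (B X : Finset V) :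
    pdeg G x B ≤ pdeg G x (B \ X) + X.card := by
  classical
  unfold pdeg
  refine (Finset.card_le_card ?_).trans (Finset.card_union_le _ _)
  intro y hy
  simp only [Finset.mem_union, Finset.mem_filter, Finset.mem_sdiff] at hy ⊢
  tauto

lemma core {V : Type*} [DecidableEq V] {G : SimpleGraph V} {S : Set V} {m Qn t σ : ℕ}
    (hm : 0 < m) (h : WellConnected G S Qn 6) (hQn : 8 * m < Qn) (U W : ℕ → Finset V) (ε ρ : ℝ)
    (hε : 0 < ε) (hρ : 0 < ρ) (hσ0 : 1 ≤ σ) (μU μW : ℕ → ℝ)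
    (hUS : ∀ i < m, ↑(U i) ⊆ S) (hWS : ∀ i < m, ↑(W i) ⊆ S)
    (hUU : ∀ i < m, ∀ j < m, i ≠ j → Disjoint (U i) (U j))
    (hWW : ∀ i < m, ∀ j < m, i ≠ j → Disjoint (W i) (W j))
    (hUW : ∀ i < m, ∀ j < m, Disjoint (U i) (W j))
    (H1 : ∀ i < m, FewBad G (U i) (W i) ε ρ) (H2 : ∀ i < m, FewBad G (W i) (U i) ε ρ)
    (hμU : ∀ i < m, ε * (U i).card ≤ μU i) (hμW : ∀ i < m, ε * (W i).card ≤ μW i)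
    (hσU : ∀ i < m, σ + ε * (U i).card ≤ ρ * μU i)
    (hσW : ∀ i < m, σ + ε * (W i).card ≤ ρ * μW i)
    (a b : ℕ → V) (ha : ∀ i < m, a i ∈ U i) (hb : ∀ i < m, b i ∈ W i)
    (htU : ∀ i < m, t + μU i + 8 * m ≤ (U i).card)
    (htW : ∀ i < m, t + μW i + 8 * m + ε * (W i).card + 1 ≤ (W i).card)
    (hbd : ∀ i < m, ρ * μU i + 8 * m ≤ (pdeg G (b i) (U i) : ℝ))
    (had : ∀ i < m, ε * (W i).card + 1 + 8 * m ≤ (pdeg G (a i) (W i) : ℝ)) :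
    ∃ K b a S, m * (2 * t + 3) ≤ K ∧ K ≤ m * (2 * t + 3) + 6 * m ∧
      Many G b a S K ((σ ^ (2 * t)) ^ m) := by
  classical
  set T := (Finset.range m).image a ∪ (Finset.range m).image b with hTd
  have hT : T.card ≤ 2 * m := by
    refine (Finset.card_union_le _ _).trans ?_
    have e1 := Finset.card_image_le (s := Finset.range m) (f := a)
    have e2 := Finset.card_image_le (s := Finset.range m) (f := b)
    rw [Finset.card_range] at e1 e2
    omega
  have haT : ∀ i < m, a i ∈ T := fun i hi =>
    Finset.mem_union_left _ (Finset.mem_image_of_mem _ (Finset.mem_range.2 hi))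
  have hbT : ∀ i < m, b i ∈ T := fun i hi =>
    Finset.mem_union_right _ (Finset.mem_image_of_mem _ (Finset.mem_range.2 hi))
  have hab : ∀ i < m, ∀ j < m, a i ≠ b j := fun i hi j hj hij =>
    Finset.disjoint_left.1 (hUW i hi j hj) (ha i hi) (hij ▸ hb j hj)
  have haa : ∀ i < m, ∀ j < m, i ≠ j → a i ≠ a j := fun i hi j hj hne hij =>
    Finset.disjoint_left.1 (hUU i hi j hj hne) (ha i hi) (hij ▸ ha j hj)
  have hbb : ∀ i < m, ∀ j < m, i ≠ j → b i ≠ b j := fun i hi j hj hne hij =>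
    Finset.disjoint_left.1 (hWW i hi j hj hne) (hb i hi) (hij ▸ hb j hj)
  obtain ⟨R, r1, r2, r3, r4⟩ := connectors h hQn a b T hT (fun i hi => hUS i hi (ha i hi))
    (fun i hi => hWS i hi (hb i hi)) haT hbT hab hbb (m - 1) (by omega)
  set X := T ∪ (Finset.range (m - 1)).biUnion R with hXd
  have hXc : X.card ≤ 8 * m := by
    rw [hXd]
    have e2 := Finset.card_union_le T ((Finset.range (m - 1)).biUnion R)
    have e3 : ((Finset.range (m - 1)).biUnion R).card ≤ (Finset.range (m - 1)).card * 6 :=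
      Finset.card_biUnion_le_card_mul _ _ _ (fun i hi => r2 i (Finset.mem_range.1 hi))
    rw [Finset.card_range] at e3
    omega
  have hXc' : (X.card : ℝ) ≤ 8 * m := by exact_mod_cast hXc
  have haX : ∀ i < m, a i ∈ X := fun i hi => Finset.mem_union_left _ (haT i hi)
  have piece : ∀ i < m, Many G (b i) (a i) (↑((U i ∪ W i) \ X) ∪ {a i}) (2 * t + 3)
      (σ ^ (2 * t)) := by
    intro i hi
    -- reserved set
    have h1 : (⌈ε * (W i).card⌉₊) ≤ ((W i \ X).filter (fun y => G.Adj (a i) y)).card := by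
      have e1 := pdeg_sdiff G (a i) (W i) X
      have e2 : pdeg G (a i) (W i \ X) = ((W i \ X).filter (fun y => G.Adj (a i) y)).card := by
        unfold pdeg; congr
      rw [e2] at e1
      have e3 : (pdeg G (a i) (W i) : ℝ) ≤
        ((W i \ X).filter (fun y => G.Adj (a i) y)).card + X.card := by exact_mod_cast e1
      rw [Nat.ceil_le]
      linarith [had i hi]
    have hW0 : ¬ ε * (W i).card ≤ 0 := by
      have : 0 < (W i).card := Finset.card_pos.2 ⟨_, hb i hi⟩
      have : (0:ℝ) < (W i).card := by exact_mod_cast this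
      rw [not_le]; positivity
    · obtain ⟨P, hP, hPc⟩ := Finset.exists_subset_card_eq h1
      have hPmem : ∀ x ∈ P, x ∈ W i ∧ x ∉ X ∧ G.Adj (a i) x := by
        intro x hx
        have := hP hx
        simp only [Finset.mem_filter, Finset.mem_sdiff] at this
        tauto
      have hPW : P ⊆ W i := fun x hx => (hPmem x hx).1
      have hPc2 : (P.card : ℝ) < ε * (W i).card + 1 := by
        rw [hPc]; exact Nat.ceil_lt_add_one (by positivity)
      have hPc1 : ε * (W i).card ≤ (P.card : ℝ) := by
        rw [hPc]; exact Nat.le_ceil _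
      have hPne : P.Nonempty := by
        rw [← Finset.card_pos]
        have : (0:ℝ) < P.card := by linarith [not_le.1 hW0]
        exact_mod_cast this
      have hW' : ((W i).card : ℝ) ≤ ((W i \ X) \ P).card + X.card + P.card := by
        have e1 := Finset.card_le_card_sdiff_add_card (s := W i) (t := X)
        have e2 := Finset.card_le_card_sdiff_add_card (s := W i \ X) (t := P)
        exact_mod_cast (by omega : (W i).card ≤ ((W i \ X) \ P).card + X.card + P.card)
      have hU' : ((U i).card : ℝ) ≤ (U i \ X).card + X.card := by
        exact_mod_cast Finset.card_le_card_sdiff_add_card (s := U i) (t := X)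
      have hbd' : (pdeg G (b i) (U i) : ℝ) ≤ pdeg G (b i) (U i \ X) + X.card := by
        exact_mod_cast pdeg_sdiff G (b i) (U i) X
      have := grow (hUW i hi i hi) (H1 i hi) (H2 i hi) hρ (hμU i hi) (hμW i hi) hσ0 (hσU i hi)
        (hσW i hi) hPW hPc1 hPne (a := a i) (fun r hr => (hPmem r hr).2.2.symm)
        (fun h => (hPmem _ h).2.1 (haX i hi)) t (U i \ X) ((W i \ X) \ P) (b i)
        Finset.sdiff_subset (Finset.sdiff_subset.trans Finset.sdiff_subset)
        Finset.sdiff_disjoint (by simp [haX i hi]) (by simp [haX i hi])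
        (by linarith [htU i hi]) (by linarith [htW i hi]) (by linarith [hbd i hi])
      refine this.mono ?_
      intro x hx
      simp only [Set.mem_union, Finset.mem_coe, Finset.mem_sdiff, Finset.mem_union,
        Set.mem_singleton_iff] at hx ⊢
      have := hPmem x
      tauto
  obtain ⟨K, k1, k2, k3⟩ := glue_s16 a b (fun i => ↑((U i ∪ W i) \ X) ∪ {a i}) (fun i => ↑(R i)) piece
    (fun i hi => r1 i (by omega)) (by
      intro i hi j hj hij
      rw [Set.disjoint_left]
      intro x hx hx'
      simp only [Set.mem_union, Finset.mem_coe, Finset.mem_sdiff, Finset.mem_union,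
        Set.mem_singleton_iff] at hx hx'
      rcases hx with ⟨hx, hxX⟩ | hx
      · rcases hx' with ⟨hx', _⟩ | hx'
        · rcases hx with hx | hx <;> rcases hx' with hx' | hx'
          · exact Finset.disjoint_left.1 (hUU i hi j hj hij) hx hx'
          · exact Finset.disjoint_left.1 (hUW i hi j hj) hx hx'
          · exact Finset.disjoint_left.1 (hUW j hj i hi) hx' hx
          · exact Finset.disjoint_left.1 (hWW i hi j hj hij) hx hx'
        · exact hxX (hx' ▸ haX j hj)
      · rcases hx' with ⟨_, hx'⟩ | hx'
        · exact hx' (hx ▸ haX i hi)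
        · exact haa i hi j hj hij (hx.symm.trans hx'))
    (fun i hi j hj hij => by
      simpa using r4 i (by omega) j (by omega) hij)
    (by
      intro i hi j hj
      rw [Set.disjoint_left]
      intro x hx hx'
      simp only [Set.mem_union, Finset.mem_coe, Finset.mem_sdiff, 
        Set.mem_singleton_iff] at hx hx'
      rcases hx with ⟨hx, hxX⟩ | hx
      · exact hxX (Finset.mem_union_right _
          (Finset.mem_biUnion.2 ⟨j, Finset.mem_range.2 (by omega), hx'⟩))
      · have := r3 j (by omega) x hx' (hx ▸ haT i hi)
        exact hab i hi (j+1) (by omega) (hx.symm.trans this)) (m - 1) (by omega)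
  rw [Nat.sub_add_cancel hm] at k1 k2 k3
  exact ⟨K, _, _, _, k1, by omega, k3⟩

lemma Many.count {n k K N : ℕ} {G : SimpleGraph (Fin n)} {b a : Fin n} {S : Set (Fin n)}
    (h : Many G b a S K N) (hk : k ≤ K) :
    N ≤ Nat.card {f : Fin k → Fin n // IsPathSeq G k f} * n ^ (K - k) := by
  classical
  obtain ⟨F, hF, h⟩ := h
  have hlen : ∀ l : F, l.1.length = K := fun l => (h l.1 l.2).1
  let φ : F → {f : Fin k → Fin n // IsPathSeq G k f} × (Fin (K - k) → Fin n) := fun l =>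
    (⟨fun i => l.1[i.1]'(by rw [hlen l]; omega), by
      obtain ⟨h1, h2, h3, h4, h5⟩ := h l.1 l.2
      refine ⟨?_, ?_⟩
      · intro i j hij
        exact Fin.ext ((List.Nodup.getElem_inj_iff h2).1 hij)
      · intro i hi
        have := (List.isChain_cons.1 h4).2
        exact List.isChain_iff_getElem.1 this i.1 (by omega)⟩,
      fun i => l.1[k + i.1]'(by rw [hlen l]; omega))
  have hφ : Function.Injective φ := by
    intro l l' hl
    simp only [φ, Prod.mk.injEq, Subtype.mk.injEq] at hl
    obtain ⟨e1, e2⟩ := hl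
    apply Subtype.ext
    apply List.ext_getElem
    · rw [hlen, hlen]
    · intro i hi hi'
      by_cases hik : i < k
      · exact congrFun e1 ⟨i, hik⟩
      · have := congrFun e2 ⟨i - k, by rw [hlen] at hi; omega⟩
        have e : k + (i - k) = i := by omega
        simpa only [e] using this
  have := Nat.card_le_card_of_injective φ hφ
  rw [Nat.card_prod] at this
  simp only [Nat.card_eq_fintype_card, Fintype.card_coe, Fintype.card_fun, Fintype.card_fin] at this ⊢
  exact hF.trans this

lemma exists_typical {V : Type*} {G : SimpleGraph V} {U W : Finset V} {ε ρ : ℝ}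
    (hε : ε ≤ 1) (hU : 0 < U.card) (h : FewBad G U W ε ρ) :
    ∃ x ∈ U, ρ * W.card ≤ (pdeg G x W : ℝ) := by
  by_contra! hcon
  have hU' : (0:ℝ) < U.card := by exact_mod_cast hU
  have hW : (0:ℝ) ≤ W.card := by positivity
  have := h W subset_rfl (by nlinarith) U subset_rfl hcon
  nlinarith

/-- the final computation -/
lemma final_calc {n k P σ m M e : ℕ} {δ : ℝ} (hδ : 0 < δ) (hmM : m ≤ M) (hn : 0 < n)
    (hkn : k ≤ n) (hσn : σ ≤ n) (hσ1 : 1 ≤ σ) (hσδ : δ * n ≤ σ) (he : k ≤ e + 2 * m)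
    (hP : σ ^ e ≤ P * n ^ (9 * m)) (hbig : 3 * n ^ (11 * M) ≤ 4 ^ k) (hk1 : 1 ≤ δ / 4 * k) :
    (δ / 4 * k) ^ k ≤ ((P / 2 : ℕ) : ℝ) := by
  have h1 : σ ^ k ≤ P * n ^ (11 * M) := by
    calc σ ^ k ≤ σ ^ (e + 2 * m) := Nat.pow_le_pow_right hσ1 he
      _ = σ ^ e * σ ^ (2 * m) := pow_add _ _ _
      _ ≤ (P * n ^ (9 * m)) * n ^ (2 * m) := Nat.mul_le_mul hP (Nat.pow_le_pow_left hσn _)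
      _ = P * n ^ (11 * m) := by rw [mul_assoc, ← pow_add]; congr 2; ring
      _ ≤ _ := Nat.mul_le_mul_left _ (Nat.pow_le_pow_right hn (by omega))
  have h1' : (σ : ℝ) ^ k ≤ P * (n:ℝ) ^ (11 * M) := by exact_mod_cast h1
  have hb' : 3 * (n:ℝ) ^ (11 * M) ≤ 4 ^ k := by exact_mod_cast hbig
  have hkn' : (k:ℝ) ≤ n := by exact_mod_cast hkn
  have hn' : (0:ℝ) < n := by exact_mod_cast hn
  set y := (δ / 4 * k) ^ k with hy
  have hy1 : 1 ≤ y := one_le_pow₀ hk1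
  have h2 : 4 ^ k * y ≤ (σ:ℝ) ^ k := by
    rw [hy, ← mul_pow]
    apply pow_le_pow_left₀ (by positivity)
    nlinarith
  have hpow : (0:ℝ) < (n:ℝ) ^ (11 * M) := by positivity
  have h3 : 3 * y ≤ P := by
    have : 3 * y * (n:ℝ) ^ (11 * M) ≤ P * (n:ℝ) ^ (11 * M) := by nlinarith
    exact le_of_mul_le_mul_right this hpow
  have h4 : (P:ℝ) ≤ 2 * ((P / 2 : ℕ) : ℝ) + 1 := by
    exact_mod_cast (by omega : P ≤ 2 * (P / 2) + 1)
  linarith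

lemma eventually_big (M : ℕ) : ∃ n₁ : ℕ, ∀ n : ℕ, n₁ ≤ n →
    3 * n ^ (11 * M) ≤ 4 ^ ((2 * (n + 1) + 2) / 3) := by
  have h := tendsto_pow_const_div_const_pow_of_one_lt (11 * M) (r := (2:ℝ)) (by norm_num)
  have h2 := h.eventually (gt_mem_nhds (show (0:ℝ) < 1 / 3 by norm_num))
  obtain ⟨n₁, hn₁⟩ := Filter.eventually_atTop.1 h2
  refine ⟨n₁, fun n hn => ?_⟩
  have h3 := hn₁ n hn
  rw [div_lt_iff₀ (by positivity)] at h3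
  have h4 : 3 * n ^ (11 * M) ≤ 2 ^ n := by
    have : (3:ℝ) * (n:ℝ) ^ (11 * M) ≤ 2 ^ n := by linarith
    exact_mod_cast this
  refine h4.trans ?_
  rw [show (4:ℕ) = 2 ^ 2 by norm_num, ← pow_mul]
  exact Nat.pow_le_pow_right (by norm_num) (by omega)

/-- numerics for one cluster size `u` -/
lemma cluster_numerics {ε s u nn MM mm tt A : ℝ} (hs : 0 < s) (hs1 : s ≤ 1 / 10 ^ 10)
    (hε : ε = s ^ 2) (hM : 1 ≤ MM) (hn : 0 ≤ nn) (hu : (1 - ε) / MM * nn ≤ u)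
    (hm : (2 / 3 + 13 * s) * MM / 2 ≤ mm) (ht : tt * (2 * mm) ≤ (2 * nn + 4) / 3)
    (hA : A + 3 ≤ s * u) (hA0 : 0 ≤ A) :
    tt + 15 * s * u + A + ε * u + 1 ≤ u := by
  have hu0 : 0 < u := by
    by_contra h
    push Not at h
    nlinarith
  have h1 : (1 - ε) * nn ≤ u * MM := by
    rw [div_mul_eq_mul_div, div_le_iff₀ (by linarith)] at hu
    exact hu
  have h2 : tt ≤ (1 - 18 * s) * u + 2 := by
    by_contra! hc
    have hpos : 0 ≤ (1 - 18 * s) * u + 2 := by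
      have : 0 ≤ 1 - 18 * s := by linarith
      positivity
    have a1 : ((1 - 18 * s) * u + 2) * ((2 / 3 + 13 * s) * MM) < (2 * nn + 4) / 3 := by
      have : ((1 - 18 * s) * u + 2) * ((2 / 3 + 13 * s) * MM) ≤
          ((1 - 18 * s) * u + 2) * (2 * mm) := by
        apply mul_le_mul_of_nonneg_left _ hpos
        linarith
      have hmm : 0 < mm := lt_of_lt_of_le (by positivity) hm
      have : ((1 - 18 * s) * u + 2) * (2 * mm) < tt * (2 * mm) :=
        mul_lt_mul_of_pos_right hc (by linarith)
      linarith
    have a2 : 2 * ((2 / 3 + 13 * s) * MM) ≥ 4 / 3 := by nlinarith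
    have a3 : (1 - 18 * s) * (2 / 3 + 13 * s) * (u * MM) < 2 * nn / 3 := by nlinarith
    have a4 : (1 - 18 * s) * (2 / 3 + 13 * s) * ((1 - ε) * nn) < 2 * nn / 3 := by
      refine lt_of_le_of_lt (mul_le_mul_of_nonneg_left h1 ?_) a3
      have : 0 ≤ 1 - 18 * s := by linarith
      positivity
    have a5 : 2 / 3 ≤ (1 - 18 * s) * (2 / 3 + 13 * s) * (1 - ε) := by
      subst hε
      have : 2/3 + s/2 ≤ (1 - 18 * s) * (2 / 3 + 13 * s) := by nlinarith
      have h6 : (2/3 + s/2) * (1 - s^2) ≤ (1 - 18 * s) * (2 / 3 + 13 * s) * (1 - s^2) :=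
        mul_le_mul_of_nonneg_right this (by nlinarith)
      nlinarith
    nlinarith
  have h3 : ε * u ≤ s * u := by
    subst hε
    nlinarith [mul_pos hs hu0]
  nlinarith [mul_pos hs hu0]

set_option maxHeartbeats 2000000 in
/-- many paths `P_k`, `k = ⌈2(n+1)/3⌉`, in Case 1 of the stability lemma,
with `d = 20√ε` and `λ = 13√ε`. (Here `⌈2(n+1)/3⌉ = (2(n+1)+2)/3` with natural division.) -/
theorem paths_in_case_one (ε : ℝ) (hε0 : 0 < ε) (hε1 : ε ≤ 1 / 10 ^ 20)
    (M : ℕ) (hM : 0 < M) (c : ℝ) (hc : (1 - ε) / M ≤ c) :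
    ∃ c' : ℝ, 0 < c' ∧ ∃ n₀ : ℕ, ∀ n : ℕ, n₀ ≤ n →
      ∀ G : SimpleGraph (Fin n), ∀ m : ℕ,
        (2 / 3 + 13 * Real.sqrt ε) * M / 2 ≤ (m : ℝ) →
        ∀ Us Vs : Fin m → Finset (Fin n),
          (∀ i j, i ≠ j → Disjoint (Us i) (Us j)) →
          (∀ i j, i ≠ j → Disjoint (Vs i) (Vs j)) →
          (∀ i j, Disjoint (Us i) (Vs j)) →
          (∀ i, c * n ≤ ((Us i).card : ℝ) ∧ c * n ≤ ((Vs i).card : ℝ)) →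
          (∀ i, IsRegularPair G (Us i) (Vs i) ε ∧
            20 * Real.sqrt ε - ε ≤ dens G (Us i) (Vs i)) →
          WellConnected G
            ((⋃ i, ((Us i : Set (Fin n)))) ∪ ⋃ i, ((Vs i : Set (Fin n)))) (200 * M) 6 →
          (c' * (((2 * (n + 1) + 2) / 3 : ℕ) : ℝ)) ^ ((2 * (n + 1) + 2) / 3 : ℕ)
            ≤ (pathCount G ((2 * (n + 1) + 2) / 3) : ℝ) := by
  set s := Real.sqrt ε with hsd
  have hs : 0 < s := Real.sqrt_pos.2 hε0
  have hss : ε = s ^ 2 := (Real.sq_sqrt hε0.le).symm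
  have hs1 : s ≤ 1 / 10 ^ 10 := by
    rw [hsd, show (1 / 10 ^ 10 : ℝ) = Real.sqrt (1 / 10 ^ 20) by
      rw [show (1 / 10 ^ 20 : ℝ) = (1 / 10 ^ 10) ^ 2 by norm_num, Real.sqrt_sq (by norm_num)]]
    exact Real.sqrt_le_sqrt hε1
  have hM1 : (1:ℝ) ≤ M := by exact_mod_cast hM
  have hε2 : ε ≤ 1 / 2 := hε1.trans (by norm_num)
  have hc0 : 0 < c := lt_of_lt_of_le (div_pos (by linarith) (by linarith)) hc
  obtain ⟨n₁, hn₁⟩ := eventually_big M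
  set δ := ε * c with hδd
  have hδ : 0 < δ := mul_pos hε0 hc0
  obtain ⟨n₂, hn₂⟩ := exists_nat_ge ((8 * M + 3) / (s * c))
  obtain ⟨n₃, hn₃⟩ := exists_nat_ge (1 / (ε * c))
  obtain ⟨n₄, hn₄⟩ := exists_nat_ge (4 / δ * 2)
  refine ⟨δ / 4, by positivity, n₁ + n₂ + n₃ + n₄ + 4, ?_⟩
  intro n hn G m hm Us Vs hUU hVV hUV hcard hreg hwell
  have hn0 : (0:ℝ) < n := by exact_mod_cast (by omega : 0 < n)
  set k := (2 * (n + 1) + 2) / 3 with hk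
  have hm0 : 0 < m := by
    have : (0:ℝ) < m := lt_of_lt_of_le (by positivity) hm
    exact_mod_cast this
  -- cluster size facts
  have hsz : ∀ u : ℝ, c * n ≤ u → 8 * M + 3 ≤ s * u ∧ 1 ≤ ε * u ∧ (1 - ε) / M * n ≤ u ∧ 0 < u := by
    intro u hu
    have h2 : (8 * M + 3) / (s * c) ≤ n := hn₂.trans (by exact_mod_cast (by omega : n₂ ≤ n))
    have h3 : 1 / (ε * c) ≤ n := hn₃.trans (by exact_mod_cast (by omega : n₃ ≤ n))
    rw [div_le_iff₀ (by positivity)] at h2 h3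
    refine ⟨?_, ?_, ?_, ?_⟩
    · nlinarith
    · nlinarith
    · exact (mul_le_mul_of_nonneg_right hc hn0.le).trans hu
    · exact lt_of_lt_of_le (by positivity) hu
  -- m ≤ M
  have hmM : m ≤ M := by
    have h1 : ((Finset.univ : Finset (Fin m)).biUnion Us).card = ∑ i, (Us i).card :=
      Finset.card_biUnion (fun i _ j _ hij => hUU i j hij)
    have h2 : ((Finset.univ : Finset (Fin m)).biUnion Vs).card = ∑ i, (Vs i).card :=
      Finset.card_biUnion (fun i _ j _ hij => hVV i j hij)
    have h3 : Disjoint ((Finset.univ : Finset (Fin m)).biUnion Us)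
        ((Finset.univ : Finset (Fin m)).biUnion Vs) := by
      rw [Finset.disjoint_biUnion_left]
      intro i _
      rw [Finset.disjoint_biUnion_right]
      intro j _
      exact hUV i j
    have h4 := Finset.card_union_of_disjoint h3
    have h5 := Finset.card_le_univ ((Finset.univ : Finset (Fin m)).biUnion Us ∪
      (Finset.univ : Finset (Fin m)).biUnion Vs)
    rw [h4, h1, h2, Fintype.card_fin] at h5
    have h6 : (∑ i, ((Us i).card : ℝ)) + ∑ i, ((Vs i).card : ℝ) ≤ n := by exact_mod_cast h5
    have h7 : ∑ i : Fin m, c * (n:ℝ) ≤ ∑ i, ((Us i).card : ℝ) :=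
      Finset.sum_le_sum fun i _ => (hcard i).1
    have h8 : ∑ i : Fin m, c * (n:ℝ) ≤ ∑ i, ((Vs i).card : ℝ) :=
      Finset.sum_le_sum fun i _ => (hcard i).2
    simp only [Finset.sum_const, Finset.card_univ, Fintype.card_fin, nsmul_eq_mul] at h7 h8
    have h9 : 2 * (m * c) ≤ 1 := by
      have : 2 * (m * c) * n ≤ 1 * n := by linarith
      exact le_of_mul_le_mul_right this hn0
    have h10 : (1 - ε) ≤ c * M := by rwa [div_le_iff₀ (by linarith)] at hc
    have h11 : (m:ℝ) ≤ M := by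
      have : (m:ℝ) * c ≤ M * c := by nlinarith
      exact le_of_mul_le_mul_right this hc0
    exact_mod_cast h11
  have hmM' : (m:ℝ) ≤ M := by exact_mod_cast hmM
  set ρ := 20 * s - 2 * ε with hρd
  have hρ19 : 19 * s ≤ ρ := by rw [hρd, hss]; nlinarith
  have hρ : 0 < ρ := by linarith
  set σ := ⌈ε * c * n⌉₊ with hσd
  have hσδ : δ * n ≤ σ := Nat.le_ceil _
  have hσlt : (σ:ℝ) < ε * c * n + 1 := Nat.ceil_lt_add_one (by positivity)
  have hσ1 : 1 ≤ σ := Nat.one_le_ceil_iff.2 (by positivity)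
  set t := k / (2 * m) with htd
  have ht1 : t * (2 * m) ≤ k := Nat.div_mul_le_self _ _
  have ht2 : k < (t + 1) * (2 * m) := by
    have := Nat.lt_div_mul_add (a := k) (b := 2 * m) (by omega)
    rw [← htd] at this
    linarith
  have ht1' : (t:ℝ) * (2 * m) ≤ (2 * n + 4) / 3 := by
    have h1 : (t:ℝ) * (2 * m) ≤ k := by exact_mod_cast ht1
    have h2 : (3:ℝ) * k ≤ 2 * n + 4 := by exact_mod_cast (by omega : 3 * k ≤ 2 * n + 4)
    linarith
  have hρs : ∀ u : ℝ, 0 < u → ε * u * 200 ≤ ρ * (15 * s * u) := by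
    intro u hu
    have : 19 * s * (15 * s * u) ≤ ρ * (15 * s * u) :=
      mul_le_mul_of_nonneg_right hρ19 (by positivity)
    have h0 : 0 < s ^ 2 * u := by positivity
    rw [hss]
    nlinarith
  have hσu : ∀ u : ℝ, c * n ≤ u → σ + ε * u ≤ ρ * (15 * s * u) := by
    intro u hu
    obtain ⟨h1, h2, h3, h4⟩ := hsz u hu
    have := hρs u h4
    have h5 : ε * (c * n) ≤ ε * u := mul_le_mul_of_nonneg_left hu hε0.le
    linarith
  have hnum : ∀ u : ℝ, c * n ≤ u → t + 15 * s * u + 8 * m + ε * u + 1 ≤ u := by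
    intro u hu
    obtain ⟨h1, h2, h3, h4⟩ := hsz u hu
    have := cluster_numerics (A := 8 * M) hs hs1 hss hM1 hn0.le h3 hm ht1' h1 (by positivity)
    linarith
  have hεs : ∀ u : ℝ, 0 < u → ε * u ≤ 15 * s * u := by
    intro u hu
    rw [hss]
    have : 0 < s * u := by positivity
    nlinarith
  have hcl : ∀ i, 0 < (Us i).card ∧ 0 < (Vs i).card := by
    intro i
    obtain ⟨h1, h2⟩ := hcard i
    have a1 := (hsz _ h1).2.2.2
    have a2 := (hsz _ h2).2.2.2
    exact ⟨by exact_mod_cast a1, by exact_mod_cast a2⟩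
  have F1 : ∀ i, FewBad G (Us i) (Vs i) ε ρ := fun i =>
    fewBad_of_regular hε0 (hcl i).1 (hcl i).2 (hreg i).1 (by linarith [(hreg i).2])
  have F2 : ∀ i, FewBad G (Vs i) (Us i) ε ρ := fun i =>
    fewBad_of_regular hε0 (hcl i).2 (hcl i).1 (hreg i).1.symm
      (by rw [dens_comm]; linarith [(hreg i).2])
  choose a ha had using fun i => exists_typical (by linarith) (hcl i).1 (F1 i)
  choose b hb hbd using fun i => exists_typical (by linarith) (hcl i).2 (F2 i)
  -- extend indices to ℕ
  let ι : ℕ → Fin m := fun i => if h : i < m then ⟨i, h⟩ else ⟨0, hm0⟩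
  have hι : ∀ i < m, ∀ j < m, i ≠ j → ι i ≠ ι j := by
    intro i hi j hj hij h
    simp only [ι, hi, hj, dif_pos, Fin.mk.injEq] at h
    exact hij h
  obtain ⟨K, b0, a0, S0, k1, k2, k3⟩ := core (t := t) (σ := σ) hm0 hwell (by omega)
    (fun i => Us (ι i)) (fun i => Vs (ι i)) ε ρ hε0 hρ hσ1
    (fun i => 15 * s * (Us (ι i)).card) (fun i => 15 * s * (Vs (ι i)).card)
    (fun i _ => (Set.subset_iUnion (fun i => (Us i : Set (Fin n))) (ι i)).trans
      Set.subset_union_left)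
    (fun i _ => (Set.subset_iUnion (fun i => (Vs i : Set (Fin n))) (ι i)).trans
      Set.subset_union_right)
    (fun i hi j hj hij => hUU _ _ (hι i hi j hj hij))
    (fun i hi j hj hij => hVV _ _ (hι i hi j hj hij))
    (fun i hi j hj => hUV _ _)
    (fun i _ => F1 _) (fun i _ => F2 _)
    (fun i _ => hεs _ (hsz _ (hcard _).1).2.2.2)
    (fun i _ => hεs _ (hsz _ (hcard _).2).2.2.2)
    (fun i _ => hσu _ (hcard _).1) (fun i _ => hσu _ (hcard _).2)
    (fun i => a (ι i)) (fun i => b (ι i)) (fun i _ => ha _) (fun i _ => hb _)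
    (fun i _ => by
      have h1 := hnum _ (hcard (ι i)).1
      have h2 := (hsz _ (hcard (ι i)).1).2.1
      linarith)
    (fun i _ => hnum _ (hcard (ι i)).2)
    (fun i _ => by
      have h1 := hbd (ι i)
      obtain ⟨h2, h3, h4, h5⟩ := hsz _ (hcard (ι i)).1
      set u : ℝ := ((Us (ι i)).card : ℝ)
      have h6 : ρ * (15 * s * u) ≤ ρ * u / 2 := by
        have : 15 * s * u ≤ u / 2 := by nlinarith
        have := mul_le_mul_of_nonneg_left this hρ.le
        linarith
      have h7 : 19 * s * u ≤ ρ * u := mul_le_mul_of_nonneg_right hρ19 h5.le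
      linarith)
    (fun i _ => by
      have h1 := had (ι i)
      obtain ⟨h2, h3, h4, h5⟩ := hsz _ (hcard (ι i)).2
      set u : ℝ := ((Vs (ι i)).card : ℝ)
      have h7 : 19 * s * u ≤ ρ * u := mul_le_mul_of_nonneg_right hρ19 h5.le
      have h8 := hεs u h5
      linarith)
  have hkK : k ≤ K := by nlinarith
  have hcount := k3.count hkK
  rw [← pow_mul] at hcount
  have hKk : K - k ≤ 9 * m := by
    have : K ≤ k + 9 * m := by nlinarith
    omega
  have hσn : σ ≤ n := by
    have i0 : Fin m := ⟨0, hm0⟩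
    obtain ⟨h2, h3, h4, h5⟩ := hsz _ (hcard i0).1
    have h6 : ((Us i0).card : ℝ) ≤ n := by
      have := Finset.card_le_univ (Us i0)
      rw [Fintype.card_fin] at this
      exact_mod_cast this
    have h7 : ε * (c * n) ≤ ε * (Us i0).card := mul_le_mul_of_nonneg_left (hcard i0).1 hε0.le
    have h8 : ε * (Us i0).card ≤ 1 / 2 * (Us i0).card := mul_le_mul_of_nonneg_right hε2 h5.le
    have : (σ:ℝ) ≤ n := by linarith
    exact_mod_cast this
  unfold pathCount
  refine final_calc (σ := σ) (m := m) (M := M) (e := 2 * t * m) hδ hmM (by omega) (by omega) hσn hσ1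
    hσδ (by nlinarith) ?_ (hn₁ n (by omega)) ?_
  · refine hcount.trans (Nat.mul_le_mul_left _ (Nat.pow_le_pow_right (by omega) hKk))
  · have h1 : 4 / δ * 2 ≤ n := hn₄.trans (by exact_mod_cast (by omega : n₄ ≤ n))
    have h2 : (n:ℝ) ≤ 2 * k := by exact_mod_cast (by omega : n ≤ 2 * k)
    have h3 : 4 / δ ≤ k := by linarith
    rw [div_le_iff₀ hδ] at h3
    linarith
end
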